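/- For every ε₀ ∈ (0,1) there exists a constant C > 0 (depending only on ε₀ and on γ) such that for every positive integer m which is a sum of two squares and satisfies |τ̂_m(4)| < 1 − ε₀, the following approximate Kac–Rice formula holds: |Var(Z) − m·∫₀ᴸ∫₀ᴸ ( r(t₁,t₂)² − r₁(t₁,t₂)²/(2π²m) − r₂(t₁,t₂)²/(2π²m) + r₁₂(t₁,t₂)²/(2π²m)² ) dt₁ dt₂| ≤ C · m / N^{3/2}. -/

import Mathlib

open MeasureTheory ProbabilityTheory Real

noncomputable section

/-- The set of lattice points on the circle of radius `√m`:
`E = {μ ∈ ℤ² : μ₁² + μ₂² = m}` (all solutions satisfy `|μᵢ| ≤ m`). -/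
def latticeSet (m : ℕ) : Finset (ℤ × ℤ) :=
  (Finset.Icc (-(m : ℤ)) (m : ℤ) ×ˢ Finset.Icc (-(m : ℤ)) (m : ℤ)).filter
    (fun μ => μ.1 ^ 2 + μ.2 ^ 2 = (m : ℤ))

/-- `N = #E`, the number of lattice points on the circle of radius `√m`. -/
def latN (m : ℕ) : ℕ := (latticeSet m).card

/-- The probability space of the arithmetic random wave: `ℝ^E × ℝ^E`. -/
abbrev WaveSpace (m : ℕ) : Type :=
  (↥(latticeSet m) → ℝ) × (↥(latticeSet m) → ℝ)

/-- The Gaussian probability measure of the arithmetic random wave: the product of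
standard Gaussian measures on `ℝ^E × ℝ^E`. -/
def waveMeasure (m : ℕ) : Measure (WaveSpace m) :=
  (Measure.pi fun _ : ↥(latticeSet m) => gaussianReal 0 1).prod
    (Measure.pi fun _ : ↥(latticeSet m) => gaussianReal 0 1)

/-- The arithmetic random wave
`F(x) = N^{-1/2} ∑_{μ ∈ E} (b_μ cos(2π⟨μ,x⟩) + c_μ sin(2π⟨μ,x⟩))`. -/
def wave (m : ℕ) (ω : WaveSpace m) (x : ℝ × ℝ) : ℝ :=
  (Real.sqrt (latN m))⁻¹ *
    ∑ μ : ↥(latticeSet m),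
      (ω.1 μ * Real.cos (2 * π * (((μ : ℤ × ℤ).1 : ℝ) * x.1 + ((μ : ℤ × ℤ).2 : ℝ) * x.2)) +
       ω.2 μ * Real.sin (2 * π * (((μ : ℤ × ℤ).1 : ℝ) * x.1 + ((μ : ℤ × ℤ).2 : ℝ) * x.2)))

/-- The number of nodal intersections of the wave with the curve `γ` on `[0, L]`. -/
def nodalCount (m : ℕ) (γ : ℝ → ℝ × ℝ) (L : ℝ) (ω : WaveSpace m) : ℕ :=
  Set.ncard {t : ℝ | t ∈ Set.Icc 0 L ∧ wave m ω (γ t) = 0}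

/-- The covariance function of the wave restricted to the curve:
`r(t₁,t₂) = N⁻¹ ∑_{μ ∈ E} cos(2π⟨μ, γ(t₁) − γ(t₂)⟩)`. -/
def covFn (m : ℕ) (γ : ℝ → ℝ × ℝ) (t₁ t₂ : ℝ) : ℝ :=
  ((latN m : ℝ))⁻¹ *
    ∑ μ ∈ latticeSet m,
      Real.cos (2 * π * ((μ.1 : ℝ) * (γ t₁ - γ t₂).1 + (μ.2 : ℝ) * (γ t₁ - γ t₂).2))

/-- `r₁ = ∂r/∂t₁`. -/
def covFn1 (m : ℕ) (γ : ℝ → ℝ × ℝ) (t₁ t₂ : ℝ) : ℝ :=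
  deriv (fun s => covFn m γ s t₂) t₁

/-- `r₂ = ∂r/∂t₂`. -/
def covFn2 (m : ℕ) (γ : ℝ → ℝ × ℝ) (t₁ t₂ : ℝ) : ℝ :=
  deriv (fun s => covFn m γ t₁ s) t₂

/-- `r₁₂ = ∂²r/∂t₁∂t₂`. -/
def covFn12 (m : ℕ) (γ : ℝ → ℝ × ℝ) (t₁ t₂ : ℝ) : ℝ :=
  deriv (fun s => deriv (fun u => covFn m γ s u) t₂) t₁

/-- The fourth Fourier coefficient of the angular measure:
`τ̂_m(4) = (N m²)⁻¹ ∑_{μ ∈ E} (μ₁⁴ − 6 μ₁² μ₂² + μ₂⁴)`. -/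
def tauHat4 (m : ℕ) : ℝ :=
  ((latN m : ℝ) * (m : ℝ) ^ 2)⁻¹ *
    ∑ μ ∈ latticeSet m,
      ((μ.1 : ℝ) ^ 4 - 6 * (μ.1 : ℝ) ^ 2 * (μ.2 : ℝ) ^ 2 + (μ.2 : ℝ) ^ 4)

lemma mem_latticeSet {m : ℕ} {μ : ℤ × ℤ} :
    μ ∈ latticeSet m ↔ μ.1 ^ 2 + μ.2 ^ 2 = (m : ℤ) := by
  unfold latticeSet
  rw [Finset.mem_filter, Finset.mem_product, Finset.mem_Icc, Finset.mem_Icc]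
  refine ⟨fun h => h.2, fun h => ⟨⟨⟨?_, ?_⟩, ?_, ?_⟩, h⟩⟩ <;>
    nlinarith [sq_nonneg μ.1, sq_nonneg μ.2, sq_nonneg (μ.1 - 1), sq_nonneg (μ.1 + 1),
      sq_nonneg (μ.2 - 1), sq_nonneg (μ.2 + 1), Int.le_self_sq μ.1, Int.le_self_sq μ.2,
      Int.le_self_sq (-μ.1), Int.le_self_sq (-μ.2)]

/-- The Gaussian integers of norm `m`. -/
def gaussSet (m : ℕ) : Finset GaussianInt :=
  (latticeSet m).image fun μ => ⟨μ.1, μ.2⟩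

lemma mem_gaussSet {m : ℕ} {z : GaussianInt} : z ∈ gaussSet m ↔ z.norm = m := by
  rw [gaussSet, Finset.mem_image, Zsqrtd.norm_def]
  constructor
  · rintro ⟨μ, hμ, rfl⟩
    rw [mem_latticeSet] at hμ
    linear_combination hμ
  · intro h
    exact ⟨(z.re, z.im), mem_latticeSet.2 (by linear_combination h), rfl⟩

lemma card_gaussSet (m : ℕ) : (gaussSet m).card = latN m := by
  refine Finset.card_image_of_injective _ fun a b h => ?_
  simp only [Zsqrtd.mk.injEq] at h
  exact Prod.ext h.1 h.2

/-- A Gaussian integer of norm `p ^ k * n` is, up to a factor of norm `n`, a product of `k` or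
`k / 2` factors chosen among two conjugate primes. -/
lemma exists_factorization_of_norm {p : ℕ} (hp : p.Prime) :
    ∃ (x : GaussianInt) (h : ℕ → ℕ), (∀ k, h k ≤ k) ∧ ∀ (n : ℕ), ¬ p ∣ n → ∀ (k : ℕ)
      (z : GaussianInt), z.norm = ((p ^ k * n : ℕ) : ℤ) →
      ∃ i ≤ h k, ∃ w ∈ gaussSet n, z = x ^ i * star x ^ (h k - i) * w := by
  have hpu : ¬ IsUnit (p : GaussianInt) := by
    intro hu
    have := Zsqrtd.norm_eq_one_iff.2 hu
    rw [Zsqrtd.norm_natCast, ← Nat.cast_mul, Int.natAbs_natCast] at this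
    have := hp.one_lt
    nlinarith
  have hp0 : (p : GaussianInt) ≠ 0 := by exact_mod_cast hp.ne_zero
  obtain ⟨x, hx, hxp⟩ := WfDvdMonoid.exists_irreducible_factor hpu hp0
  have hxprime : Prime x := hx.prime
  have key : ∀ z : GaussianInt, (p : ℤ) ∣ z.norm → x ∣ z ∨ star x ∣ z := by
    intro z hz
    have h1 : (p : GaussianInt) ∣ z * star z := by
      rw [← Zsqrtd.norm_eq_mul_conj]
      obtain ⟨c, hc⟩ := hz
      exact ⟨c, by rw [hc]; push_cast; rfl⟩
    rcases hxprime.dvd_or_dvd (hxp.trans h1) with h | h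
    · exact Or.inl h
    · right
      have := map_dvd (starRingEnd GaussianInt) h
      rwa [starRingEnd_apply, starRingEnd_apply, star_star] at this
  have hstar : (star x).norm = x.norm := Zsqrtd.norm_conj x
  have hxn : x.norm.natAbs ∣ p ^ 2 := by
    obtain ⟨c, hc⟩ := hxp
    have := congrArg Zsqrtd.norm hc
    rw [Zsqrtd.norm_mul, Zsqrtd.norm_natCast] at this
    have := congrArg Int.natAbs this
    rw [Int.natAbs_mul, Int.natAbs_mul, Int.natAbs_natCast] at this
    exact ⟨_, by rw [← this, sq]⟩
  have hxnn : 0 ≤ x.norm := GaussianInt.norm_nonneg x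
  obtain ⟨j, hj, hjx⟩ := (Nat.dvd_prime_pow hp).1 hxn
  have hj0 : j ≠ 0 := by
    rintro rfl
    exact hx.not_isUnit (Zsqrtd.norm_eq_one_iff.1 (by simpa using hjx))
  have hxnorm : x.norm = (p : ℤ) ^ j := by
    rw [← Int.natAbs_of_nonneg hxnn, hjx]; push_cast; rfl
  have hpz : (p : ℤ) ≠ 0 := by exact_mod_cast hp.ne_zero
  refine ⟨x, fun k => k / j, fun k => Nat.div_le_self _ _, fun n hn k => ?_⟩
  induction k using Nat.strong_induction_on with
  | _ k ih =>
  intro z hz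
  by_cases hk : k = 0
  · subst hk
    exact ⟨0, by simp, z, mem_gaussSet.2 (by simpa using hz), by simp⟩
  have hdvd : (p : ℤ) ∣ z.norm := by
    rw [hz]; exact_mod_cast Dvd.dvd.mul_right (dvd_pow_self p hk) n
  have hdesc : ∀ y w : GaussianInt, y.norm = (p : ℤ) ^ j → z = y * w →
      j ≤ k ∧ w.norm = ((p ^ (k - j) * n : ℕ) : ℤ) := by
    intro y w hy hzy
    have h1 : (p : ℤ) ^ j * w.norm = p ^ k * n := by
      rw [← hy, ← Zsqrtd.norm_mul, ← hzy, hz]; push_cast; rfl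
    have hjk : j ≤ k := by
      by_contra! hlt
      obtain ⟨d, rfl⟩ : ∃ d, j = k + (d + 1) := ⟨j - k - 1, by omega⟩
      rw [pow_add, mul_assoc] at h1
      have h2 := mul_left_cancel₀ (pow_ne_zero k hpz) h1
      apply hn
      have : (p : ℤ) ∣ n := by
        rw [← h2, pow_succ]; exact ⟨(p : ℤ) ^ d * w.norm, by ring⟩
      exact_mod_cast this
    refine ⟨hjk, ?_⟩
    obtain ⟨d, rfl⟩ : ∃ d, k = j + d := ⟨k - j, by omega⟩
    rw [pow_add, mul_assoc] at h1
    have h2 := mul_left_cancel₀ (pow_ne_zero j hpz) h1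
    rw [h2]; simp
  have hdiv : j ≤ k → k / j = (k - j) / j + 1 := fun h => by
    rw [← Nat.sub_add_cancel h, Nat.add_div_right _ (Nat.pos_of_ne_zero hj0)]; simp
  rcases key z hdvd with ⟨w, hw⟩ | ⟨w, hw⟩
  · obtain ⟨hjk, hwn⟩ := hdesc x w hxnorm hw
    obtain ⟨i, hi, u, hu, hwu⟩ := ih (k - j) (by omega) w hwn
    refine ⟨i + 1, by dsimp only; rw [hdiv hjk]; exact Nat.succ_le_succ hi, u, hu, ?_⟩
    dsimp only
    rw [hw, hwu, hdiv hjk, Nat.add_sub_add_right]; ring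
  · obtain ⟨hjk, hwn⟩ := hdesc (star x) w (hstar.trans hxnorm) hw
    obtain ⟨i, hi, u, hu, hwu⟩ := ih (k - j) (by omega) w hwn
    dsimp only at hi
    refine ⟨i, by dsimp only; rw [hdiv hjk]; exact hi.trans (Nat.le_succ _), u, hu, ?_⟩
    dsimp only
    rw [hw, hwu, hdiv hjk, Nat.sub_add_comm hi]; ring

lemma latN_prime_pow_mul_le {p k n : ℕ} (hp : p.Prime) (hn : ¬ p ∣ n) :
    latN (p ^ k * n) ≤ (k + 1) * latN n := by
  obtain ⟨x, h, hh, H⟩ := exists_factorization_of_norm hp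
  rw [← card_gaussSet, ← card_gaussSet]
  calc (gaussSet (p ^ k * n)).card
      ≤ ((Finset.range (k + 1) ×ˢ gaussSet n).image
          fun q => x ^ q.1 * star x ^ (h k - q.1) * q.2).card := by
        refine Finset.card_le_card fun z hz => ?_
        obtain ⟨i, hi, w, hw, hzw⟩ := H n hn k z (mem_gaussSet.1 hz)
        refine Finset.mem_image.2 ⟨(i, w), Finset.mem_product.2 ⟨?_, hw⟩, hzw.symm⟩
        exact Finset.mem_range.2 (Nat.lt_succ_of_le (hi.trans (hh k)))
    _ ≤ (k + 1) * (gaussSet n).card := by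
        refine Finset.card_image_le.trans ?_
        rw [Finset.card_product, Finset.card_range]

lemma latN_le_card_divisors {m : ℕ} (hm : m ≠ 0) : latN m ≤ 4 * m.divisors.card := by
  induction m using Nat.strong_induction_on with
  | _ m ih =>
  by_cases h1 : m = 1
  · subst h1; decide
  have hp := Nat.minFac_prime h1
  obtain ⟨k, n, hn, hmn⟩ := Nat.exists_eq_pow_mul_and_not_dvd hm m.minFac hp.ne_one
  have hpm := Nat.minFac_dvd m
  generalize m.minFac = p at hp hn hmn hpm
  have hn0 : n ≠ 0 := by rintro rfl; simp at hn
  have hk : k ≠ 0 := by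
    rintro rfl
    rw [pow_zero, one_mul] at hmn
    exact hn (hmn ▸ hpm)
  have hlt : n < m := by
    rw [hmn]
    have := Nat.one_lt_pow hk hp.one_lt
    nlinarith [Nat.pos_of_ne_zero hn0]
  have hcop : Nat.Coprime (p ^ k) n := ((Nat.Prime.coprime_iff_not_dvd hp).2 hn).pow_left k
  rw [hmn, hcop.card_divisors_mul, Nat.divisors_prime_pow hp, Finset.card_map, Finset.card_range]
  calc latN (p ^ k * n) ≤ (k + 1) * latN n := latN_prime_pow_mul_le hp hn
    _ ≤ (k + 1) * (4 * n.divisors.card) := by gcongr; exact ih n hlt hn0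
    _ = 4 * ((k + 1) * n.divisors.card) := by ring

lemma exists_card_divisors_pow_le : ∃ C : ℕ, ∀ m : ℕ, m ≠ 0 → m.divisors.card ^ 9 ≤ C * m := by
  have h2 : ∀ k : ℕ, (k + 1) ^ 9 ≤ 9 ^ 9 * 2 ^ k := by
    intro k
    have h : k + 1 ≤ 9 * 2 ^ (k / 9) := by
      have := (Nat.lt_two_pow_self (n := k / 9))
      omega
    calc (k + 1) ^ 9 ≤ (9 * 2 ^ (k / 9)) ^ 9 := Nat.pow_le_pow_left h 9
      _ = 9 ^ 9 * 2 ^ (k / 9 * 9) := by rw [mul_pow, ← pow_mul]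
      _ ≤ 9 ^ 9 * 2 ^ k := by gcongr; · norm_num
                              · exact Nat.div_mul_le_self k 9
  obtain ⟨K, hK⟩ : ∃ K : ℕ, K = 9 ^ 9 := ⟨_, rfl⟩
  rw [← hK] at h2
  obtain ⟨P, hP⟩ : ∃ P : ℕ, P = 512 := ⟨_, rfl⟩
  refine ⟨K ^ P, fun m hm => ?_⟩
  rw [Nat.card_divisors hm, ← Finset.prod_pow]
  calc ∏ p ∈ m.primeFactors, (m.factorization p + 1) ^ 9
      ≤ ∏ p ∈ m.primeFactors, ((if p < P then K else 1) * p ^ m.factorization p) := by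
        refine Finset.prod_le_prod' fun p hp => ?_
        have hpp := (Nat.prime_of_mem_primeFactors hp).two_le
        split_ifs with h
        · exact (h2 _).trans (by gcongr)
        · rw [one_mul]
          calc (m.factorization p + 1) ^ 9 ≤ (2 ^ m.factorization p) ^ 9 :=
                Nat.pow_le_pow_left Nat.lt_two_pow_self 9
            _ = (2 ^ 9) ^ m.factorization p := by rw [← pow_mul, ← pow_mul, mul_comm]
            _ ≤ p ^ m.factorization p := Nat.pow_le_pow_left (by omega) _
    _ = (∏ p ∈ m.primeFactors, if p < P then K else 1) * m := by
        rw [Finset.prod_mul_distrib]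
        congr 1
        exact Nat.prod_factorization_pow_eq_self hm
    _ ≤ K ^ P * m := by
        gcongr
        rw [← Finset.prod_filter, Finset.prod_const]
        refine Nat.pow_le_pow_right (by rw [hK]; norm_num) ?_
        calc _ ≤ (Finset.range P).card := Finset.card_le_card fun p hp => by
              simpa using (Finset.mem_filter.1 hp).2
          _ = P := by simp

lemma exists_latN_pow_le : ∃ C : ℕ, 0 < C ∧ ∀ m : ℕ, m ≠ 0 → latN m ^ 9 ≤ C * m := by
  obtain ⟨C, hC⟩ := exists_card_divisors_pow_le
  refine ⟨4 ^ 9 * C + 1, by positivity, fun m hm => ?_⟩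
  calc latN m ^ 9 ≤ (4 * m.divisors.card) ^ 9 := Nat.pow_le_pow_left (latN_le_card_divisors hm) 9
    _ = 4 ^ 9 * m.divisors.card ^ 9 := by rw [mul_pow]
    _ ≤ 4 ^ 9 * (C * m) := by gcongr; exact hC m hm
    _ ≤ (4 ^ 9 * C + 1) * m := by nlinarith

/-- The squared Euclidean length of an integer vector. -/
def sqLen (v : ℤ × ℤ) : ℤ := v.1 ^ 2 + v.2 ^ 2

lemma sqLen_pos {v : ℤ × ℤ} (hv : v ≠ 0) : 0 < sqLen v := by
  unfold sqLen
  rcases eq_or_ne v.1 0 with h1 | h1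
  · have h2 : v.2 ≠ 0 := fun h2 => hv (Prod.ext h1 h2)
    positivity
  · positivity

lemma card_latticeSet_filter_sub_mem_le {m : ℕ} {w : ℤ × ℤ} (hw : w ≠ 0) :
    ((latticeSet m).filter fun μ => w - μ ∈ latticeSet m).card ≤ 2 := by
  by_contra! h
  obtain ⟨a, ha, b, hb, c, hc, hab, hac, hbc⟩ := Finset.two_lt_card.1 h
  simp only [Finset.mem_filter, mem_latticeSet, Prod.fst_sub, Prod.snd_sub] at ha hb hc
  have hw' := sqLen_pos hw
  unfold sqLen at hw'
  have key : ∀ a b : ℤ × ℤ, a ≠ b →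
      a.1 ^ 2 + a.2 ^ 2 = (m : ℤ) ∧ (w.1 - a.1) ^ 2 + (w.2 - a.2) ^ 2 = (m : ℤ) →
      b.1 ^ 2 + b.2 ^ 2 = (m : ℤ) ∧ (w.1 - b.1) ^ 2 + (w.2 - b.2) ^ 2 = (m : ℤ) →
      w.1 * a.2 - w.2 * a.1 + (w.1 * b.2 - w.2 * b.1) = 0 := by
    intro a b hab ha hb
    have hin : w.1 * a.1 + w.2 * a.2 = w.1 * b.1 + w.2 * b.2 := by linarith [ha.1, ha.2, hb.1, hb.2]
    have hmul : (w.1 * a.2 - w.2 * a.1 + (w.1 * b.2 - w.2 * b.1)) *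
        (w.1 * a.2 - w.2 * a.1 - (w.1 * b.2 - w.2 * b.1)) = 0 := by
      linear_combination (w.1 ^ 2 + w.2 ^ 2) * (ha.1 - hb.1) -
        (w.1 * a.1 + w.2 * a.2 + (w.1 * b.1 + w.2 * b.2)) * hin
    rcases mul_eq_zero.1 hmul with h | h
    · exact h
    · exfalso
      apply hab
      have h1 : (w.1 ^ 2 + w.2 ^ 2) * (a.1 - b.1) = 0 := by
        linear_combination w.1 * hin - w.2 * h
      have h2 : (w.1 ^ 2 + w.2 ^ 2) * (a.2 - b.2) = 0 := by
        linear_combination w.2 * hin + w.1 * h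
      refine Prod.ext ?_ ?_
      · exact sub_eq_zero.1 ((mul_eq_zero.1 h1).resolve_left hw'.ne')
      · exact sub_eq_zero.1 ((mul_eq_zero.1 h2).resolve_left hw'.ne')
  have h1 := key a b hab ha hb
  have h2 := key a c hac ha hc
  have h3 := key b c hbc hb hc
  have hin : w.1 * a.1 + w.2 * a.2 = w.1 * b.1 + w.2 * b.2 := by linarith [ha.1, ha.2, hb.1, hb.2]
  have h4 : w.1 * a.2 - w.2 * a.1 - (w.1 * b.2 - w.2 * b.1) = 0 := by linarith
  apply hab
  have h5 : (w.1 ^ 2 + w.2 ^ 2) * (a.1 - b.1) = 0 := by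
    linear_combination w.1 * hin - w.2 * h4
  have h6 : (w.1 ^ 2 + w.2 ^ 2) * (a.2 - b.2) = 0 := by
    linear_combination w.2 * hin + w.1 * h4
  refine Prod.ext ?_ ?_
  · exact sub_eq_zero.1 ((mul_eq_zero.1 h5).resolve_left hw'.ne')
  · exact sub_eq_zero.1 ((mul_eq_zero.1 h6).resolve_left hw'.ne')

/-- Three lattice points on a circle of radius `√m` cannot be too close to each other. -/
lemma four_mul_le_sqLen_mul {m : ℕ} {a b c : ℤ × ℤ} (ha : a ∈ latticeSet m)
    (hb : b ∈ latticeSet m) (hc : c ∈ latticeSet m) (hab : a ≠ b) (hac : a ≠ c) (hbc : b ≠ c) :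
    4 * (m : ℤ) ≤ sqLen (a - b) * sqLen (a - c) * sqLen (b - c) := by
  have h1 := sqLen_pos (sub_ne_zero.2 hab)
  have h2 := sqLen_pos (sub_ne_zero.2 hac)
  have h3 := sqLen_pos (sub_ne_zero.2 hbc)
  rw [mem_latticeSet] at ha hb hc
  have hP : 2 * (a.1 * (a.1 - b.1) + a.2 * (a.2 - b.2)) = sqLen (a - b) := by
    unfold sqLen; simp only [Prod.fst_sub, Prod.snd_sub]; linear_combination ha - hb
  have hQ : 2 * (a.1 * (a.1 - c.1) + a.2 * (a.2 - c.2)) = sqLen (a - c) := by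
    unfold sqLen; simp only [Prod.fst_sub, Prod.snd_sub]; linear_combination ha - hc
  set x := (a.1 - b.1) * (a.2 - c.2) - (a.2 - b.2) * (a.1 - c.1) with hx
  have hid : sqLen (a - b) * sqLen (a - c) * sqLen (b - c) = 4 * m * x ^ 2 := by
    have e1 : sqLen (a - b) * sqLen (a - c) * sqLen (b - c) =
        (sqLen (a - b) * (a.1 - c.1) - sqLen (a - c) * (a.1 - b.1)) ^ 2 +
        (sqLen (a - b) * (a.2 - c.2) - sqLen (a - c) * (a.2 - b.2)) ^ 2 := by
      unfold sqLen; simp only [Prod.fst_sub, Prod.snd_sub]; ring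
    rw [e1, ← hP, ← hQ, ← ha, hx]; ring
  have hx0 : x ≠ 0 := by
    intro h
    rw [h] at hid
    have : 0 < sqLen (a - b) * sqLen (a - c) * sqLen (b - c) := by positivity
    linarith
  have : 1 ≤ x ^ 2 := Int.add_one_le_iff.2 (sq_pos_of_ne_zero hx0)
  rw [hid]
  nlinarith

lemma sum_latticeSet_representations_le (m : ℕ) (v : ℤ × ℤ) :
    ∑ a ∈ latticeSet m, ∑ b ∈ latticeSet m, ∑ c ∈ latticeSet m, ∑ d ∈ latticeSet m,
      (if a + b + c + d = v then (1 : ℝ) else 0) ≤ 3 * (latN m : ℝ) ^ 2 := by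
  have h2 : ∀ u : ℤ × ℤ, ∑ c ∈ latticeSet m, ∑ d ∈ latticeSet m,
      (if u + c + d = v then (1 : ℝ) else 0) ≤ 2 + if u = v then (latN m : ℝ) else 0 := by
    intro u
    have e : ∀ c, ∑ d ∈ latticeSet m, (if u + c + d = v then (1 : ℝ) else 0) =
        if v - u - c ∈ latticeSet m then 1 else 0 := by
      intro c
      rw [← Finset.sum_ite_eq' (latticeSet m) (v - u - c) fun _ => (1 : ℝ)]
      refine Finset.sum_congr rfl fun d _ => if_congr ?_ rfl rfl
      constructor
      · rintro rfl; abel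
      · rintro rfl; abel
    simp_rw [e]
    rw [← Finset.sum_filter, Finset.sum_const, nsmul_eq_mul, mul_one]
    split_ifs with h
    · have : ((latticeSet m).filter fun c => v - u - c ∈ latticeSet m).card ≤ latN m :=
        Finset.card_filter_le _ _
      have : (((latticeSet m).filter fun c => v - u - c ∈ latticeSet m).card : ℝ) ≤ latN m := by
        exact_mod_cast this
      linarith
    · rw [add_zero]
      exact_mod_cast card_latticeSet_filter_sub_mem_le (sub_ne_zero.2 (Ne.symm h))
  have h1 : ∀ a : ℤ × ℤ, ∑ b ∈ latticeSet m, (if a + b = v then (latN m : ℝ) else 0) ≤ latN m := by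
    intro a
    calc _ = ∑ b ∈ latticeSet m, (if b = v - a then (latN m : ℝ) else 0) :=
          Finset.sum_congr rfl fun b _ => if_congr (by rw [eq_sub_iff_add_eq, add_comm]) rfl rfl
      _ ≤ latN m := by
          rw [Finset.sum_ite_eq']
          split_ifs
          · exact le_rfl
          · positivity
  calc _ ≤ ∑ a ∈ latticeSet m, ∑ b ∈ latticeSet m, (2 + if a + b = v then (latN m : ℝ) else 0) :=
        Finset.sum_le_sum fun a _ => Finset.sum_le_sum fun b _ => h2 (a + b)
    _ ≤ ∑ a ∈ latticeSet m, (2 * (latN m : ℝ) + latN m) := by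
        refine Finset.sum_le_sum fun a _ => ?_
        rw [Finset.sum_add_distrib, Finset.sum_const, nsmul_eq_mul]
        have := h1 a
        unfold latN at *
        linarith
    _ = 3 * (latN m : ℝ) ^ 2 := by
        rw [Finset.sum_const, nsmul_eq_mul]; unfold latN; ring

/-- The weight `min(1, 1/|v|)` of an integer vector. -/
def invLen (v : ℤ × ℤ) : ℝ := if v = 0 then 1 else (√(sqLen v : ℝ))⁻¹

lemma invLen_nonneg (v : ℤ × ℤ) : 0 ≤ invLen v := by unfold invLen; split_ifs <;> positivity

lemma invLen_le_inv {v : ℤ × ℤ} {t : ℝ} (ht : 0 < t) (h : t ^ 2 ≤ sqLen v) : invLen v ≤ t⁻¹ := by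
  unfold invLen
  rw [if_neg]
  · exact inv_anti₀ ht (Real.le_sqrt_of_sq_le h)
  · rintro rfl
    simp [sqLen] at h
    exact ht.ne' h

lemma invLen_le_mul (v : ℤ × ℤ) :
    invLen v ≤ (√(max 1 (v.1.natAbs : ℝ)))⁻¹ * (√(max 1 (v.2.natAbs : ℝ)))⁻¹ := by
  have hx : (v.1.natAbs : ℝ) ^ 2 = (v.1 : ℝ) ^ 2 := by rw [Nat.cast_natAbs]; simp
  have hy : (v.2.natAbs : ℝ) ^ 2 = (v.2 : ℝ) ^ 2 := by rw [Nat.cast_natAbs]; simp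
  rw [← mul_inv, ← Real.sqrt_mul (by positivity)]
  by_cases hv : v = 0
  · subst hv; simp [invLen]
  have h1 : (1 : ℝ) ≤ sqLen v := by exact_mod_cast sqLen_pos hv
  refine invLen_le_inv (by positivity) ?_
  rw [Real.sq_sqrt (by positivity)]
  have hs : (sqLen v : ℝ) = (v.1 : ℝ) ^ 2 + (v.2 : ℝ) ^ 2 := by unfold sqLen; push_cast; ring
  have hA : (max 1 (v.1.natAbs : ℝ)) ^ 2 ≤ sqLen v := by
    rcases max_cases 1 (v.1.natAbs : ℝ) with ⟨h, _⟩ | ⟨h, _⟩ <;> rw [h] <;> nlinarith [sq_nonneg (v.2 : ℝ)]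
  have hB : (max 1 (v.2.natAbs : ℝ)) ^ 2 ≤ sqLen v := by
    rcases max_cases 1 (v.2.natAbs : ℝ) with ⟨h, _⟩ | ⟨h, _⟩ <;> rw [h] <;> nlinarith [sq_nonneg (v.1 : ℝ)]
  nlinarith [sq_nonneg (max 1 (v.1.natAbs : ℝ) - max 1 (v.2.natAbs : ℝ))]

lemma sum_range_inv_sqrt_le (R : ℕ) :
    ∑ k ∈ Finset.range (R + 1), (√(max 1 (k : ℝ)))⁻¹ ≤ 1 + 2 * √R := by
  induction R with
  | zero => simp
  | succ R ih =>
    rw [Finset.sum_range_succ]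
    have h1 : max 1 ((R + 1 : ℕ) : ℝ) = R + 1 := by push_cast; exact max_eq_right (by linarith [R.cast_nonneg (α := ℝ)])
    rw [h1]
    push_cast
    have hs : 0 < √((R : ℝ) + 1) := by positivity
    have hs2 := Real.sq_sqrt (show (0 : ℝ) ≤ R + 1 by positivity)
    have hr2 := Real.sq_sqrt (show (0 : ℝ) ≤ R by positivity)
    have : (√((R : ℝ) + 1))⁻¹ ≤ 2 * (√((R : ℝ) + 1) - √R) := by
      rw [inv_le_iff_one_le_mul₀ hs]
      nlinarith [sq_nonneg (√((R : ℝ) + 1) - √R)]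
    linarith

lemma sum_box_invLen_le {R : ℕ} (hR : 1 ≤ R) :
    ∑ v ∈ Finset.Icc (-(R : ℤ)) R ×ˢ Finset.Icc (-(R : ℤ)) R, invLen v ≤ 36 * R := by
  set g : ℤ → ℝ := fun x => (√(max 1 (x.natAbs : ℝ)))⁻¹ with hg
  have h1 : ∑ x ∈ Finset.Icc (-(R : ℤ)) R, g x ≤ 6 * √R := by
    have hsub : Finset.Icc (-(R : ℤ)) R ⊆ (Finset.range (R + 1)).image (fun k : ℕ => (k : ℤ)) ∪
        (Finset.range (R + 1)).image (fun k : ℕ => -(k : ℤ)) := by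
      intro x hx
      rw [Finset.mem_Icc] at hx
      simp only [Finset.mem_union, Finset.mem_image, Finset.mem_range]
      rcases le_total 0 x with h | h
      · exact Or.inl ⟨x.natAbs, by omega, by omega⟩
      · exact Or.inr ⟨x.natAbs, by omega, by omega⟩
    have hg0 : ∀ x, 0 ≤ g x := fun x => by positivity
    have hone : (1 : ℝ) ≤ √R := Real.one_le_sqrt.2 (by exact_mod_cast hR)
    calc _ ≤ _ := Finset.sum_le_sum_of_subset_of_nonneg hsub fun x _ _ => hg0 x
      _ ≤ ∑ x ∈ (Finset.range (R + 1)).image (fun k : ℕ => (k : ℤ)), g x +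
          ∑ x ∈ (Finset.range (R + 1)).image (fun k : ℕ => -(k : ℤ)), g x := by
          rw [← Finset.sum_union_inter]
          exact le_add_of_nonneg_right (Finset.sum_nonneg fun x _ => hg0 x)
      _ = 2 * ∑ k ∈ Finset.range (R + 1), (√(max 1 (k : ℝ)))⁻¹ := by
          rw [Finset.sum_image (by intro a _ b _ h; simpa using h),
            Finset.sum_image (by intro a _ b _ h; simpa using h)]
          simp [hg, two_mul]
      _ ≤ 6 * √R := by linarith [sum_range_inv_sqrt_le R]
  calc _ ≤ ∑ v ∈ Finset.Icc (-(R : ℤ)) R ×ˢ Finset.Icc (-(R : ℤ)) R, g v.1 * g v.2 :=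
        Finset.sum_le_sum fun v _ => invLen_le_mul v
    _ = (∑ x ∈ Finset.Icc (-(R : ℤ)) R, g x) * ∑ x ∈ Finset.Icc (-(R : ℤ)) R, g x := by
        rw [Finset.sum_product, Finset.sum_mul_sum]
    _ ≤ (6 * √R) * (6 * √R) := by
        have : 0 ≤ ∑ x ∈ Finset.Icc (-(R : ℤ)) R, g x := Finset.sum_nonneg fun x _ => by positivity
        gcongr
    _ = 36 * R := by nlinarith [Real.sq_sqrt (show (0 : ℝ) ≤ R by positivity)]

/-- At most two lattice points on the circle lie close to a given point. -/
lemma card_latticeSet_filter_near_le {m : ℕ} {t : ℝ} (ht : 16 * t ^ 6 ≤ m) (u : ℤ × ℤ) :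
    ((latticeSet m).filter fun d => (sqLen (u + d) : ℝ) < t ^ 2).card ≤ 2 := by
  by_contra! h
  obtain ⟨a, ha, b, hb, c, hc, hab, hac, hbc⟩ := Finset.two_lt_card.1 h
  simp only [Finset.mem_filter] at ha hb hc
  have h4 := four_mul_le_sqLen_mul ha.1 hb.1 hc.1 hab hac hbc
  have key : ∀ a b : ℤ × ℤ, (sqLen (u + a) : ℝ) < t ^ 2 → (sqLen (u + b) : ℝ) < t ^ 2 →
      (sqLen (a - b) : ℝ) < 4 * t ^ 2 := by
    intro a b h1 h2
    unfold sqLen at *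
    simp only [Prod.fst_sub, Prod.snd_sub, Prod.fst_add, Prod.snd_add] at *
    push_cast at *
    nlinarith [sq_nonneg ((u.1 : ℝ) + a.1 + (u.1 + b.1)), sq_nonneg ((u.2 : ℝ) + a.2 + (u.2 + b.2))]
  have h0 : ∀ v : ℤ × ℤ, (0 : ℝ) ≤ sqLen v := fun v => by
    unfold sqLen; push_cast; positivity
  have h5 : (4 * m : ℝ) ≤ sqLen (a - b) * sqLen (a - c) * sqLen (b - c) := by exact_mod_cast h4
  have k1 := key a b ha.2 hb.2
  have k2 := key a c ha.2 hc.2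
  have k3 := key b c hb.2 hc.2
  have h6 : (sqLen (a - b) : ℝ) * sqLen (a - c) * sqLen (b - c) <
      4 * t ^ 2 * (4 * t ^ 2) * (4 * t ^ 2) := by
    have := mul_lt_mul'' k1 k2 (h0 _) (h0 _)
    exact mul_lt_mul'' this k3 (mul_nonneg (h0 _) (h0 _)) (h0 _)
  nlinarith

lemma latN_pos {m : ℕ} (h : ∃ a b : ℤ, a ^ 2 + b ^ 2 = (m : ℤ)) : 0 < latN m := by
  obtain ⟨a, b, h⟩ := h
  exact Finset.card_pos.2 ⟨(a, b), mem_latticeSet.2 h⟩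

lemma exists_sum_invLen_le : ∃ C : ℝ, 0 < C ∧ ∀ m : ℕ, m ≠ 0 → 0 < latN m →
    ∑ a ∈ latticeSet m, ∑ b ∈ latticeSet m, ∑ c ∈ latticeSet m, ∑ d ∈ latticeSet m,
      invLen (a + b + c + d) ≤ C * ((latN m : ℝ) ^ 2 * √(latN m)) := by
  obtain ⟨C, hC, hN⟩ := exists_latN_pow_le
  refine ⟨110 + 16 * C, by positivity, fun m hm hNpos => ?_⟩
  set E := latticeSet m
  set N : ℝ := (latN m : ℝ) with hNdef
  have hN1 : (1 : ℝ) ≤ N := Nat.one_le_cast.2 hNpos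
  have hs0 : 0 < √N := by positivity
  have hs2 : √N ^ 2 = N := Real.sq_sqrt (by positivity)
  set R := Nat.sqrt (latN m) with hR
  have hR1 : 1 ≤ R := Nat.sqrt_pos.2 hNpos
  have hRle : (R : ℝ) ≤ √N := Real.nat_sqrt_le_real_sqrt
  have hRlt : √N ≤ R + 1 := Real.real_sqrt_le_nat_sqrt_succ
  set box := Finset.Icc (-(R : ℤ)) R ×ˢ Finset.Icc (-(R : ℤ)) R with hbox
  have hEc : (E.card : ℝ) = N := rfl
  set T : ℝ := N * √N / (16 * C) with hT
  have hC1 : (1 : ℝ) ≤ C := by exact_mod_cast hC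
  have hT0 : 0 < T := by positivity
  have hT6 : 16 * T ^ 6 ≤ m := by
    have h1 : N ^ 9 ≤ C * m := by rw [hNdef]; exact_mod_cast hN m hm
    have h2 : T ^ 6 = N ^ 9 / (16 * C) ^ 6 := by
      rw [hT, div_pow, mul_pow, show √N ^ 6 = (√N ^ 2) ^ 3 by ring, hs2]; ring
    have h3 : (16 * C : ℝ) ≤ (16 * C) ^ 6 := le_self_pow₀ (by linarith) (by norm_num)
    have h4 : N ^ 9 / (16 * C) ^ 6 ≤ N ^ 9 / (16 * C) := by gcongr
    have h5 : N ^ 9 / (16 * C) ≤ m / 16 := by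
      rw [div_le_div_iff₀ (by positivity) (by norm_num)]; nlinarith
    rw [h2]; linarith
  have hsplit : ∀ v, invLen v ≤ (∑ w ∈ box, invLen w * if v = w then 1 else 0) +
      if v ∈ box then 0 else invLen v := by
    intro v
    simp only [mul_ite, mul_one, mul_zero]
    rw [Finset.sum_ite_eq]
    split_ifs <;> simp
  have hfar : ∀ u : ℤ × ℤ, ∑ d ∈ E, (if u + d ∈ box then 0 else invLen (u + d)) ≤
      (2 + 16 * C) / √N := by
    intro u
    calc ∑ d ∈ E, (if u + d ∈ box then 0 else invLen (u + d))
        ≤ ∑ d ∈ E, ((if (sqLen (u + d) : ℝ) < T ^ 2 then (√N)⁻¹ else 0) + T⁻¹) := by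
          refine Finset.sum_le_sum fun d _ => ?_
          by_cases hb : u + d ∈ box
          · rw [if_pos hb]; split_ifs <;> positivity
          rw [if_neg hb]
          by_cases hn : (sqLen (u + d) : ℝ) < T ^ 2
          · rw [if_pos hn]
            have : invLen (u + d) ≤ (√N)⁻¹ := by
              refine invLen_le_inv hs0 ?_
              have hlarge : ((R : ℤ) + 1) ^ 2 ≤ sqLen (u + d) := by
                simp only [hbox, Finset.mem_product, Finset.mem_Icc, not_and_or, not_le] at hb
                unfold sqLen
                rcases hb with (h | h) | (h | h) <;>
                  nlinarith [sq_nonneg (u + d).1, sq_nonneg (u + d).2]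
              have : ((R : ℝ) + 1) ^ 2 ≤ sqLen (u + d) := by exact_mod_cast hlarge
              exact (pow_le_pow_left₀ hs0.le hRlt 2).trans this
            have := inv_pos.2 hT0
            linarith
          · rw [if_neg hn, zero_add]
            exact invLen_le_inv hT0 (not_lt.1 hn)
      _ ≤ 2 * (√N)⁻¹ + N * T⁻¹ := by
          rw [Finset.sum_add_distrib, ← Finset.sum_filter, Finset.sum_const, Finset.sum_const,
            nsmul_eq_mul, nsmul_eq_mul, hEc]
          gcongr
          exact_mod_cast card_latticeSet_filter_near_le hT6 u
      _ = (2 + 16 * C) / √N := by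
          rw [hT]; field_simp
  calc _ ≤ ∑ a ∈ E, ∑ b ∈ E, ∑ c ∈ E, ∑ d ∈ E,
        ((∑ w ∈ box, invLen w * if a + b + c + d = w then 1 else 0) +
          if a + b + c + d ∈ box then 0 else invLen (a + b + c + d)) :=
        Finset.sum_le_sum fun a _ => Finset.sum_le_sum fun b _ => Finset.sum_le_sum fun c _ =>
          Finset.sum_le_sum fun d _ => hsplit _
    _ = ∑ w ∈ box, invLen w * ∑ a ∈ E, ∑ b ∈ E, ∑ c ∈ E, ∑ d ∈ E,
          (if a + b + c + d = w then 1 else 0) +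
        ∑ a ∈ E, ∑ b ∈ E, ∑ c ∈ E, ∑ d ∈ E,
          (if a + b + c + d ∈ box then 0 else invLen (a + b + c + d)) := by
        simp only [Finset.sum_add_distrib]
        congr 1
        simp only [Finset.mul_sum]
        refine Eq.trans (Finset.sum_congr rfl fun a _ => ?_) Finset.sum_comm
        refine Eq.trans (Finset.sum_congr rfl fun b _ => ?_) Finset.sum_comm
        refine Eq.trans (Finset.sum_congr rfl fun c _ => ?_) Finset.sum_comm
        exact Finset.sum_comm
    _ ≤ ∑ w ∈ box, invLen w * (3 * N ^ 2) +
        ∑ a ∈ E, ∑ b ∈ E, ∑ c ∈ E, (2 + 16 * C) / √N := by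
        refine add_le_add (Finset.sum_le_sum fun w _ => ?_) ?_
        · exact mul_le_mul_of_nonneg_left (sum_latticeSet_representations_le m w) (invLen_nonneg w)
        · exact Finset.sum_le_sum fun a _ => Finset.sum_le_sum fun b _ =>
            Finset.sum_le_sum fun c _ => hfar (a + b + c)
    _ ≤ 36 * √N * (3 * N ^ 2) + N * (N * (N * ((2 + 16 * C) / √N))) := by
        rw [← Finset.sum_mul]
        simp only [Finset.sum_const, nsmul_eq_mul, hEc]
        have := sum_box_invLen_le hR1
        gcongr
        linarith
    _ = (110 + 16 * C) * (N ^ 2 * √N) := by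
        have : N / √N = √N := by rw [div_eq_iff hs0.ne', ← sq, hs2]
        rw [show N * (N * (N * ((2 + 16 * C) / √N))) = N ^ 2 * (2 + 16 * C) * (N / √N) by ring, this]
        ring

/-- Integration by parts bound for `∫ A exp(iφ)` with weight `lam / (φ'² + lam)`. -/
lemma norm_integral_mul_cexp_le {L lam K M J : ℝ} (hL : 0 ≤ L) (hlam : 0 < lam) (hM : 0 ≤ M)
    {φ φ' φ'' : ℝ → ℝ} {A A' : ℝ → ℂ}
    (hφ : ∀ t, HasDerivAt φ (φ' t) t) (hφ' : ∀ t, HasDerivAt φ' (φ'' t) t)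
    (hφ'' : Continuous φ'') (hA : ∀ t, HasDerivAt A (A' t) t) (hA' : Continuous A')
    (hAK : ∀ t ∈ Set.Icc 0 L, ‖A t‖ ≤ K) (hA'K : ∀ t ∈ Set.Icc 0 L, ‖A' t‖ ≤ K)
    (hφM : ∀ t ∈ Set.Icc 0 L, |φ'' t| ≤ M * lam)
    (hJ : ∫ t in (0 : ℝ)..L, lam / (φ' t ^ 2 + lam) ≤ J) :
    ‖∫ t in (0 : ℝ)..L, A t * Complex.exp (Complex.I * φ t)‖ ≤
      K * ((1 + L) / √lam + (M + 1) * J) := by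
  have hK : 0 ≤ K := (norm_nonneg _).trans (hAK 0 ⟨le_rfl, hL⟩)
  have hpos : ∀ t, 0 < φ' t ^ 2 + lam := fun t => by positivity
  set g : ℝ → ℝ := fun t => φ' t / (φ' t ^ 2 + lam) with hgdef
  set g' : ℝ → ℝ := fun t => φ'' t * (lam - φ' t ^ 2) / (φ' t ^ 2 + lam) ^ 2 with hg'def
  have hg : ∀ t, HasDerivAt g (g' t) t := fun t => by
    have := (hφ' t).div (((hφ' t).pow 2).add_const lam) (hpos t).ne'
    refine this.congr_deriv ?_
    simp only [hg'def, Pi.pow_apply]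
    congr 1
    push_cast
    ring
  have cφ : Continuous φ := continuous_iff_continuousAt.2 fun t => (hφ t).continuousAt
  have cφ' : Continuous φ' := continuous_iff_continuousAt.2 fun t => (hφ' t).continuousAt
  have cA : Continuous A := continuous_iff_continuousAt.2 fun t => (hA t).continuousAt
  have cg : Continuous g := continuous_iff_continuousAt.2 fun t => (hg t).continuousAt
  have cg' : Continuous g' := by
    refine (hφ''.mul (continuous_const.sub (cφ'.pow 2))).div ((cφ'.pow 2).add_const _ |>.pow 2)
      fun t => (pow_pos (hpos t) 2).ne'
  set e : ℝ → ℂ := fun t => Complex.exp (Complex.I * φ t) with hedef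
  have ce : Continuous e := by fun_prop
  have hnorm : ∀ t, ‖e t‖ = 1 := fun t => by
    rw [hedef]; simp only [mul_comm Complex.I]; exact Complex.norm_exp_ofReal_mul_I _
  have he : ∀ t, HasDerivAt e (Complex.I * φ' t * e t) t := fun t => by
    have := (((hφ t).ofReal_comp).const_mul Complex.I).cexp
    refine this.congr_deriv ?_
    simp only [hedef]; ring
  have hsl : 0 < √lam := Real.sqrt_pos.2 hlam
  have hsl2 : √lam ^ 2 = lam := Real.sq_sqrt hlam.le
  have hgb : ∀ t, |g t| ≤ 1 / (2 * √lam) := fun t => by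
    rw [hgdef, abs_div, abs_of_pos (hpos t), div_le_div_iff₀ (hpos t) (by positivity)]
    nlinarith [sq_nonneg (|φ' t| - √lam), sq_abs (φ' t)]
  have hg'b : ∀ t ∈ Set.Icc 0 L, |g' t| ≤ M * (lam / (φ' t ^ 2 + lam)) := fun t ht => by
    have h1 : |lam - φ' t ^ 2| ≤ φ' t ^ 2 + lam := by
      rw [abs_le]; constructor <;> nlinarith [sq_nonneg (φ' t)]
    rw [hg'def, abs_div, abs_mul, abs_of_pos (pow_pos (hpos t) 2), mul_div_assoc']
    rw [div_le_div_iff₀ (pow_pos (hpos t) 2) (hpos t)]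
    have := mul_le_mul (hφM t ht) h1 (abs_nonneg _) (by positivity)
    nlinarith [hpos t]
  set F : ℝ → ℂ := fun t => -Complex.I * g t * A t * e t with hFdef
  set R : ℝ → ℂ := fun t => Complex.I * g' t * A t * e t + Complex.I * g t * A' t * e t +
    A t * e t * ((lam / (φ' t ^ 2 + lam) : ℝ) : ℂ) with hRdef
  have hF : ∀ t, HasDerivAt F (A t * e t - R t) t := fun t => by
    have := ((((hg t).ofReal_comp).const_mul (-Complex.I)).mul (hA t)).mul (he t)
    refine this.congr_deriv ?_
    have h2 : (1 : ℂ) - ((lam / (φ' t ^ 2 + lam) : ℝ) : ℂ) = g t * φ' t := by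
      rw [hgdef, ← Complex.ofReal_one, ← Complex.ofReal_sub, ← Complex.ofReal_mul]
      congr 1
      field_simp [(hpos t).ne']
      ring
    simp only [hRdef]
    have : A t * e t - (Complex.I * g' t * A t * e t + Complex.I * g t * A' t * e t +
        A t * e t * ((lam / (φ' t ^ 2 + lam) : ℝ) : ℂ)) =
        A t * e t * (1 - ((lam / (φ' t ^ 2 + lam) : ℝ) : ℂ)) -
        (Complex.I * g' t * A t * e t + Complex.I * g t * A' t * e t) := by ring
    rw [this, h2]
    simp only [Pi.mul_apply]
    linear_combination (- (A t * e t * g t * φ' t)) * Complex.I_sq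
  have cw : Continuous fun t => lam / (φ' t ^ 2 + lam) :=
    continuous_const.div ((cφ'.pow 2).add_const _) fun t => (hpos t).ne'
  have cR : Continuous R := by
    have := Complex.continuous_ofReal.comp cw
    have := Complex.continuous_ofReal.comp cg
    have := Complex.continuous_ofReal.comp cg'
    simp only [Function.comp_def] at *
    fun_prop
  have hint : ∫ t in (0 : ℝ)..L, A t * e t = F L - F 0 + ∫ t in (0 : ℝ)..L, R t := by
    have := intervalIntegral.integral_eq_sub_of_hasDerivAt (fun t _ => hF t)
      (((cA.mul ce).sub cR).intervalIntegrable 0 L)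
    have hsub := intervalIntegral.integral_sub (μ := volume) ((cA.mul ce).intervalIntegrable 0 L)
      (cR.intervalIntegrable 0 L)
    simp only [Pi.mul_apply] at hsub
    rw [hsub] at this
    rw [← this]; ring
  have hFb : ∀ t ∈ Set.Icc 0 L, ‖F t‖ ≤ K * (1 / (2 * √lam)) := fun t ht => by
    rw [hFdef]
    simp only [norm_mul, norm_neg, Complex.norm_I, one_mul, hnorm, mul_one, Complex.norm_real,
      Real.norm_eq_abs]
    rw [mul_comm]
    exact mul_le_mul (hAK t ht) (hgb t) (abs_nonneg _) hK
  have hRb : ‖∫ t in (0 : ℝ)..L, R t‖ ≤ ∫ t in (0 : ℝ)..L, (K * (1 / (2 * √lam)) +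
      K * (M + 1) * (lam / (φ' t ^ 2 + lam))) := by
    refine intervalIntegral.norm_integral_le_of_norm_le hL ?_
      ((continuous_const.add (continuous_const.mul cw)).intervalIntegrable 0 L)
    refine Filter.Eventually.of_forall fun t ht => ?_
    have ht' : t ∈ Set.Icc 0 L := ⟨ht.1.le, ht.2⟩
    have hw0 : 0 ≤ lam / (φ' t ^ 2 + lam) := by positivity
    refine (norm_add₃_le).trans ?_
    simp only [norm_mul, Complex.norm_I, one_mul, hnorm, mul_one, Complex.norm_real,
      Real.norm_eq_abs, abs_of_nonneg hw0]
    have h1 := mul_le_mul (hg'b t ht') (hAK t ht') (norm_nonneg _) (by positivity)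
    have h2 := mul_le_mul (hgb t) (hA'K t ht') (norm_nonneg _) (by positivity)
    have h3 := mul_le_mul_of_nonneg_right (hAK t ht') hw0
    linarith
  rw [intervalIntegral.integral_add intervalIntegrable_const
    ((cw.intervalIntegrable 0 L).const_mul _), intervalIntegral.integral_const,
    intervalIntegral.integral_const_mul, smul_eq_mul, sub_zero] at hRb
  change ‖∫ t in (0 : ℝ)..L, A t * e t‖ ≤ _
  rw [hint]
  have h1 := hFb 0 ⟨le_rfl, hL⟩
  have h2 := hFb L ⟨hL, le_rfl⟩
  have h3 := norm_add_le (F L - F 0) (∫ t in (0 : ℝ)..L, R t)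
  have h4 := norm_sub_le (F L) (F 0)
  have h5 : K * (M + 1) * ∫ t in (0 : ℝ)..L, lam / (φ' t ^ 2 + lam) ≤ K * (M + 1) * J :=
    mul_le_mul_of_nonneg_left hJ (by positivity)
  have h6 : K * ((1 + L) / √lam + (M + 1) * J) =
      2 * (K * (1 / (2 * √lam))) + L * (2 * (K * (1 / (2 * √lam)))) + K * (M + 1) * J := by
    field_simp
  rw [h6]
  have h7 : 0 ≤ L * (K * (1 / (2 * √lam))) := by positivity
  linarith

/-- A unit-speed vector field turning with nonvanishing curvature `κ` spends little time
near the orthogonal of a given direction. -/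
lemma integral_inv_one_add_le {L k₀ k₁ : ℝ} (hL : 0 ≤ L) (hk₀ : 0 < k₀)
    {p q κ κ' : ℝ → ℝ} (hp : ∀ t ∈ Set.Icc 0 L, HasDerivAt p (-(κ t * q t)) t)
    (hq : ∀ t ∈ Set.Icc 0 L, HasDerivAt q (κ t * p t) t)
    (hpq : ∀ t ∈ Set.Icc 0 L, p t ^ 2 + q t ^ 2 = 1)
    (hκ : ∀ t ∈ Set.Icc 0 L, HasDerivAt κ (κ' t) t) (hκ' : ContinuousOn κ' (Set.Icc 0 L))
    (hκ₀ : ∀ t ∈ Set.Icc 0 L, k₀ ≤ |κ t|) (hκ₁ : ∀ t ∈ Set.Icc 0 L, |κ' t| ≤ k₁)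
    {u₁ u₂ lam : ℝ} (hu : u₁ ^ 2 + u₂ ^ 2 = 1) (hlam : 1 ≤ lam) :
    ∫ t in (0 : ℝ)..L, 1 / (1 + lam * (u₁ * p t + u₂ * q t) ^ 2) ≤
      (L + π / k₀ + L * ((1 + k₁ / k₀ ^ 2) * (π / 2))) / √lam := by
  have hlam0 : 0 < lam := by linarith
  have hsl : 0 < √lam := Real.sqrt_pos.2 hlam0
  have hsl2 : √lam ^ 2 = lam := Real.sq_sqrt hlam0.le
  set c : ℝ → ℝ := fun t => u₁ * p t + u₂ * q t with hc
  set s : ℝ → ℝ := fun t => u₂ * p t - u₁ * q t with hs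
  have hcs : ∀ t ∈ Set.Icc 0 L, c t ^ 2 + s t ^ 2 = 1 := fun t ht => by
    simp only [hc, hs]; linear_combination (u₁ ^ 2 + u₂ ^ 2) * hpq t ht + hu
  have hdc : ∀ t ∈ Set.Icc 0 L, HasDerivAt c (κ t * s t) t := fun t ht => by
    refine (((hp t ht).const_mul u₁).add ((hq t ht).const_mul u₂)).congr_deriv ?_
    simp only [hs]; ring
  have hds : ∀ t ∈ Set.Icc 0 L, HasDerivAt s (-(κ t * c t)) t := fun t ht => by
    refine (((hp t ht).const_mul u₂).sub ((hq t ht).const_mul u₁)).congr_deriv ?_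
    simp only [hc]; ring
  have hκne : ∀ t ∈ Set.Icc 0 L, κ t ≠ 0 := fun t ht h => by
    have := hκ₀ t ht; rw [h, abs_zero] at this; linarith
  have hpos : ∀ t, 0 < 1 + lam * c t ^ 2 := fun t => by positivity
  set h : ℝ → ℝ := fun t => Real.arctan (√lam * c t) with hh
  set w : ℝ → ℝ := fun t => s t / κ t with hw
  set w' : ℝ → ℝ := fun t => (-(κ t * c t) * κ t - s t * κ' t) / κ t ^ 2 with hw'
  have hdh : ∀ t ∈ Set.Icc 0 L,
      HasDerivAt h (1 / (1 + (√lam * c t) ^ 2) * (√lam * (κ t * s t))) t := fun t ht =>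
    ((hdc t ht).const_mul √lam).arctan
  have hdw : ∀ t ∈ Set.Icc 0 L, HasDerivAt w (w' t) t := fun t ht =>
    (hds t ht).div (hκ t ht) (hκne t ht)
  have cont : ∀ {f f' : ℝ → ℝ}, (∀ t ∈ Set.Icc 0 L, HasDerivAt f (f' t) t) →
      ContinuousOn f (Set.Icc 0 L) := fun hf t ht => (hf t ht).continuousAt.continuousWithinAt
  have cc := cont hdc
  have cs := cont hds
  have cκ := cont hκ
  have ch := cont hdh
  have cw := cont hdw
  have cw' : ContinuousOn w' (Set.Icc 0 L) :=
    (((cκ.mul cc).neg.mul cκ).sub (cs.mul hκ')).div (cκ.pow 2) fun t ht => pow_ne_zero 2 (hκne t ht)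
  have hsle : ∀ t ∈ Set.Icc 0 L, |s t| ≤ 1 := fun t ht => by
    rw [← sq_le_one_iff_abs_le_one]; nlinarith [hcs t ht, sq_nonneg (c t)]
  have hcle : ∀ t ∈ Set.Icc 0 L, |c t| ≤ 1 := fun t ht => by
    rw [← sq_le_one_iff_abs_le_one]; nlinarith [hcs t ht, sq_nonneg (s t)]
  have hwb : ∀ t ∈ Set.Icc 0 L, |w t| ≤ 1 / k₀ := fun t ht => by
    rw [hw, abs_div]
    exact div_le_div₀ zero_le_one (hsle t ht) hk₀ (hκ₀ t ht)
  have hw'b : ∀ t ∈ Set.Icc 0 L, |w' t| ≤ 1 + k₁ / k₀ ^ 2 := fun t ht => by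
    have e : w' t = -c t - s t * (κ' t / κ t ^ 2) := by
      simp only [hw']; field_simp [hκne t ht]
    have h1 : |κ' t / κ t ^ 2| ≤ k₁ / k₀ ^ 2 := by
      rw [abs_div, abs_pow]
      exact div_le_div₀ ((abs_nonneg _).trans (hκ₁ t ht)) (hκ₁ t ht) (by positivity)
        (pow_le_pow_left₀ hk₀.le (hκ₀ t ht) 2)
    rw [e]
    refine (abs_sub _ _).trans ?_
    rw [abs_neg, abs_mul]
    have := mul_le_mul (hsle t ht) h1 (abs_nonneg _) zero_le_one
    linarith [hcle t ht]
  have hhb : ∀ t, |h t| ≤ π / 2 := fun t => by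
    rw [abs_le]; exact ⟨(Real.neg_pi_div_two_lt_arctan _).le, (Real.arctan_lt_pi_div_two _).le⟩
  set G : ℝ → ℝ := fun t => w t * h t / √lam with hG
  have hdG : ∀ t ∈ Set.Icc 0 L,
      HasDerivAt G (s t ^ 2 / (1 + lam * c t ^ 2) + w' t * h t / √lam) t := fun t ht => by
    refine (((hdw t ht).mul (hdh t ht)).div_const √lam).congr_deriv ?_
    have e : (√lam * c t) ^ 2 = lam * c t ^ 2 := by rw [mul_pow, hsl2]
    rw [e]
    simp only [hw]
    field_simp [hκne t ht, (hpos t).ne', hsl.ne']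
    ring
  have uI : Set.uIcc 0 L = Set.Icc 0 L := Set.uIcc_of_le hL
  have cS : ContinuousOn (fun t => s t ^ 2 / (1 + lam * c t ^ 2)) (Set.Icc 0 L) :=
    (cs.pow 2).div (continuousOn_const.add (continuousOn_const.mul (cc.pow 2)))
      fun t _ => (hpos t).ne'
  have cW : ContinuousOn (fun t => w' t * h t / √lam) (Set.Icc 0 L) :=
    (cw'.mul ch).div_const _
  have iS : IntervalIntegrable (fun t => s t ^ 2 / (1 + lam * c t ^ 2)) volume 0 L :=
    ContinuousOn.intervalIntegrable (by rwa [uI])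
  have iW : IntervalIntegrable (fun t => w' t * h t / √lam) volume 0 L :=
    ContinuousOn.intervalIntegrable (by rwa [uI])
  have hint := intervalIntegral.integral_eq_sub_of_hasDerivAt (f := G) (a := 0) (b := L)
    (fun t ht => hdG t (uI ▸ ht)) (iS.add iW)
  rw [intervalIntegral.integral_add iS iW] at hint
  have hGb : ∀ t ∈ Set.Icc 0 L, |G t| ≤ π / 2 / k₀ / √lam := fun t ht => by
    rw [hG, abs_div, abs_mul, abs_of_pos hsl]
    have := mul_le_mul (hwb t ht) (hhb t) (abs_nonneg _) (by positivity)
    gcongr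
    exact this.trans_eq (by ring)
  have hWb : |∫ t in (0 : ℝ)..L, w' t * h t / √lam| ≤
      (1 + k₁ / k₀ ^ 2) * (π / 2) / √lam * |L - 0| := by
    rw [← Real.norm_eq_abs]
    refine intervalIntegral.norm_integral_le_of_norm_le_const fun t ht => ?_
    have ht' : t ∈ Set.Icc 0 L := by rw [Set.uIoc_of_le hL] at ht; exact ⟨ht.1.le, ht.2⟩
    rw [Real.norm_eq_abs, abs_div, abs_mul, abs_of_pos hsl]
    gcongr
    · exact (abs_nonneg _).trans (hw'b t ht')
    · exact hw'b t ht'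
    · exact hhb t
  have hle : ∫ t in (0 : ℝ)..L, 1 / (1 + lam * c t ^ 2) ≤
      ∫ t in (0 : ℝ)..L, (1 / √lam + s t ^ 2 / (1 + lam * c t ^ 2)) := by
    refine intervalIntegral.integral_mono_on hL ?_ (intervalIntegrable_const.add iS) fun t ht => ?_
    · refine ContinuousOn.intervalIntegrable ?_
      rw [uI]
      exact continuousOn_const.div (continuousOn_const.add (continuousOn_const.mul (cc.pow 2)))
        fun t _ => (hpos t).ne'
    · have h1 : 1 / (1 + lam * c t ^ 2) =
          c t ^ 2 / (1 + lam * c t ^ 2) + s t ^ 2 / (1 + lam * c t ^ 2) := by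
        rw [← add_div, hcs t ht]
      have h2 : c t ^ 2 / (1 + lam * c t ^ 2) ≤ 1 / √lam := by
        rw [div_le_div_iff₀ (hpos t) hsl]
        have : √lam ≤ lam := by
          nlinarith [Real.one_le_sqrt.2 hlam]
        nlinarith [sq_nonneg (c t)]
      linarith
  rw [intervalIntegral.integral_add intervalIntegrable_const iS,
    intervalIntegral.integral_const, smul_eq_mul] at hle
  refine hle.trans ?_
  have h0 := hGb 0 ⟨le_rfl, hL⟩
  have hl := hGb L ⟨hL, le_rfl⟩
  rw [abs_le] at h0 hl
  rw [sub_zero, abs_of_nonneg hL, abs_le] at hWb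
  have e : (L + π / k₀ + L * ((1 + k₁ / k₀ ^ 2) * (π / 2))) / √lam =
      L * (1 / √lam) + 2 * (π / 2 / k₀ / √lam) + (1 + k₁ / k₀ ^ 2) * (π / 2) / √lam * L := by
    field_simp
  rw [e]
  linarith [h0.1, hl.2, hWb.1, sub_zero L]

lemma ContDiff.deriv_top {E : Type*} [NormedAddCommGroup E] [NormedSpace ℝ E] {f : ℝ → E}
    (hf : ContDiff ℝ (⊤ : ℕ∞) f) : ContDiff ℝ (⊤ : ℕ∞) (deriv f) :=
  (contDiff_infty_iff_deriv.1 hf).2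

lemma ContDiff.hasDerivAt_top {E : Type*} [NormedAddCommGroup E] [NormedSpace ℝ E] {f : ℝ → E}
    (hf : ContDiff ℝ (⊤ : ℕ∞) f) (t : ℝ) : HasDerivAt f (deriv f t) t :=
  ((contDiff_infty_iff_deriv.1 hf).1 t).hasDerivAt

lemma HasDerivAt.prod_fst {f : ℝ → ℝ × ℝ} {f' : ℝ × ℝ} {t : ℝ} (hf : HasDerivAt f f' t) :
    HasDerivAt (fun s => (f s).1) f'.1 t :=
  (ContinuousLinearMap.fst ℝ ℝ ℝ).hasFDerivAt.comp_hasDerivAt t hf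

lemma HasDerivAt.prod_snd {f : ℝ → ℝ × ℝ} {f' : ℝ × ℝ} {t : ℝ} (hf : HasDerivAt f f' t) :
    HasDerivAt (fun s => (f s).2) f'.2 t :=
  (ContinuousLinearMap.snd ℝ ℝ ℝ).hasFDerivAt.comp_hasDerivAt t hf

/-- A differentiable function that is constant on a nondegenerate interval has zero derivative
there, end points included. -/
lemma HasDerivAt.eq_zero_of_const_on_Icc {f : ℝ → ℝ} {f' L c : ℝ} (hL : 0 < L)
    (hc : ∀ t ∈ Set.Icc 0 L, f t = c) {t : ℝ} (ht : t ∈ Set.Icc 0 L) (hf : HasDerivAt f f' t) :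
    f' = 0 := by
  have h1 := hf.hasDerivWithinAt (s := Set.Icc 0 L)
  have h2 : HasDerivWithinAt f 0 (Set.Icc 0 L) t :=
    (hasDerivWithinAt_const t (Set.Icc 0 L) c).congr (fun s hs => hc s hs) (hc t ht)
  exact (uniqueDiffOn_Icc hL t ht).eq_deriv _ h1 h2

lemma exists_integral_curve_le {L : ℝ} (hL : 0 < L) {γ : ℝ → ℝ × ℝ}
    (hγ : ContDiff ℝ (⊤ : ℕ∞) γ)
    (hunit : ∀ t ∈ Set.Icc (0 : ℝ) L, (deriv γ t).1 ^ 2 + (deriv γ t).2 ^ 2 = 1)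
    (hcurv : ∀ t ∈ Set.Icc (0 : ℝ) L, deriv (deriv γ) t ≠ 0) :
    ∃ C > 0, ∀ u₁ u₂ lam : ℝ, u₁ ^ 2 + u₂ ^ 2 = 1 → 1 ≤ lam →
      ∫ t in (0 : ℝ)..L, 1 / (1 + lam * (u₁ * (deriv γ t).1 + u₂ * (deriv γ t).2) ^ 2) ≤
        C / √lam := by
  set p : ℝ → ℝ := fun t => (deriv γ t).1
  set q : ℝ → ℝ := fun t => (deriv γ t).2
  set p₁ : ℝ → ℝ := fun t => (deriv (deriv γ) t).1
  set q₁ : ℝ → ℝ := fun t => (deriv (deriv γ) t).2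
  set p₂ : ℝ → ℝ := fun t => (deriv (deriv (deriv γ)) t).1
  set q₂ : ℝ → ℝ := fun t => (deriv (deriv (deriv γ)) t).2
  have s1 := hγ.deriv_top
  have s2 := s1.deriv_top
  have s3 := s2.deriv_top
  have dp : ∀ t, HasDerivAt p (p₁ t) t := fun t => (s1.hasDerivAt_top t).prod_fst
  have dq : ∀ t, HasDerivAt q (q₁ t) t := fun t => (s1.hasDerivAt_top t).prod_snd
  have dp₁ : ∀ t, HasDerivAt p₁ (p₂ t) t := fun t => (s2.hasDerivAt_top t).prod_fst
  have dq₁ : ∀ t, HasDerivAt q₁ (q₂ t) t := fun t => (s2.hasDerivAt_top t).prod_snd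
  have cp : Continuous p := continuous_fst.comp s1.continuous
  have cq : Continuous q := continuous_snd.comp s1.continuous
  have cp₁ : Continuous p₁ := continuous_fst.comp s2.continuous
  have cq₁ : Continuous q₁ := continuous_snd.comp s2.continuous
  have cp₂ : Continuous p₂ := continuous_fst.comp s3.continuous
  have cq₂ : Continuous q₂ := continuous_snd.comp s3.continuous
  set κ : ℝ → ℝ := fun t => p t * q₁ t - q t * p₁ t
  set κ₁ : ℝ → ℝ := fun t => p t * q₂ t - q t * p₂ t
  have dκ : ∀ t, HasDerivAt κ (κ₁ t) t := fun t => by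
    refine (((dp t).mul (dq₁ t)).sub ((dq t).mul (dp₁ t))).congr_deriv ?_
    simp only [κ₁]; ring
  have cκ : Continuous κ := (cp.mul cq₁).sub (cq.mul cp₁)
  have cκ₁ : Continuous κ₁ := (cp.mul cq₂).sub (cq.mul cp₂)
  have horth : ∀ t ∈ Set.Icc 0 L, p t * p₁ t + q t * q₁ t = 0 := fun t ht => by
    have : 2 * (p t * p₁ t + q t * q₁ t) = 0 :=
      HasDerivAt.eq_zero_of_const_on_Icc hL hunit ht
        ((((dp t).pow 2).add ((dq t).pow 2)).congr_deriv (by push_cast; ring))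
    linarith
  have hp₁ : ∀ t ∈ Set.Icc 0 L, p₁ t = -(κ t * q t) := fun t ht => by
    simp only [κ]; linear_combination p t * horth t ht - p₁ t * hunit t ht
  have hq₁ : ∀ t ∈ Set.Icc 0 L, q₁ t = κ t * p t := fun t ht => by
    simp only [κ]; linear_combination q t * horth t ht - q₁ t * hunit t ht
  have hκne : ∀ t ∈ Set.Icc 0 L, κ t ≠ 0 := fun t ht h => by
    refine hcurv t ht (Prod.ext ?_ ?_)
    · change p₁ t = 0; rw [hp₁ t ht, h]; ring
    · change q₁ t = 0; rw [hq₁ t ht, h]; ring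
  have hne : (Set.Icc 0 L).Nonempty := Set.nonempty_Icc.2 hL.le
  obtain ⟨t₀, ht₀, hmin⟩ := isCompact_Icc.exists_isMinOn hne cκ.abs.continuousOn
  obtain ⟨k₁, hk₁⟩ := isCompact_Icc.exists_bound_of_continuousOn (s := Set.Icc 0 L)
    cκ₁.continuousOn
  have hk₀ : 0 < |κ t₀| := abs_pos.2 (hκne t₀ ht₀)
  have hk₁0 : 0 ≤ k₁ := (norm_nonneg _).trans (hk₁ t₀ ht₀)
  refine ⟨L + π / |κ t₀| + L * ((1 + k₁ / |κ t₀| ^ 2) * (π / 2)), by positivity,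
    fun u₁ u₂ lam hu hlam => ?_⟩
  exact integral_inv_one_add_le hL.le hk₀ (fun t ht => hp₁ t ht ▸ dp t)
    (fun t ht => hq₁ t ht ▸ dq t) hunit (fun t _ => dκ t) cκ₁.continuousOn
    (fun t ht => hmin ht) hk₁ hu hlam

/-- The phase `2π⟨v, γ(t)⟩`. -/
def phase (γ : ℝ → ℝ × ℝ) (v : ℤ × ℤ) (t : ℝ) : ℝ :=
  2 * π * ((v.1 : ℝ) * (γ t).1 + (v.2 : ℝ) * (γ t).2)

lemma hasDerivAt_phase {γ : ℝ → ℝ × ℝ} {t : ℝ} {w : ℝ × ℝ} (h : HasDerivAt γ w t) (v : ℤ × ℤ) :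
    HasDerivAt (phase γ v) (2 * π * ((v.1 : ℝ) * w.1 + (v.2 : ℝ) * w.2)) t :=
  ((h.prod_fst.const_mul (v.1 : ℝ)).add (h.prod_snd.const_mul (v.2 : ℝ))).const_mul (2 * π)

lemma exists_norm_integral_phase_le {L : ℝ} (hL : 0 < L) {γ : ℝ → ℝ × ℝ}
    (hγ : ContDiff ℝ (⊤ : ℕ∞) γ)
    (hunit : ∀ t ∈ Set.Icc (0 : ℝ) L, (deriv γ t).1 ^ 2 + (deriv γ t).2 ^ 2 = 1)
    (hcurv : ∀ t ∈ Set.Icc (0 : ℝ) L, deriv (deriv γ) t ≠ 0) :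
    ∃ C > 0, ∀ (v : ℤ × ℤ) (K : ℝ) (A A' : ℝ → ℂ), (∀ t, HasDerivAt A (A' t) t) →
      Continuous A' → (∀ t ∈ Set.Icc 0 L, ‖A t‖ ≤ K) → (∀ t ∈ Set.Icc 0 L, ‖A' t‖ ≤ K) →
      ‖∫ t in (0 : ℝ)..L, A t * Complex.exp (Complex.I * phase γ v t)‖ ≤
        C * K * √(invLen v) := by
  obtain ⟨C₀, hC₀, hJ⟩ := exists_integral_curve_le hL hγ hunit hcurv
  have s1 := hγ.deriv_top
  have s2 := s1.deriv_top
  obtain ⟨k, hk⟩ := isCompact_Icc.exists_bound_of_continuousOn (s := Set.Icc 0 L)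
    s2.continuous.continuousOn
  have hk0 : 0 ≤ k := (norm_nonneg _).trans (hk 0 ⟨le_rfl, hL.le⟩)
  refine ⟨(1 + L) + (4 * π * k + 1) * C₀, by positivity, fun v K A A' hA hA' hAK hA'K => ?_⟩
  have hK : 0 ≤ K := (norm_nonneg _).trans (hAK 0 ⟨le_rfl, hL.le⟩)
  by_cases hv : v = 0
  · subst hv
    have : ‖∫ t in (0 : ℝ)..L, A t * Complex.exp (Complex.I * phase γ 0 t)‖ ≤ K * |L - 0| := by
      refine intervalIntegral.norm_integral_le_of_norm_le_const fun t ht => ?_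
      rw [Set.uIoc_of_le hL.le] at ht
      rw [norm_mul, mul_comm Complex.I, Complex.norm_exp_ofReal_mul_I, mul_one]
      exact hAK t ⟨ht.1.le, ht.2⟩
    rw [sub_zero, abs_of_pos hL] at this
    refine this.trans ?_
    simp only [invLen, if_true, Real.sqrt_one, mul_one]
    have : 0 ≤ (4 * π * k + 1) * C₀ := by positivity
    nlinarith
  have hsq : (1 : ℝ) ≤ sqLen v := by exact_mod_cast sqLen_pos hv
  have hsqe : (sqLen v : ℝ) = (v.1 : ℝ) ^ 2 + (v.2 : ℝ) ^ 2 := by unfold sqLen; push_cast; ring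
  set lam : ℝ := √(sqLen v : ℝ) with hlamdef
  have hlam : 1 ≤ lam := Real.one_le_sqrt.2 hsq
  have hlam0 : 0 < lam := by linarith
  have hlam2 : lam ^ 2 = (v.1 : ℝ) ^ 2 + (v.2 : ℝ) ^ 2 := by
    rw [hlamdef, Real.sq_sqrt (by linarith), hsqe]
  have hinv : √(invLen v) = 1 / √lam := by
    rw [invLen, if_neg hv, Real.sqrt_inv, one_div]
  have hv1 : |(v.1 : ℝ)| ≤ lam := abs_le_of_sq_le_sq (by nlinarith [sq_nonneg (v.2 : ℝ)]) hlam0.le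
  have hv2 : |(v.2 : ℝ)| ≤ lam := abs_le_of_sq_le_sq (by nlinarith [sq_nonneg (v.1 : ℝ)]) hlam0.le
  set φ' : ℝ → ℝ := fun t => 2 * π * ((v.1 : ℝ) * (deriv γ t).1 + (v.2 : ℝ) * (deriv γ t).2)
  set φ'' : ℝ → ℝ := fun t =>
    2 * π * ((v.1 : ℝ) * (deriv (deriv γ) t).1 + (v.2 : ℝ) * (deriv (deriv γ) t).2)
  have c2 := s2.continuous
  have c1 := s1.continuous
  have cφ' : Continuous φ' := by fun_prop
  have cφ'' : Continuous φ'' := by fun_prop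
  have hmain := norm_integral_mul_cexp_le (K := K) (M := 4 * π * k) (J := C₀ / √lam) hL.le hlam0
    (by positivity) (φ := phase γ v) (φ' := φ') (φ'' := φ'') (A := A) (A' := A')
    (fun t => hasDerivAt_phase (hγ.hasDerivAt_top t) v)
    (fun t => hasDerivAt_phase (s1.hasDerivAt_top t) v) cφ'' hA hA' hAK hA'K ?_ ?_
  · rw [hinv]
    refine hmain.trans_eq ?_
    field_simp
  · intro t ht
    have h1 := hk t ht
    rw [Prod.norm_def, max_le_iff, Real.norm_eq_abs, Real.norm_eq_abs] at h1
    simp only [φ'']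
    rw [abs_mul, abs_of_pos (by positivity : 0 < 2 * π)]
    have h2 := abs_add_le ((v.1 : ℝ) * (deriv (deriv γ) t).1) ((v.2 : ℝ) * (deriv (deriv γ) t).2)
    rw [abs_mul, abs_mul] at h2
    have h3 := mul_le_mul hv1 h1.1 (abs_nonneg _) hlam0.le
    have h4 := mul_le_mul hv2 h1.2 (abs_nonneg _) hlam0.le
    have : 2 * π * |(v.1 : ℝ) * (deriv (deriv γ) t).1 + (v.2 : ℝ) * (deriv (deriv γ) t).2| ≤
        2 * π * (lam * k + lam * k) := by gcongr; linarith
    linarith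
  · have hu : ((v.1 : ℝ) / lam) ^ 2 + ((v.2 : ℝ) / lam) ^ 2 = 1 := by
      rw [div_pow, div_pow, ← add_div, ← hlam2]; exact div_self (by positivity)
    refine le_trans ?_ (hJ _ _ lam hu hlam)
    have hpos1 : ∀ t, 0 < φ' t ^ 2 + lam := fun t => by positivity
    have hpos2 : ∀ t, 0 < 1 + lam * ((v.1 : ℝ) / lam * (deriv γ t).1 +
      (v.2 : ℝ) / lam * (deriv γ t).2) ^ 2 := fun t => by positivity
    refine intervalIntegral.integral_mono_on hL.le ?_ ?_ fun t _ => ?_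
    · exact (continuous_const.div ((cφ'.pow 2).add_const _)
        fun t => (hpos1 t).ne').intervalIntegrable 0 L
    · refine (continuous_const.div ?_ fun t => (hpos2 t).ne').intervalIntegrable 0 L
      fun_prop
    · rw [div_le_div_iff₀ (hpos1 t) (hpos2 t)]
      set z := (v.1 : ℝ) * (deriv γ t).1 + (v.2 : ℝ) * (deriv γ t).2 with hz
      have e1 : (v.1 : ℝ) / lam * (deriv γ t).1 + (v.2 : ℝ) / lam * (deriv γ t).2 = z / lam := by
        rw [hz]; ring
      have e2 : φ' t = 2 * π * z := rfl
      have e3 : lam * (1 + lam * (z / lam) ^ 2) = lam + z ^ 2 := by field_simp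
      rw [e1, e2, e3]
      have : 1 ≤ (2 * π) ^ 2 := by nlinarith [Real.pi_gt_three]
      nlinarith [sq_nonneg z]

lemma invLen_neg (v : ℤ × ℤ) : invLen (-v) = invLen v := by
  simp [invLen, sqLen]

lemma phase_add (γ : ℝ → ℝ × ℝ) (v w : ℤ × ℤ) (t : ℝ) :
    phase γ (v + w) t = phase γ v t + phase γ w t := by
  simp only [phase, Prod.fst_add, Prod.snd_add]; push_cast; ring

lemma phase_neg (γ : ℝ → ℝ × ℝ) (v : ℤ × ℤ) (t : ℝ) : phase γ (-v) t = -phase γ v t := by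
  simp only [phase, Prod.fst_neg, Prod.snd_neg]; push_cast; ring

lemma Continuous.phase {γ : ℝ → ℝ × ℝ} (h : Continuous γ) (v : ℤ × ℤ) :
    Continuous (phase γ v) := by
  unfold _root_.phase; fun_prop

lemma sum_pow_four {ι : Type*} (s : Finset ι) (f : ι → ℂ) :
    (∑ i ∈ s, f i) ^ 4 = ∑ x ∈ s ×ˢ s ×ˢ s ×ˢ s, f x.1 * f x.2.1 * f x.2.2.1 * f x.2.2.2 := by
  simp only [Finset.sum_product, ← Finset.mul_sum, ← Finset.sum_mul]
  ring

/-- Fourth moment of a kernel `N⁻¹ ∑ A_μ(t) e(⟨μ,γ(t)⟩) B_μ(s) e(-⟨μ,γ(s)⟩)`. -/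
lemma exists_integral_pow_four_le {L : ℝ} (hL : 0 < L) {γ : ℝ → ℝ × ℝ}
    (hγ : ContDiff ℝ (⊤ : ℕ∞) γ)
    (hunit : ∀ t ∈ Set.Icc (0 : ℝ) L, (deriv γ t).1 ^ 2 + (deriv γ t).2 ^ 2 = 1)
    (hcurv : ∀ t ∈ Set.Icc (0 : ℝ) L, deriv (deriv γ) t ≠ 0) {K : ℝ} (hK : 1 ≤ K) :
    ∃ C > 0, ∀ m : ℕ, m ≠ 0 → 0 < latN m → ∀ A A' B B' : ℤ × ℤ → ℝ → ℂ,
      (∀ μ t, HasDerivAt (A μ) (A' μ t) t) → (∀ μ, Continuous (A' μ)) →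
      (∀ μ t, HasDerivAt (B μ) (B' μ t) t) → (∀ μ, Continuous (B' μ)) →
      (∀ μ ∈ latticeSet m, ∀ t ∈ Set.Icc 0 L, ‖A μ t‖ ≤ K ∧ ‖A' μ t‖ ≤ K) →
      (∀ μ ∈ latticeSet m, ∀ t ∈ Set.Icc 0 L, ‖B μ t‖ ≤ K ∧ ‖B' μ t‖ ≤ K) →
      ∀ q : ℝ → ℝ → ℝ, (∀ t s, (q t s : ℂ) = (latN m : ℂ)⁻¹ * ∑ μ ∈ latticeSet m,
        (A μ t * Complex.exp (Complex.I * phase γ μ t)) *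
          (B μ s * Complex.exp (Complex.I * phase γ (-μ) s))) →
      ∫ t in (0 : ℝ)..L, ∫ s in (0 : ℝ)..L, q t s ^ 4 ≤ C / (latN m * √(latN m)) := by
  obtain ⟨C₀, hC₀, hosc⟩ := exists_norm_integral_phase_le hL hγ hunit hcurv
  obtain ⟨C₁, hC₁, hsum⟩ := exists_sum_invLen_le
  refine ⟨(C₀ * (4 * K ^ 4)) ^ 2 * C₁, by positivity, ?_⟩
  intro m hm hN A A' B B' hA hA' hB hB' hAK hBK q hq
  set E := latticeSet m
  set S := E ×ˢ E ×ˢ E ×ˢ E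
  have hN0 : (0 : ℝ) < latN m := by exact_mod_cast hN
  have prodBound : ∀ (A A' : ℤ × ℤ → ℝ → ℂ) (w : ℤ × ℤ) , (∀ μ t, HasDerivAt (A μ) (A' μ t) t) →
      (∀ μ, Continuous (A' μ)) →
      (∀ μ ∈ E, ∀ t ∈ Set.Icc 0 L, ‖A μ t‖ ≤ K ∧ ‖A' μ t‖ ≤ K) → ∀ x ∈ S,
      ‖∫ t in (0 : ℝ)..L, A x.1 t * A x.2.1 t * A x.2.2.1 t * A x.2.2.2 t *
        Complex.exp (Complex.I * phase γ w t)‖ ≤ C₀ * (4 * K ^ 4) * √(invLen w) := by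
    intro A A' w hA hA' hAK x hx
    obtain ⟨h1, h2, h3, h4⟩ : x.1 ∈ E ∧ x.2.1 ∈ E ∧ x.2.2.1 ∈ E ∧ x.2.2.2 ∈ E := by
      simpa [S] using hx
    have cA : ∀ μ, Continuous (A μ) := fun μ =>
      continuous_iff_continuousAt.2 fun t => (hA μ t).continuousAt
    refine hosc w (4 * K ^ 4) _ _ (fun t => (((hA x.1 t).mul (hA x.2.1 t)).mul
      (hA x.2.2.1 t)).mul (hA x.2.2.2 t)) ?_ ?_ ?_
    · have := cA x.1; have := cA x.2.1; have := cA x.2.2.1; have := cA x.2.2.2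
      have := hA' x.1; have := hA' x.2.1; have := hA' x.2.2.1; have := hA' x.2.2.2
      simp only [Pi.mul_apply]
      fun_prop
    · intro t ht
      simp only [norm_mul]
      calc _ ≤ K * K * K * K := by
            gcongr
            · exact (hAK _ h1 t ht).1
            · exact (hAK _ h2 t ht).1
            · exact (hAK _ h3 t ht).1
            · exact (hAK _ h4 t ht).1
        _ ≤ 4 * K ^ 4 := by nlinarith [pow_pos (zero_lt_one.trans_le hK) 4]
    · intro t ht
      have a1 := hAK _ h1 t ht
      have a2 := hAK _ h2 t ht
      have a3 := hAK _ h3 t ht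
      have a4 := hAK _ h4 t ht
      simp only [Pi.mul_apply]
      rw [show ((A' x.1 t * A x.2.1 t + A x.1 t * A' x.2.1 t) * A x.2.2.1 t +
        A x.1 t * A x.2.1 t * A' x.2.2.1 t) * A x.2.2.2 t +
        A x.1 t * A x.2.1 t * A x.2.2.1 t * A' x.2.2.2 t =
        A' x.1 t * A x.2.1 t * A x.2.2.1 t * A x.2.2.2 t +
        A x.1 t * A' x.2.1 t * A x.2.2.1 t * A x.2.2.2 t +
        A x.1 t * A x.2.1 t * A' x.2.2.1 t * A x.2.2.2 t +
        A x.1 t * A x.2.1 t * A x.2.2.1 t * A' x.2.2.2 t by ring]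
      have key : ∀ z₁ z₂ z₃ z₄ : ℂ, ‖z₁‖ ≤ K → ‖z₂‖ ≤ K → ‖z₃‖ ≤ K → ‖z₄‖ ≤ K →
          ‖z₁ * z₂ * z₃ * z₄‖ ≤ K ^ 4 := by
        intro z₁ z₂ z₃ z₄ e1 e2 e3 e4
        simp only [norm_mul]
        calc _ ≤ K * K * K * K := by gcongr
          _ = K ^ 4 := by ring
      refine (norm_add_le _ _).trans ?_
      have := norm_add₃_le (a := A' x.1 t * A x.2.1 t * A x.2.2.1 t * A x.2.2.2 t)
        (b := A x.1 t * A' x.2.1 t * A x.2.2.1 t * A x.2.2.2 t)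
        (c := A x.1 t * A x.2.1 t * A' x.2.2.1 t * A x.2.2.2 t)
      linarith [key _ _ _ _ a1.2 a2.1 a3.1 a4.1, key _ _ _ _ a1.1 a2.2 a3.1 a4.1,
        key _ _ _ _ a1.1 a2.1 a3.2 a4.1, key _ _ _ _ a1.1 a2.1 a3.1 a4.2]
  set P : (ℤ × ℤ) × (ℤ × ℤ) × (ℤ × ℤ) × (ℤ × ℤ) → ℝ → ℂ := fun x t =>
    A x.1 t * A x.2.1 t * A x.2.2.1 t * A x.2.2.2 t *
      Complex.exp (Complex.I * phase γ (x.1 + x.2.1 + x.2.2.1 + x.2.2.2) t)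
  set Q : (ℤ × ℤ) × (ℤ × ℤ) × (ℤ × ℤ) × (ℤ × ℤ) → ℝ → ℂ := fun x s =>
    B x.1 s * B x.2.1 s * B x.2.2.1 s * B x.2.2.2 s *
      Complex.exp (Complex.I * phase γ (-(x.1 + x.2.1 + x.2.2.1 + x.2.2.2)) s)
  have hPQ : ∀ t s, ((q t s ^ 4 : ℝ) : ℂ) = ∑ x ∈ S, (latN m : ℂ)⁻¹ ^ 4 * P x t * Q x s := by
    intro t s
    rw [Complex.ofReal_pow, hq, mul_pow, sum_pow_four, Finset.mul_sum]
    refine Finset.sum_congr rfl fun x _ => ?_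
    simp only [P, Q, phase_add, neg_add, Complex.ofReal_add, mul_add, Complex.exp_add]
    ring
  have cP : ∀ x, Continuous (P x) := fun x => by
    have cA : ∀ μ, Continuous (A μ) := fun μ =>
      continuous_iff_continuousAt.2 fun t => (hA μ t).continuousAt
    have := cA x.1; have := cA x.2.1; have := cA x.2.2.1; have := cA x.2.2.2
    have := hγ.continuous.phase (x.1 + x.2.1 + x.2.2.1 + x.2.2.2)
    fun_prop
  have cQ : ∀ x, Continuous (Q x) := fun x => by
    have cB : ∀ μ, Continuous (B μ) := fun μ =>
      continuous_iff_continuousAt.2 fun t => (hB μ t).continuousAt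
    have := cB x.1; have := cB x.2.1; have := cB x.2.2.1; have := cB x.2.2.2
    have := hγ.continuous.phase (-(x.1 + x.2.1 + x.2.2.1 + x.2.2.2))
    fun_prop
  have hint : ((∫ t in (0 : ℝ)..L, ∫ s in (0 : ℝ)..L, q t s ^ 4 : ℝ) : ℂ) =
      ∑ x ∈ S, (latN m : ℂ)⁻¹ ^ 4 * (∫ t in (0 : ℝ)..L, P x t) * ∫ s in (0 : ℝ)..L, Q x s := by
    rw [← intervalIntegral.integral_ofReal]
    have e : ∀ t, ((∫ s in (0 : ℝ)..L, q t s ^ 4 : ℝ) : ℂ) =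
        ∑ x ∈ S, (latN m : ℂ)⁻¹ ^ 4 * P x t * ∫ s in (0 : ℝ)..L, Q x s := by
      intro t
      rw [← intervalIntegral.integral_ofReal]
      simp_rw [hPQ]
      rw [intervalIntegral.integral_finsetSum fun x _ =>
        ((cQ x).intervalIntegrable 0 L).const_mul _]
      simp_rw [intervalIntegral.integral_const_mul]
    simp_rw [e]
    rw [intervalIntegral.integral_finsetSum fun x _ =>
      (((cP x).intervalIntegrable 0 L).const_mul _).mul_const _]
    simp_rw [intervalIntegral.integral_mul_const, intervalIntegral.integral_const_mul]
  calc ∫ t in (0 : ℝ)..L, ∫ s in (0 : ℝ)..L, q t s ^ 4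
      ≤ ‖((∫ t in (0 : ℝ)..L, ∫ s in (0 : ℝ)..L, q t s ^ 4 : ℝ) : ℂ)‖ := by
        rw [Complex.norm_real]; exact Real.le_norm_self _
    _ ≤ ∑ x ∈ S, (latN m : ℝ)⁻¹ ^ 4 * ((C₀ * (4 * K ^ 4)) ^ 2 *
          invLen (x.1 + x.2.1 + x.2.2.1 + x.2.2.2)) := by
        rw [hint]
        refine norm_sum_le_of_le _ fun x hx => ?_
        rw [norm_mul, norm_mul, norm_pow, norm_inv, Complex.norm_natCast, mul_assoc]
        have h1 := prodBound A A' (x.1 + x.2.1 + x.2.2.1 + x.2.2.2) hA hA' hAK x hx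
        have h2 := prodBound B B' (-(x.1 + x.2.1 + x.2.2.1 + x.2.2.2)) hB hB' hBK x hx
        rw [invLen_neg] at h2
        refine mul_le_mul_of_nonneg_left ?_ (by positivity)
        refine (mul_le_mul h1 h2 (norm_nonneg _) (by positivity)).trans_eq ?_
        have := Real.mul_self_sqrt (invLen_nonneg (x.1 + x.2.1 + x.2.2.1 + x.2.2.2))
        linear_combination (C₀ * (4 * K ^ 4)) ^ 2 * this
    _ = (latN m : ℝ)⁻¹ ^ 4 * ((C₀ * (4 * K ^ 4)) ^ 2 * ∑ a ∈ E, ∑ b ∈ E, ∑ c ∈ E, ∑ d ∈ E,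
          invLen (a + b + c + d)) := by
        simp only [S, Finset.sum_product, Finset.mul_sum]
    _ ≤ (latN m : ℝ)⁻¹ ^ 4 * ((C₀ * (4 * K ^ 4)) ^ 2 *
          (C₁ * ((latN m : ℝ) ^ 2 * √(latN m)))) := by
        have := hsum m hm hN
        gcongr
    _ = (C₀ * (4 * K ^ 4)) ^ 2 * C₁ / (latN m * √(latN m)) := by
        have h1 : (0 : ℝ) < √(latN m) := Real.sqrt_pos.2 hN0
        have h2 := Real.sq_sqrt hN0.le
        field_simp
        rw [h2]

/-- The tent function of height `1/ε` supported on `[-ε, ε]`. -/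
def tent (ε x : ℝ) : ℝ := ε⁻¹ * max 0 (1 - |x| / ε)

lemma tent_nonneg {ε : ℝ} (hε : 0 < ε) (x : ℝ) : 0 ≤ tent ε x := by unfold tent; positivity

lemma tent_le {ε : ℝ} (hε : 0 < ε) (x : ℝ) : tent ε x ≤ ε⁻¹ := by
  unfold tent
  have : max 0 (1 - |x| / ε) ≤ 1 := max_le zero_le_one (by linarith [div_nonneg (abs_nonneg x) hε.le])
  have h := inv_pos.2 hε
  nlinarith

lemma tent_neg (ε x : ℝ) : tent ε (-x) = tent ε x := by simp [tent]

lemma tent_eq_zero {ε : ℝ} (hε : 0 < ε) {x : ℝ} (hx : ε ≤ |x|) : tent ε x = 0 := by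
  unfold tent
  rw [max_eq_left, mul_zero]
  rw [sub_nonpos, one_le_div hε]; exact hx

lemma continuous_tent (ε : ℝ) : Continuous (tent ε) := by unfold tent; fun_prop

lemma integral_tent_half {ε : ℝ} (hε : 0 < ε) : ∫ x in (0 : ℝ)..ε, tent ε x = 1 / 2 := by
  have : ∀ x ∈ Set.uIcc 0 ε, tent ε x = ε⁻¹ * (1 - ε⁻¹ * x) := fun x hx => by
    rw [Set.uIcc_of_le hε.le] at hx
    unfold tent
    rw [abs_of_nonneg hx.1, max_eq_right, div_eq_inv_mul]
    rw [sub_nonneg, div_le_one hε]; exact hx.2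
  rw [intervalIntegral.integral_congr this, intervalIntegral.integral_const_mul,
    intervalIntegral.integral_sub (by simp)
      (Continuous.intervalIntegrable (by fun_prop) _ _), intervalIntegral.integral_const_mul]
  simp only [intervalIntegral.integral_const, integral_id, smul_eq_mul]
  field_simp; ring

/-- The primitive of the tent function vanishing at the origin. -/
def tentPrim (ε x : ℝ) : ℝ := ∫ y in (0 : ℝ)..x, tent ε y

lemma hasDerivAt_tentPrim (ε x : ℝ) : HasDerivAt (tentPrim ε) (tent ε x) x :=
  intervalIntegral.integral_hasDerivAt_right ((continuous_tent ε).intervalIntegrable _ _)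
    (continuous_tent ε).aestronglyMeasurable.stronglyMeasurableAtFilter
    (continuous_tent ε).continuousAt

lemma tentPrim_neg (ε x : ℝ) : tentPrim ε (-x) = -tentPrim ε x := by
  have h := intervalIntegral.integral_comp_neg (a := 0) (b := x) (fun y => tent ε y)
  simp only [tent_neg, neg_zero] at h
  rw [tentPrim, tentPrim, h, intervalIntegral.integral_symm]

lemma tentPrim_of_le {ε x : ℝ} (hε : 0 < ε) (hx : ε ≤ x) : tentPrim ε x = 1 / 2 := by
  have hi : ∀ a b, IntervalIntegrable (tent ε) volume a b := fun a b =>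
    (continuous_tent ε).intervalIntegrable a b
  rw [tentPrim, ← intervalIntegral.integral_add_adjacent_intervals (hi 0 ε) (hi ε x),
    integral_tent_half hε]
  have : ∫ y in ε..x, tent ε y = ∫ y in ε..x, (0 : ℝ) :=
    intervalIntegral.integral_congr fun y hy => by
      rw [Set.uIcc_of_le hx] at hy
      exact tent_eq_zero hε (hy.1.trans (le_abs_self y))
  rw [this]; simp

lemma monotone_tentPrim {ε : ℝ} (hε : 0 < ε) : Monotone (tentPrim ε) :=
  monotone_of_hasDerivAt_nonneg (hasDerivAt_tentPrim ε) fun x => tent_nonneg hε x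

lemma tentPrim_le {ε : ℝ} (hε : 0 < ε) (x : ℝ) : tentPrim ε x ≤ 1 / 2 := by
  rw [← tentPrim_of_le hε (le_max_left ε x)]
  exact monotone_tentPrim hε (le_max_right ε x)

lemma neg_half_le_tentPrim {ε : ℝ} (hε : 0 < ε) (x : ℝ) : -(1 / 2) ≤ tentPrim ε x := by
  have := tentPrim_le hε (-x)
  rw [tentPrim_neg] at this; linarith

lemma tentPrim_of_le_neg {ε x : ℝ} (hε : 0 < ε) (hx : x ≤ -ε) : tentPrim ε x = -(1 / 2) := by
  rw [← tentPrim_of_le hε (show ε ≤ -x by linarith), tentPrim_neg, neg_neg]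

/-- The smoothed count of the zeros of `f` on `[a, b]`. -/
def kacInt (f f' : ℝ → ℝ) (ε a b : ℝ) : ℝ := ∫ t in a..b, tent ε (f t) * |f' t|

/-- The set of zeros of `f` on `[a, b]`. -/
def zeroSet (f : ℝ → ℝ) (a b : ℝ) : Set ℝ := {t | t ∈ Set.Icc a b ∧ f t = 0}

lemma zeroSet_union {f : ℝ → ℝ} {a b c : ℝ} (hac : a ≤ c) (hcb : c ≤ b) :
    zeroSet f a b = zeroSet f a c ∪ zeroSet f c b := by
  ext t
  simp only [zeroSet, Set.mem_ofPred_eq, Set.mem_union, Set.mem_Icc]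
  constructor
  · rintro ⟨⟨h1, h2⟩, h3⟩
    rcases le_total t c with h | h
    · exact Or.inl ⟨⟨h1, h⟩, h3⟩
    · exact Or.inr ⟨⟨h, h2⟩, h3⟩
  · rintro (⟨⟨h1, h2⟩, h3⟩ | ⟨⟨h1, h2⟩, h3⟩)
    · exact ⟨⟨h1, h2.trans hcb⟩, h3⟩
    · exact ⟨⟨hac.trans h1, h2⟩, h3⟩

lemma ncard_zeroSet_add {f : ℝ → ℝ} {a b c : ℝ} (hac : a ≤ c) (hcb : c ≤ b) (hc : f c ≠ 0)
    (h1 : (zeroSet f a c).Finite) (h2 : (zeroSet f c b).Finite) :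
    (zeroSet f a b).ncard = (zeroSet f a c).ncard + (zeroSet f c b).ncard := by
  rw [zeroSet_union hac hcb, Set.ncard_union_eq _ h1 h2]
  rw [Set.disjoint_left]
  rintro t ⟨ht, h0⟩ ⟨ht', -⟩
  exact hc (le_antisymm ht.2 ht'.1 ▸ h0)

lemma kacInt_add {f f' : ℝ → ℝ} (hf : Continuous f) (hf' : Continuous f') (ε a b c : ℝ) :
    kacInt f f' ε a b = kacInt f f' ε a c + kacInt f f' ε c b := by
  have : Continuous fun t => tent ε (f t) * |f' t| := ((continuous_tent ε).comp hf).mul hf'.abs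
  exact (intervalIntegral.integral_add_adjacent_intervals (this.intervalIntegrable _ _)
    (this.intervalIntegrable _ _)).symm

/-- The conclusion of the Kac formula with at most `n` zeros. -/
def KacProp (f f' : ℝ → ℝ) (a b : ℝ) (n : ℕ) : Prop :=
  (∀ ε, 0 < ε → kacInt f f' ε a b ≤ n) ∧ (zeroSet f a b).Finite ∧ (zeroSet f a b).ncard ≤ n ∧
    Filter.Tendsto (fun ε => kacInt f f' ε a b) (nhdsWithin 0 (Set.Ioi 0))
      (nhds ((zeroSet f a b).ncard : ℝ))

lemma KacProp.neg {f f' : ℝ → ℝ} {a b : ℝ} {n : ℕ}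
    (h : KacProp (fun t => -f t) (fun t => -f' t) a b n) : KacProp f f' a b n := by
  have e1 : ∀ ε, kacInt (fun t => -f t) (fun t => -f' t) ε a b = kacInt f f' ε a b := fun ε => by
    simp [kacInt, tent_neg]
  have e2 : zeroSet (fun t => -f t) a b = zeroSet f a b := by simp [zeroSet]
  simpa only [KacProp, e1, e2] using h

lemma kacProp_of_pos {f f' : ℝ → ℝ} (hf : ∀ t, HasDerivAt f (f' t) t) (hf' : Continuous f')
    {a b : ℝ} (hab : a < b) (hpos : ∀ t ∈ Set.Ioo a b, 0 < f' t) (ha : f a ≠ 0) (hb : f b ≠ 0) :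
    KacProp f f' a b 1 := by
  have cf : Continuous f := continuous_iff_continuousAt.2 fun t => (hf t).continuousAt
  have hnn : ∀ t ∈ Set.Icc a b, 0 ≤ f' t := by
    have hcl : Set.Icc a b ⊆ closure (Set.Ioo a b) := by rw [closure_Ioo hab.ne]
    intro t ht
    exact closure_minimal (fun s hs => (hpos s hs).le) (isClosed_le continuous_const hf') (hcl ht)
  have hmono : StrictMonoOn f (Set.Icc a b) := by
    refine strictMonoOn_of_deriv_pos (convex_Icc a b) cf.continuousOn fun t ht => ?_
    rw [interior_Icc] at ht
    rw [(hf t).deriv]; exact hpos t ht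
  have hval : ∀ ε, kacInt f f' ε a b = tentPrim ε (f b) - tentPrim ε (f a) := fun ε => by
    have e : kacInt f f' ε a b = ∫ t in a..b, tent ε (f t) * f' t :=
      intervalIntegral.integral_congr fun t ht => by
        rw [Set.uIcc_of_le hab.le] at ht
        simp only [abs_of_nonneg (hnn t ht)]
    rw [e]
    refine intervalIntegral.integral_eq_sub_of_hasDerivAt (f := fun t => tentPrim ε (f t))
      (fun t _ => (hasDerivAt_tentPrim ε (f t)).comp t (hf t)) ?_
    exact (((continuous_tent ε).comp cf).mul hf').intervalIntegrable _ _
  have hsub : (zeroSet f a b).Subsingleton := by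
    rintro s ⟨hs, h0⟩ t ⟨ht, h1⟩
    exact hmono.injOn hs ht (h0.trans h1.symm)
  have hle : (zeroSet f a b).ncard ≤ 1 := by
    have := hsub.finite.to_subtype
    exact Set.ncard_le_one_iff_subsingleton.2 hsub
  refine ⟨fun ε hε => ?_, hsub.finite, hle, ?_⟩
  · rw [hval, Nat.cast_one]
    linarith [tentPrim_le hε (f b), neg_half_le_tentPrim hε (f a)]
  have hfab : f a < f b := hmono ⟨le_rfl, hab.le⟩ ⟨hab.le, le_rfl⟩ hab
  have hev : ∀ᶠ ε : ℝ in nhdsWithin 0 (Set.Ioi 0), 0 < ε ∧ ε ≤ |f a| ∧ ε ≤ |f b| := by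
    filter_upwards [self_mem_nhdsWithin,
      nhdsWithin_le_nhds (Iic_mem_nhds (abs_pos.2 ha)),
      nhdsWithin_le_nhds (Iic_mem_nhds (abs_pos.2 hb))] with ε h1 h2 h3
    exact ⟨h1, h2, h3⟩
  refine Filter.Tendsto.congr' (f₁ := fun _ => ((zeroSet f a b).ncard : ℝ)) ?_ tendsto_const_nhds
  filter_upwards [hev] with ε ⟨hε, h1, h2⟩
  rw [hval]
  rcases lt_or_gt_of_ne ha with ha' | ha'
  · rcases lt_or_gt_of_ne hb with hb' | hb'
    · have : zeroSet f a b = ∅ := by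
        rw [Set.eq_empty_iff_forall_notMem]
        rintro t ⟨ht, h0⟩
        have := hmono.monotoneOn ht ⟨hab.le, le_rfl⟩ ht.2
        linarith
      rw [abs_of_neg ha'] at h1
      rw [abs_of_neg hb'] at h2
      rw [this, tentPrim_of_le_neg (x := f a) hε (by linarith),
        tentPrim_of_le_neg (x := f b) hε (by linarith)]; simp
    · obtain ⟨t, ht, h0⟩ := intermediate_value_Icc hab.le cf.continuousOn ⟨ha'.le, hb'.le⟩
      have h3 : 0 < (zeroSet f a b).ncard := (Set.ncard_pos hsub.finite).2 ⟨t, ht, h0⟩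
      have h4 : (zeroSet f a b).ncard = 1 := by omega
      rw [h4]
      rw [abs_of_neg ha'] at h1
      rw [abs_of_pos hb'] at h2
      rw [tentPrim_of_le_neg (x := f a) hε (by linarith), tentPrim_of_le hε h2]; norm_num
  · have : zeroSet f a b = ∅ := by
      rw [Set.eq_empty_iff_forall_notMem]
      rintro t ⟨ht, h0⟩
      have := hmono.monotoneOn ⟨le_rfl, hab.le⟩ ht ht.1
      linarith
    rw [abs_of_pos ha'] at h1
    rw [abs_of_pos (ha'.trans hfab)] at h2
    rw [this, tentPrim_of_le hε h1, tentPrim_of_le hε h2]; simp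

/-- Deterministic Kac formula on an interval with finitely many critical points. -/
lemma kacProp_of_finite {f f' : ℝ → ℝ} (hf : ∀ t, HasDerivAt f (f' t) t) (hf' : Continuous f')
    (k : ℕ) : ∀ a b : ℝ, a < b → {t | t ∈ Set.Ioo a b ∧ f' t = 0}.Finite →
      {t | t ∈ Set.Ioo a b ∧ f' t = 0}.ncard = k → (∀ t ∈ Set.Icc a b, f t = 0 → f' t ≠ 0) →
      f a ≠ 0 → f b ≠ 0 → KacProp f f' a b (k + 1) := by
  have cf : Continuous f := continuous_iff_continuousAt.2 fun t => (hf t).continuousAt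
  induction k using Nat.strong_induction_on with
  | _ k ih =>
  intro a b hab hfin hk hreg ha hb
  rcases Nat.eq_zero_or_pos k with rfl | hkpos
  · have hne : ∀ t ∈ Set.Ioo a b, f' t ≠ 0 := fun t ht h0 => by
      have h := (Set.ncard_eq_zero hfin).1 hk
      exact Set.eq_empty_iff_forall_notMem.1 h t ⟨ht, h0⟩
    have hconn : IsPreconnected (f' '' Set.Ioo a b) := isPreconnected_Ioo.image f' hf'.continuousOn
    have hsign : (∀ t ∈ Set.Ioo a b, 0 < f' t) ∨ ∀ t ∈ Set.Ioo a b, f' t < 0 := by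
      by_contra! h
      obtain ⟨⟨s, hs, hs'⟩, t, ht, ht'⟩ := h
      obtain ⟨u, hu, hu0⟩ := hconn.Icc_subset (Set.mem_image_of_mem f' hs)
        (Set.mem_image_of_mem f' ht) ⟨hs', ht'⟩
      exact hne u hu hu0
    rcases hsign with h | h
    · exact kacProp_of_pos hf hf' hab h ha hb
    · exact KacProp.neg (kacProp_of_pos (fun t => (hf t).neg) hf'.neg hab
        (fun t ht => neg_pos.2 (h t ht)) (neg_ne_zero.2 ha) (neg_ne_zero.2 hb))
  · obtain ⟨c, hc, hc0⟩ : {t | t ∈ Set.Ioo a b ∧ f' t = 0}.Nonempty :=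
      (Set.ncard_pos hfin).1 (hk ▸ hkpos)
    have hfc : f c ≠ 0 := fun h => hreg c ⟨hc.1.le, hc.2.le⟩ h hc0
    set S₁ := {t | t ∈ Set.Ioo a c ∧ f' t = 0} with hS₁
    set S₂ := {t | t ∈ Set.Ioo c b ∧ f' t = 0} with hS₂
    have hdec : {t | t ∈ Set.Ioo a b ∧ f' t = 0} = insert c (S₁ ∪ S₂) := by
      ext t
      simp only [Set.mem_ofPred_eq, Set.mem_Ioo, Set.mem_insert_iff, Set.mem_union, hS₁, hS₂]
      constructor
      · rintro ⟨⟨h1, h2⟩, h3⟩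
        rcases lt_trichotomy t c with h | h | h
        · exact Or.inr (Or.inl ⟨⟨h1, h⟩, h3⟩)
        · exact Or.inl h
        · exact Or.inr (Or.inr ⟨⟨h, h2⟩, h3⟩)
      · rintro (rfl | ⟨⟨h1, h2⟩, h3⟩ | ⟨⟨h1, h2⟩, h3⟩)
        · exact ⟨hc, hc0⟩
        · exact ⟨⟨h1, h2.trans hc.2⟩, h3⟩
        · exact ⟨⟨hc.1.trans h1, h2⟩, h3⟩
    have hfu : (S₁ ∪ S₂).Finite := hfin.subset (by rw [hdec]; exact Set.subset_insert _ _)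
    have hf₁ : S₁.Finite := hfu.subset Set.subset_union_left
    have hf₂ : S₂.Finite := hfu.subset Set.subset_union_right
    have hcard : S₁.ncard + S₂.ncard + 1 = k := by
      rw [← hk, hdec, Set.ncard_insert_of_notMem _ hfu, Set.ncard_union_eq _ hf₁ hf₂]
      · rw [Set.disjoint_left]
        rintro t ⟨ht, -⟩ ⟨ht', -⟩
        exact lt_asymm ht.2 ht'.1
      · rintro (⟨h, -⟩ | ⟨h, -⟩)
        · exact lt_irrefl _ h.2
        · exact lt_irrefl _ h.1
    obtain ⟨p1, p2, p3, p4⟩ := ih S₁.ncard (by omega) a c hc.1 hf₁ rfl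
      (fun t ht => hreg t ⟨ht.1, ht.2.trans hc.2.le⟩) ha hfc
    obtain ⟨q1, q2, q3, q4⟩ := ih S₂.ncard (by omega) c b hc.2 hf₂ rfl
      (fun t ht => hreg t ⟨hc.1.le.trans ht.1, ht.2⟩) hfc hb
    have hncard := ncard_zeroSet_add hc.1.le hc.2.le hfc p2 q2
    refine ⟨fun ε hε => ?_, ?_, by omega, ?_⟩
    · rw [kacInt_add cf hf' ε a b c]
      have : ((k + 1 : ℕ) : ℝ) = ((S₁.ncard + 1 : ℕ) : ℝ) + ((S₂.ncard + 1 : ℕ) : ℝ) := by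
        rw [← hcard]; push_cast; ring
      rw [this]
      exact add_le_add (p1 ε hε) (q1 ε hε)
    · rw [zeroSet_union hc.1.le hc.2.le]; exact p2.union q2
    · rw [hncard, Nat.cast_add]
      simp_rw [kacInt_add cf hf' _ a b c]
      exact p4.add q4

section

/-- The standard Gaussian measure on the line. -/
abbrev stdG : Measure ℝ := gaussianReal 0 1

section GaussianLaw

variable {H : Type*} [NormedAddCommGroup H] [InnerProductSpace ℝ H] [FiniteDimensional ℝ H]
  [MeasurableSpace H] [BorelSpace H]
  {H' : Type*} [NormedAddCommGroup H'] [InnerProductSpace ℝ H'] [FiniteDimensional ℝ H']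
  [MeasurableSpace H'] [BorelSpace H']

lemma charFunDual_map_inner {ι : Type*} [Fintype ι] [DecidableEq ι] (v : ι → H) (l : StrongDual ℝ (ι → ℝ)) :
    charFunDual ((stdGaussian H).map (fun ω i => inner ℝ (v i) ω)) l
      = Complex.exp (-((∑ i, ∑ j, l (Pi.single i 1) * l (Pi.single j 1) * inner ℝ (v i) (v j) : ℝ)
        : ℂ) / 2) := by
  let T : H →L[ℝ] (ι → ℝ) := ContinuousLinearMap.pi fun i => innerSL ℝ (v i)
  have hT : (fun ω i => inner ℝ (v i) ω : H → ι → ℝ) = T := by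
    ext ω i; simp [T]
  rw [hT, charFunDual_map, charFunDual_stdGaussian]
  have e : l.comp T = innerSL ℝ (∑ i, l (Pi.single i 1) • v i) := by
    ext ω
    have : T ω = ∑ i, (inner ℝ (v i) ω) • (Pi.single i (1 : ℝ) : ι → ℝ) := by
      rw [← hT]
      ext j
      simp [Finset.sum_apply, Pi.single_apply]
    rw [ContinuousLinearMap.comp_apply, this, innerSL_apply_apply, sum_inner, map_sum]
    exact Finset.sum_congr rfl fun i _ => by
      rw [map_smul, inner_smul_left, smul_eq_mul, mul_comm]; rfl
  rw [e, innerSL_apply_norm, ← Complex.ofReal_pow, ← real_inner_self_eq_norm_sq]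
  congr 4
  simp only [sum_inner, inner_sum, inner_smul_left, inner_smul_right, Finset.mul_sum]
  exact Finset.sum_congr rfl fun i _ => Finset.sum_congr rfl fun j _ => by
    rw [real_inner_comm (v i) (v j), conj_trivial]; ring

lemma map_inner_eq_of_gram {ι : Type*} [Fintype ι] (v : ι → H) (w : ι → H')
    (h : ∀ i j, inner ℝ (v i) (v j) = (inner ℝ (w i) (w j) : ℝ)) :
    (stdGaussian H).map (fun ω i => inner ℝ (v i) ω)
      = (stdGaussian H').map (fun ω i => (inner ℝ (w i) ω : ℝ)) := by
  classical
  have : IsProbabilityMeasure ((stdGaussian H).map (fun ω i => (inner ℝ (v i) ω : ℝ))) :=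
    Measure.isProbabilityMeasure_map (by fun_prop)
  have : IsProbabilityMeasure ((stdGaussian H').map (fun ω i => (inner ℝ (w i) ω : ℝ))) :=
    Measure.isProbabilityMeasure_map (by fun_prop)
  apply Measure.ext_of_charFunDual
  ext l
  simp only [charFunDual_map_inner, h]

lemma map_inner_eq_map_pi {ι κ : Type*} [Fintype ι] [Fintype κ] (v : ι → H) (M : ι → κ → ℝ)
    (h : ∀ i j, inner ℝ (v i) (v j) = ∑ k, M i k * M j k) :
    (stdGaussian H).map (fun ω i => inner ℝ (v i) ω)
      = (Measure.pi fun _ : κ => stdG).map (fun x i => ∑ k, M i k * x k) := by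
  rw [map_inner_eq_of_gram v (fun i => (WithLp.toLp 2 (M i) : EuclideanSpace ℝ κ)) fun i j => by
    rw [h]; simp [PiLp.inner_apply, mul_comm], ← map_pi_eq_stdGaussian, Measure.map_map]
  · congr 1
    ext x i
    simp [PiLp.inner_apply, mul_comm]
  · fun_prop
  · fun_prop

/-- Two orthogonal vectors give independent Gaussian variables. -/
lemma map_inner_pair (u v : H) (huv : inner ℝ u v = (0 : ℝ)) :
    (stdGaussian H).map (fun ω => ((inner ℝ u ω : ℝ), (inner ℝ v ω : ℝ)))
      = (stdG.prod stdG).map (fun p : ℝ × ℝ => (‖u‖ * p.1, ‖v‖ * p.2)) := by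
  have h := map_inner_eq_map_pi ![u, v] (fun i k : Fin 2 => if i = k then ![‖u‖, ‖v‖] i else 0)
    (fun i j => by
      fin_cases i <;> fin_cases j <;>
        simp [huv, real_inner_comm u v, pow_two])
  have h' := congrArg (Measure.map (fun x : Fin 2 → ℝ => (x 0, x 1))) h
  rw [Measure.map_map (by fun_prop) (by fun_prop), Measure.map_map (by fun_prop) (by fun_prop)] at h'
  have h2 := (measurePreserving_piFinTwo (fun _ : Fin 2 => stdG)).map_eq
  rw [← h2, Measure.map_map (by fun_prop) (by fun_prop)]
  have e : (fun p : ℝ × ℝ => (‖u‖ * p.1, ‖v‖ * p.2)) ∘ ⇑(MeasurableEquiv.piFinTwo fun _ => ℝ) =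
      (fun x => (x 0, x 1)) ∘
        fun x i => ∑ k : Fin 2, (if i = k then ![‖u‖, ‖v‖] i else 0) * x k := by
    funext x
    simp
  rw [e, ← h']
  rfl

end GaussianLaw

end

section GaussianLaw

variable {H : Type*} [NormedAddCommGroup H] [InnerProductSpace ℝ H] [FiniteDimensional ℝ H]
  [MeasurableSpace H] [BorelSpace H]

/-- The linear map sending independent Gaussian variables to a value, a second value and the
two derivatives, in Cholesky form. -/
def cholesky (a b c p σ D q : ℝ) (x : (ℝ × ℝ) × (ℝ × ℝ)) : (ℝ × ℝ) × (ℝ × ℝ) :=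
  ((x.1.1, a * x.1.1 + p * x.1.2),
    (c / p * x.1.2 + σ * x.2.1, b * x.1.1 - a * b / p * x.1.2 + D * x.2.1 + q * x.2.2))

lemma continuous_cholesky (a b c p σ D q : ℝ) : Continuous (cholesky a b c p σ D q) := by
  unfold cholesky; fun_prop

lemma map_inner_quad (f₁ f₂ g₁ g₂ : H) {a b c d p σ D q : ℝ} (hf₁ : ‖f₁‖ = 1) (hf₂ : ‖f₂‖ = 1)
    (hg₁ : ‖g₁‖ = 1) (hg₂ : ‖g₂‖ = 1) (h₁ : inner ℝ f₁ g₁ = (0 : ℝ)) (h₂ : inner ℝ f₂ g₂ = (0 : ℝ))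
    (ha : inner ℝ f₁ f₂ = a) (hb : inner ℝ f₁ g₂ = b) (hc : inner ℝ g₁ f₂ = c)
    (hd : inner ℝ g₁ g₂ = d) (hp0 : p ≠ 0) (hp : p ^ 2 = 1 - a ^ 2)
    (hσ : σ ^ 2 = 1 - c ^ 2 / p ^ 2) (hD : σ * D = d + a * b * c / p ^ 2)
    (hq : q ^ 2 = 1 - b ^ 2 / p ^ 2 - D ^ 2) :
    (stdGaussian H).map (fun ω => (((inner ℝ f₁ ω : ℝ), (inner ℝ f₂ ω : ℝ)),
      ((inner ℝ g₁ ω : ℝ), (inner ℝ g₂ ω : ℝ))))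
      = ((stdG.prod stdG).prod (stdG.prod stdG)).map (cholesky a b c p σ D q) := by
  let M : Fin 4 → Fin 2 ⊕ Fin 2 → ℝ := ![Sum.elim ![1, 0] ![0, 0], Sum.elim ![a, p] ![0, 0],
    Sum.elim ![0, c / p] ![σ, 0], Sum.elim ![b, -(a * b / p)] ![D, q]]
  have hM : ∀ i j, inner ℝ (![f₁, f₂, g₁, g₂] i) (![f₁, f₂, g₁, g₂] j)
      = ∑ k, M i k * M j k := by
    have h₁' := (real_inner_comm f₁ g₁).trans h₁
    have h₂' := (real_inner_comm f₂ g₂).trans h₂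
    have ha' := (real_inner_comm f₁ f₂).trans ha
    have hb' := (real_inner_comm f₁ g₂).trans hb
    have hc' := (real_inner_comm g₁ f₂).trans hc
    have hd' := (real_inner_comm g₁ g₂).trans hd
    have k1 : a * a + p * p = 1 := by linarith
    have k2 : c / p * (c / p) + σ * σ = 1 := by
      have : c / p * (c / p) = c ^ 2 / p ^ 2 := by field_simp
      linarith
    have k3 : a * b - p * (a * b / p) = 0 := by field_simp; ring
    have k4 : p * (c / p) = c := by field_simp
    have k5 : -(c / p * (a * b / p)) + σ * D = d := by rw [hD]; field_simp; ring
    have k6 : b * b + a * b / p * (a * b / p) + (D * D + q * q) = 1 := by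
      have : b * b + a * b / p * (a * b / p) = b ^ 2 / p ^ 2 := by
        field_simp; rw [hp]; ring
      rw [this]; linarith
    intro i j
    fin_cases i <;> fin_cases j <;>
      simp [M, hf₁, hf₂, hg₁, hg₂, h₁, h₂, ha, hb, hc, hd, h₁', h₂', ha', hb', hc', hd'] <;>
      linarith
  have h := map_inner_eq_map_pi ![f₁, f₂, g₁, g₂] M hM
  have h' := congrArg (Measure.map (fun x : Fin 4 → ℝ => ((x 0, x 1), (x 2, x 3)))) h
  rw [Measure.map_map (by fun_prop) (by fun_prop), Measure.map_map (by fun_prop) (by fun_prop)] at h'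
  have h2 := (measurePreserving_piFinTwo (fun _ : Fin 2 => stdG)).map_eq
  have h3 := (measurePreserving_sumPiEquivProdPi (fun _ : Fin 2 ⊕ Fin 2 => stdG)).map_eq
  have h4 : ((stdG.prod stdG).prod (stdG.prod stdG)) = (Measure.pi fun _ : Fin 2 ⊕ Fin 2 => stdG).map
      (fun x : Fin 2 ⊕ Fin 2 → ℝ => ((x (Sum.inl 0), x (Sum.inl 1)), (x (Sum.inr 0), x (Sum.inr 1)))) := by
    rw [← h2, Measure.map_prod_map _ _ (by fun_prop) (by fun_prop), ← h3,
      Measure.map_map (by fun_prop) (by fun_prop)]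
    rfl
  have hcm : Measurable (cholesky a b c p σ D q) := (continuous_cholesky a b c p σ D q).measurable
  rw [h4, Measure.map_map hcm (by fun_prop)]
  have e : cholesky a b c p σ D q ∘
      (fun x : Fin 2 ⊕ Fin 2 → ℝ => ((x (Sum.inl 0), x (Sum.inl 1)), (x (Sum.inr 0), x (Sum.inr 1)))) =
      (fun x : Fin 4 → ℝ => ((x 0, x 1), (x 2, x 3))) ∘
        fun x i => ∑ k : Fin 2 ⊕ Fin 2, M i k * x k := by
    funext x
    simp [cholesky, M]
    ring
  rw [e, ← h']
  rfl

end GaussianLaw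

/-- The standard Gaussian density. -/
def gDens (x : ℝ) : ℝ := (√(2 * π))⁻¹ * exp (-x ^ 2 / 2)

/-- The value `1 / √(2π)` of the standard Gaussian density at the origin. -/
def gZero : ℝ := (√(2 * π))⁻¹

lemma gZero_pos : 0 < gZero := by unfold gZero; positivity

lemma gZero_sq : gZero ^ 2 = 1 / (2 * π) := by
  unfold gZero
  rw [inv_pow, Real.sq_sqrt (by positivity), one_div]

lemma gZero_le : gZero ≤ 1 / 2 := by
  have h := gZero_sq
  have h2 : 1 / (2 * π) ≤ 1 / 4 := by
    apply one_div_le_one_div_of_le (by norm_num); linarith [Real.two_le_pi]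
  nlinarith [gZero_pos]

lemma gaussianPDFReal_eq_gDens : gaussianPDFReal 0 1 = gDens := by
  ext x; simp [gaussianPDFReal, gDens]

lemma gDens_le (x : ℝ) : gDens x ≤ gZero := by
  unfold gDens gZero
  have : exp (-x ^ 2 / 2) ≤ 1 := Real.exp_le_one_iff.2 (by nlinarith [sq_nonneg x])
  exact mul_le_of_le_one_right (by positivity) this

lemma gDens_nonneg (x : ℝ) : 0 ≤ gDens x := by unfold gDens; positivity

lemma le_gDens (x : ℝ) : gZero * (1 - x ^ 2 / 2) ≤ gDens x := by
  unfold gDens gZero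
  have := Real.one_sub_le_exp_neg (x ^ 2 / 2)
  rw [neg_div]
  exact mul_le_mul_of_nonneg_left this (by positivity)

lemma continuous_gDens : Continuous gDens := by unfold gDens; fun_prop

lemma integral_stdG (f : ℝ → ℝ) : ∫ x, f x ∂stdG = ∫ x, gDens x * f x := by
  rw [integral_gaussianReal_eq_integral_smul one_ne_zero, gaussianPDFReal_eq_gDens]
  rfl

lemma integrable_abs_pow_stdG (n : ℕ) : Integrable (fun x => |x| ^ n) stdG := by
  have := (IsGaussian.memLp_id stdG (n : ENNReal) (by simp)).integrable_norm_pow'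
  simpa using this

lemma integrable_pow_stdG (n : ℕ) : Integrable (fun x => x ^ n) stdG := by
  refine (integrable_abs_pow_stdG n).mono' (by fun_prop) (Filter.Eventually.of_forall fun x => ?_)
  simp

lemma integrable_abs_stdG : Integrable (fun x => |x|) stdG := by
  simpa using integrable_abs_pow_stdG 1

lemma integral_gauss_half (n : ℕ) :
    ∫ x in Set.Ioi (0 : ℝ), x ^ (2 * n + 1) * exp (-x ^ 2 / 2) = 2 ^ n * n.factorial := by
  have h := integral_rpow_mul_exp_neg_mul_rpow (p := 2) (q := 2 * n + 1) (b := 1 / 2) (by norm_num)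
    (by have : (0 : ℝ) ≤ n := n.cast_nonneg
        linarith) (by norm_num)
  have e1 : ((2 * n + 1 : ℝ) + 1) / 2 = n + 1 := by ring
  have e2 : -((2 * n + 1 : ℝ) + 1) / 2 = -((n + 1 : ℕ) : ℝ) := by push_cast; ring
  rw [e1, e2, Real.Gamma_nat_eq_factorial, Real.rpow_neg (by norm_num), Real.rpow_natCast] at h
  have e3 : ((1 / 2 : ℝ) ^ (n + 1))⁻¹ * (1 / 2) = 2 ^ n := by
    rw [one_div, inv_pow, inv_inv, pow_succ]; ring
  rw [e3] at h
  rw [← h]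
  refine setIntegral_congr_fun measurableSet_Ioi fun x hx => ?_
  have h1 : x ^ (2 * (n : ℝ) + 1) = x ^ (2 * n + 1) := by
    rw [← Real.rpow_natCast]; push_cast; rfl
  simp only [h1, Real.rpow_two]
  congr 2; ring

lemma integral_abs_pow_stdG (n : ℕ) :
    ∫ x, |x| ^ (2 * n + 1) ∂stdG = 2 * gZero * (2 ^ n * n.factorial) := by
  rw [integral_stdG]
  have : ∀ x : ℝ, gDens x * |x| ^ (2 * n + 1)
      = (fun y => gZero * (y ^ (2 * n + 1) * exp (-y ^ 2 / 2))) |x| := fun x => by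
    simp only [gDens, gZero, sq_abs]; ring
  rw [integral_congr_ae (ae_of_all _ this),
    integral_comp_abs (f := fun y => gZero * (y ^ (2 * n + 1) * exp (-y ^ 2 / 2))),
    integral_const_mul, integral_gauss_half]; ring

lemma integral_abs_stdG : ∫ x, |x| ∂stdG = 2 * gZero := by
  simpa using integral_abs_pow_stdG 0

lemma integral_abs_cube_stdG : ∫ x, |x| ^ 3 ∂stdG = 4 * gZero := by
  have := integral_abs_pow_stdG 1
  norm_num at this
  rw [this]; ring

lemma stdG_real_abs_le {r : ℝ} (hr : 0 ≤ r) : stdG {x | |x| ≤ r} ≤ ENNReal.ofReal r := by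
  rw [gaussianReal_apply_eq_integral _ one_ne_zero, gaussianPDFReal_eq_gDens]
  apply ENNReal.ofReal_le_ofReal
  have hs : {x : ℝ | |x| ≤ r} = Set.Icc (-r) r := by ext x; simp [abs_le]
  rw [hs]
  calc ∫ x in Set.Icc (-r) r, gDens x ≤ ∫ x in Set.Icc (-r) r, (1 / 2 : ℝ) := by
        refine setIntegral_mono (continuous_gDens.integrableOn_Icc) (by simp) fun x => ?_
        exact (gDens_le x).trans gZero_le
    _ = r := by
        rw [setIntegral_const, Measure.real, Real.volume_Icc, ENNReal.toReal_ofReal (by linarith)]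
        simp; ring

lemma tent_abs (ε x : ℝ) : tent ε |x| = tent ε x := by simp [tent]

lemma integrable_tent {ε : ℝ} (hε : 0 < ε) : Integrable (tent ε) := by
  refine (continuous_tent ε).integrable_of_hasCompactSupport ?_
  refine HasCompactSupport.intro (isCompact_Icc (a := -ε) (b := ε)) fun x hx => ?_
  refine tent_eq_zero hε ?_
  by_contra! h
  exact hx (abs_le.1 h.le)

lemma integral_tent {ε : ℝ} (hε : 0 < ε) : ∫ x, tent ε x = 1 := by
  have h := integral_comp_abs (f := tent ε)
  simp_rw [tent_abs] at h
  have h2 : ∫ x in Set.Ioi (0 : ℝ), tent ε x = ∫ x in Set.Ioc (0 : ℝ) ε, tent ε x := by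
    refine (setIntegral_eq_of_subset_of_forall_sdiff_eq_zero measurableSet_Ioi
      Set.Ioc_subset_Ioi_self fun x hx => ?_)
    refine tent_eq_zero hε ?_
    have : ε < x := by
      by_contra! h
      exact hx.2 ⟨hx.1, h⟩
    exact this.le.trans (le_abs_self x)
  rw [h, h2, ← intervalIntegral.integral_of_le hε.le, integral_tent_half hε]; norm_num

lemma integral_tent_stdG_le {ε : ℝ} (hε : 0 < ε) : ∫ x, tent ε x ∂stdG ≤ gZero := by
  rw [integral_stdG]
  calc ∫ x, gDens x * tent ε x ≤ ∫ x, gZero * tent ε x := by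
        refine integral_mono_of_nonneg (Filter.Eventually.of_forall fun x =>
          mul_nonneg (gDens_nonneg x) (tent_nonneg hε x)) ((integrable_tent hε).const_mul _)
          (Filter.Eventually.of_forall fun x =>
            mul_le_mul_of_nonneg_right (gDens_le x) (tent_nonneg hε x))
    _ = gZero := by rw [integral_const_mul, integral_tent hε, mul_one]

lemma integrable_tent_stdG {ε : ℝ} (hε : 0 < ε) : Integrable (tent ε) stdG := by
  refine Integrable.of_bound (C := ε⁻¹) (continuous_tent ε).aestronglyMeasurable
    (Filter.Eventually.of_forall fun x => ?_)
  rw [Real.norm_of_nonneg (tent_nonneg hε x)]; exact tent_le hε x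

lemma le_integral_tent_stdG {ε : ℝ} (hε : 0 < ε) :
    gZero * (1 - ε ^ 2 / 2) ≤ ∫ x, tent ε x ∂stdG := by
  rw [integral_stdG]
  calc gZero * (1 - ε ^ 2 / 2) = ∫ x, (gZero * (1 - ε ^ 2 / 2)) * tent ε x := by
        rw [integral_const_mul, integral_tent hε, mul_one]
    _ ≤ ∫ x, gDens x * tent ε x := by
        refine integral_mono ((integrable_tent hε).const_mul _) ?_ fun x => ?_
        · refine ((integrable_tent hε).const_mul gZero).mono'
            (continuous_gDens.mul (continuous_tent ε)).aestronglyMeasurable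
            (Filter.Eventually.of_forall fun x => ?_)
          rw [Real.norm_of_nonneg (mul_nonneg (gDens_nonneg x) (tent_nonneg hε x))]
          exact mul_le_mul_of_nonneg_right (gDens_le x) (tent_nonneg hε x)
        · rcases le_or_gt ε |x| with h | h
          · simp [tent_eq_zero hε h]
          · refine mul_le_mul_of_nonneg_right (le_trans ?_ (le_gDens x)) (tent_nonneg hε x)
            have : x ^ 2 ≤ ε ^ 2 := sq_le_sq' (by linarith [(abs_lt.1 h).1]) (abs_lt.1 h).2.le
            exact mul_le_mul_of_nonneg_left (by linarith) gZero_pos.le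

lemma integrable_abs_add_stdG (t : ℝ) : Integrable (fun y => |t + y|) stdG := by
  refine ((integrable_const |t|).add integrable_abs_stdG).mono' (by fun_prop)
    (Filter.Eventually.of_forall fun y => ?_)
  simpa using abs_add_le t y

lemma integral_abs_add_stdG {t : ℝ} (ht : t ≠ 0) :
    ∫ y, |t + y| ∂stdG = 2 * gZero + t ^ 2 * ∫ y, tent |t| y ∂stdG := by
  have hneg : ∫ y, |t + y| ∂stdG = ∫ y, |t - y| ∂stdG := by
    have h : stdG.map (fun x => -x) = stdG := by
      have := gaussianReal_map_neg (μ := 0) (v := 1)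
      rwa [neg_zero] at this
    conv_lhs => rw [← h]
    rw [integral_map (by fun_prop) (by fun_prop)]
    simp [sub_eq_add_neg]
  have hint := integrable_abs_add_stdG t
  have hint' : Integrable (fun y => |t - y|) stdG := by
    refine ((integrable_const |t|).add integrable_abs_stdG).mono' (by fun_prop)
      (Filter.Eventually.of_forall fun y => ?_)
    simpa using abs_sub t y
  have hpt : ∀ y, |t + y| + |t - y| = 2 * (|y| + t ^ 2 * tent |t| y) := fun y => by
    have h1 : t ^ 2 * tent |t| y = max 0 (|t| - |y|) := by
      unfold tent
      have h0 : 0 < |t| := abs_pos.2 ht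
      rw [← sq_abs t, ← mul_assoc, mul_max_of_nonneg _ _ (by positivity), mul_zero]
      congr 1; field_simp
    rw [h1]
    rcases abs_cases t with ⟨e1, h1⟩ | ⟨e1, h1⟩ <;> rcases abs_cases y with ⟨e2, h2⟩ | ⟨e2, h2⟩ <;>
    rcases abs_cases (t + y) with ⟨e3, h3⟩ | ⟨e3, h3⟩ <;>
    rcases abs_cases (t - y) with ⟨e4, h4⟩ | ⟨e4, h4⟩ <;>
    rw [e1, e2, e3, e4] <;>
    rcases max_cases 0 (|t| - |y|) with ⟨e5, h5⟩ | ⟨e5, h5⟩ <;> rw [e1, e2] at e5 h5 <;> rw [e5] <;>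
    linarith
  have hsum := integral_add hint hint'
  simp_rw [hpt] at hsum
  rw [integral_const_mul, integral_add integrable_abs_stdG
    ((integrable_tent_stdG (abs_pos.2 ht)).const_mul _), integral_const_mul, integral_abs_stdG,
    ← hneg] at hsum
  linarith

lemma abs_integral_abs_add_stdG_sub_le (t : ℝ) :
    |∫ y, |t + y| ∂stdG - 2 * gZero * (1 + t ^ 2 / 2)| ≤ gZero * t ^ 4 := by
  rcases eq_or_ne t 0 with rfl | ht
  · simp [integral_abs_stdG]
  · rw [integral_abs_add_stdG ht]
    have h1 := integral_tent_stdG_le (abs_pos.2 ht)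
    have h2 := le_integral_tent_stdG (abs_pos.2 ht)
    rw [sq_abs] at h2
    have h3 : 0 ≤ t ^ 2 := sq_nonneg t
    have h4 : 0 ≤ gZero * t ^ 4 := mul_nonneg gZero_pos.le (by positivity)
    rw [abs_le]
    constructor <;> nlinarith

lemma abs_sub_one_add_half_le {s t : ℝ} (hs : 0 < s) (h : s ^ 2 = 1 - t) :
    |s - (1 + -(t / 2))| ≤ t ^ 2 := by
  have e : s - (1 + -(t / 2)) = -(t ^ 2 * (1 / (2 * (1 + s) ^ 2))) := by
    have ht : t = 1 - s ^ 2 := by linarith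
    rw [ht]; field_simp; ring
  rw [e, abs_neg, abs_of_nonneg (by positivity)]
  have : 1 / (2 * (1 + s) ^ 2) ≤ 1 := by
    rw [div_le_one (by positivity)]; nlinarith
  exact mul_le_of_le_one_right (sq_nonneg t) this

lemma abs_inv_sub_one_add_half_le {s t : ℝ} (hs : 1 / 2 ≤ s) (h : s ^ 2 = 1 - t) :
    |s⁻¹ - (1 + t / 2)| ≤ 2 * t ^ 2 := by
  have hs0 : 0 < s := by linarith
  have e : s⁻¹ - (1 + t / 2) = t ^ 2 * ((2 + s) / (2 * s * (1 + s) ^ 2)) := by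
    have ht : t = 1 - s ^ 2 := by linarith
    rw [ht]; field_simp; ring
  rw [e, abs_of_nonneg (by positivity), mul_comm]
  have : (2 + s) / (2 * s * (1 + s) ^ 2) ≤ 2 := by
    rw [div_le_iff₀ (by positivity)]; nlinarith [sq_nonneg s]
  exact mul_le_mul_of_nonneg_right this (sq_nonneg t)

lemma abs_mul_sub_one_add_le {x y l m K K' M M' S : ℝ} (hS : 0 ≤ S) (hS1 : S ≤ 1)
    (hx : |x - (1 + l)| ≤ K * S ^ 2) (hy : |y - (1 + m)| ≤ K' * S ^ 2) (hl : |l| ≤ M * S)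
    (hm : |m| ≤ M' * S) (hK : 0 ≤ K) (hK' : 0 ≤ K') (hM : 0 ≤ M) (hM' : 0 ≤ M') :
    |x * y - (1 + (l + m))| ≤ (K + K' + M * M' + K * M' + K' * M + K * K') * S ^ 2 := by
  have e : x * y - (1 + (l + m)) = (x - (1 + l)) + (y - (1 + m)) + l * m + (x - (1 + l)) * m
      + (y - (1 + m)) * l + (x - (1 + l)) * (y - (1 + m)) := by ring
  have h1 : |l * m| ≤ (M * S) * (M' * S) := by
    rw [abs_mul]; exact mul_le_mul hl hm (abs_nonneg _) (by positivity)
  have h2 : |(x - (1 + l)) * m| ≤ (K * S ^ 2) * (M' * S) := by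
    rw [abs_mul]; exact mul_le_mul hx hm (abs_nonneg _) (by positivity)
  have h3 : |(y - (1 + m)) * l| ≤ (K' * S ^ 2) * (M * S) := by
    rw [abs_mul]; exact mul_le_mul hy hl (abs_nonneg _) (by positivity)
  have h4 : |(x - (1 + l)) * (y - (1 + m))| ≤ (K * S ^ 2) * (K' * S ^ 2) := by
    rw [abs_mul]; exact mul_le_mul hx hy (abs_nonneg _) (by positivity)
  have h5 : (K * S ^ 2) * (M' * S) ≤ K * M' * S ^ 2 := by
    have : K * M' * S ^ 2 * S ≤ K * M' * S ^ 2 := mul_le_of_le_one_right (by positivity) hS1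
    linarith
  have h6 : (K' * S ^ 2) * (M * S) ≤ K' * M * S ^ 2 := by
    have : K' * M * S ^ 2 * S ≤ K' * M * S ^ 2 := mul_le_of_le_one_right (by positivity) hS1
    linarith
  have h7 : (K * S ^ 2) * (K' * S ^ 2) ≤ K * K' * S ^ 2 := by
    have : K * K' * S ^ 2 * S ^ 2 ≤ K * K' * S ^ 2 :=
      mul_le_of_le_one_right (by positivity) (by nlinarith)
    linarith
  rw [e]
  refine (abs_add_le _ _).trans ?_
  refine (add_le_add ((abs_add_le _ _).trans (add_le_add ((abs_add_le _ _).trans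
    (add_le_add ((abs_add_le _ _).trans (add_le_add ((abs_add_le _ _).trans
    (add_le_add hx hy)) h1)) h2)) h3)) h4).trans ?_
  linarith

/-- Admissible coefficients for the Cholesky form of the covariance. -/
structure CholeskyData (a b c d p σ D q : ℝ) : Prop where
  ha : |a| ≤ 1 / 4
  hb : |b| ≤ 1 / 4
  hc : |c| ≤ 1 / 4
  hd : |d| ≤ 1 / 4
  p_pos : 0 < p
  σ_pos : 0 < σ
  q_pos : 0 < q
  hp : p ^ 2 = 1 - a ^ 2
  hσ : σ ^ 2 = 1 - c ^ 2 / p ^ 2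
  hD : σ * D = d + a * b * c / p ^ 2
  hq : q ^ 2 = 1 - b ^ 2 / p ^ 2 - D ^ 2

lemma sq_le_sixteenth {a : ℝ} (h : |a| ≤ 1 / 4) : a ^ 2 ≤ 1 / 16 := by
  rw [← sq_abs]; nlinarith [abs_nonneg a]

lemma cholesky_bounds {a b c d p σ D : ℝ} (ha : |a| ≤ 1 / 4) (hb : |b| ≤ 1 / 4)
    (hc : |c| ≤ 1 / 4) (hd : |d| ≤ 1 / 4) (p_pos : 0 < p) (σ_pos : 0 < σ)
    (hp : p ^ 2 = 1 - a ^ 2) (hσ : σ ^ 2 = 1 - c ^ 2 / p ^ 2)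
    (hD : σ * D = d + a * b * c / p ^ 2) :
    9 / 10 ≤ p ∧ p ≤ 1 ∧ 9 / 10 ≤ σ ∧ σ ≤ 1 ∧ |D| ≤ 1 / 3 ∧ b ^ 2 / p ^ 2 ≤ 1 / 15 := by
  have ha2 := sq_le_sixteenth ha
  have hb2 := sq_le_sixteenth hb
  have hc2 := sq_le_sixteenth hc
  have h1 : 9 / 10 ≤ p := by nlinarith
  have h2 : p ≤ 1 := by nlinarith [sq_nonneg a]
  have hpp : 0 < p ^ 2 := by positivity
  have h3 : c ^ 2 / p ^ 2 ≤ 1 / 15 := by rw [div_le_iff₀ hpp]; nlinarith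
  have h3' : 0 ≤ c ^ 2 / p ^ 2 := by positivity
  have h4 : 9 / 10 ≤ σ := by nlinarith
  have h5 : σ ≤ 1 := by nlinarith
  have h6 : b ^ 2 / p ^ 2 ≤ 1 / 15 := by rw [div_le_iff₀ hpp]; nlinarith
  refine ⟨h1, h2, h4, h5, ?_, h6⟩
  have h7 : |σ * D| ≤ 1 / 4 + 1 / 50 := by
    rw [hD]
    refine (abs_add_le _ _).trans (add_le_add hd ?_)
    rw [abs_div, abs_mul, abs_mul, abs_of_pos hpp, div_le_iff₀ hpp]
    have h8 : |a| * |b| ≤ 1 / 4 * (1 / 4) := mul_le_mul ha hb (abs_nonneg _) (by norm_num)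
    have h9 : |a| * |b| * |c| ≤ 1 / 4 * (1 / 4) * (1 / 4) :=
      mul_le_mul h8 hc (abs_nonneg _) (by norm_num)
    nlinarith
  rw [abs_mul, abs_of_pos σ_pos] at h7
  nlinarith [abs_nonneg D]

lemma exists_choleskyData {a b c d : ℝ} (ha : |a| ≤ 1 / 4) (hb : |b| ≤ 1 / 4)
    (hc : |c| ≤ 1 / 4) (hd : |d| ≤ 1 / 4) : ∃ p σ D q, CholeskyData a b c d p σ D q := by
  have ha2 := sq_le_sixteenth ha
  have hc2 := sq_le_sixteenth hc
  have hp1 : 0 < 1 - a ^ 2 := by linarith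
  set p := √(1 - a ^ 2) with hpdef
  have p_pos : 0 < p := Real.sqrt_pos.2 hp1
  have hp : p ^ 2 = 1 - a ^ 2 := Real.sq_sqrt hp1.le
  have hpp : 0 < p ^ 2 := by positivity
  have h3 : c ^ 2 / p ^ 2 ≤ 1 / 15 := by rw [div_le_iff₀ hpp]; nlinarith
  have hσ1 : 0 < 1 - c ^ 2 / p ^ 2 := by linarith
  set σ := √(1 - c ^ 2 / p ^ 2) with hσdef
  have σ_pos : 0 < σ := Real.sqrt_pos.2 hσ1
  have hσ : σ ^ 2 = 1 - c ^ 2 / p ^ 2 := Real.sq_sqrt hσ1.le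
  have hD : σ * ((d + a * b * c / p ^ 2) / σ) = d + a * b * c / p ^ 2 := by field_simp
  obtain ⟨h1, h2, h4, h5, h6, h7⟩ := cholesky_bounds ha hb hc hd p_pos σ_pos hp hσ hD
  set D := (d + a * b * c / p ^ 2) / σ
  have hq1 : 0 < 1 - b ^ 2 / p ^ 2 - D ^ 2 := by
    rw [← sq_abs D]; nlinarith [abs_nonneg D]
  exact ⟨p, σ, D, √(1 - b ^ 2 / p ^ 2 - D ^ 2), ha, hb, hc, hd, p_pos, σ_pos,
    Real.sqrt_pos.2 hq1, hp, hσ, hD, Real.sq_sqrt hq1.le⟩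

lemma CholeskyData.bounds {a b c d p σ D q : ℝ} (h : CholeskyData a b c d p σ D q) :
    9 / 10 ≤ p ∧ p ≤ 1 ∧ 9 / 10 ≤ σ ∧ σ ≤ 1 ∧ |D| ≤ 1 / 3 ∧ b ^ 2 / p ^ 2 ≤ 1 / 15 :=
  cholesky_bounds h.ha h.hb h.hc h.hd h.p_pos h.σ_pos h.hp h.hσ h.hD

lemma CholeskyData.q_bounds {a b c d p σ D q : ℝ} (h : CholeskyData a b c d p σ D q) :
    9 / 10 ≤ q ∧ q ≤ 1 := by
  obtain ⟨h1, h2, h4, h5, h6, h7⟩ := h.bounds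
  have hq := h.hq
  have hq0 := h.q_pos
  have h8 : D ^ 2 ≤ 1 / 9 := by rw [← sq_abs]; nlinarith [abs_nonneg D]
  have h9 : 0 ≤ b ^ 2 / p ^ 2 := by positivity
  constructor <;> nlinarith [sq_nonneg D]

lemma mul_le_half_sq {u v S : ℝ} (hu : 0 ≤ u) (hv : 0 ≤ v) (h : u + v ≤ S) :
    u * v ≤ S ^ 2 / 2 := by
  have : (u + v) ^ 2 ≤ S ^ 2 := pow_le_pow_left₀ (by positivity) h 2
  nlinarith [sq_nonneg u, sq_nonneg v]

lemma CholeskyData.D_sq {a b c d p σ D q : ℝ} (h : CholeskyData a b c d p σ D q) :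
    D ^ 2 ≤ 5 * (a ^ 2 + b ^ 2 + c ^ 2 + d ^ 2) ∧
      |D ^ 2 - d ^ 2| ≤ 9 * (a ^ 2 + b ^ 2 + c ^ 2 + d ^ 2) ^ 2 := by
  obtain ⟨h1, h2, h4, h5, -, -⟩ := h.bounds
  have ha2 := sq_le_sixteenth h.ha
  have hb2 := sq_le_sixteenth h.hb
  have hc2 := sq_le_sixteenth h.hc
  have hd2 := sq_le_sixteenth h.hd
  have hpp : 0 < p ^ 2 := by have := h.p_pos; positivity
  have hp8 : 4 / 5 ≤ p ^ 2 := by nlinarith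
  set u := a ^ 2 with hu
  set v := b ^ 2 with hv
  set w := c ^ 2 with hw
  set z := d ^ 2 with hz
  have u0 : 0 ≤ u := sq_nonneg a
  have v0 : 0 ≤ v := sq_nonneg b
  have w0 : 0 ≤ w := sq_nonneg c
  have z0 : 0 ≤ z := sq_nonneg d
  set S := u + v + w + z with hS
  set e := a * b * c / p ^ 2 with he
  have hinv : (p ^ 2)⁻¹ ≤ 5 / 4 := by
    rw [inv_le_comm₀ hpp (by norm_num)]; linarith
  have hinv0 : 0 ≤ (p ^ 2)⁻¹ := by positivity
  have he2 : e ^ 2 ≤ 2 * (u * (v * w)) := by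
    have : e ^ 2 = u * (v * w) * ((p ^ 2)⁻¹ * (p ^ 2)⁻¹) := by
      rw [he, hu, hv, hw]; field_simp
    rw [this, mul_comm 2]
    exact mul_le_mul_of_nonneg_left (by nlinarith) (by positivity)
  have hσ2 : 4 / 5 ≤ σ ^ 2 := by nlinarith
  have hD : σ * D = d + e := h.hD
  have hsq : σ ^ 2 * D ^ 2 = z + 2 * (d * e) + e ^ 2 := by
    rw [← mul_pow, hD]; ring
  have hvw : v * w ≤ 1 / 256 := by nlinarith
  have huS' : u * (v * w) ≤ S / 256 := by nlinarith
  have hDS : D ^ 2 ≤ 5 * S := by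
    have : 2 * (d * e) ≤ z + e ^ 2 := by nlinarith [sq_nonneg (d - e)]
    nlinarith
  refine ⟨hDS, ?_⟩
  have hde : |d * e| ≤ S ^ 2 := by
    apply abs_le_of_sq_le_sq _ (by positivity)
    rw [mul_pow]
    have h10 : z * (2 * (u * (v * w))) ≤ (S ^ 2) ^ 2 := by
      have k1 : u * v ≤ S ^ 2 / 2 := mul_le_half_sq u0 v0 (by linarith)
      have k2 : w * z ≤ S ^ 2 / 2 := mul_le_half_sq w0 z0 (by linarith)
      have k3 := mul_le_mul k1 k2 (by positivity) (by positivity)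
      have k4 : 0 ≤ (S ^ 2) ^ 2 := by positivity
      linarith
    exact (mul_le_mul_of_nonneg_left he2 z0).trans h10
  have hw' : w / p ^ 2 ≤ 5 / 4 * S := by
    rw [div_eq_mul_inv]; nlinarith
  have hw'' : 0 ≤ w / p ^ 2 := by positivity
  have hexp : D ^ 2 - z = D ^ 2 * (w / p ^ 2) + 2 * (d * e) + e ^ 2 := by
    have := h.hσ
    rw [this] at hsq; linarith
  have hDw : D ^ 2 * (w / p ^ 2) ≤ (5 * S) * (5 / 4 * S) :=
    mul_le_mul hDS hw' hw'' (by positivity)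
  have hDw0 : 0 ≤ D ^ 2 * (w / p ^ 2) := by positivity
  have he3 : e ^ 2 ≤ S ^ 2 / 2 := by
    have k1 : u * v ≤ S ^ 2 / 2 := mul_le_half_sq u0 v0 (by linarith)
    have k2 : u * v * w ≤ S ^ 2 / 2 * (1 / 16) := mul_le_mul k1 hc2 w0 (by positivity)
    have k3 : 0 ≤ S ^ 2 := sq_nonneg S
    linarith
  have hde' := abs_le.1 hde
  have k3 : 0 ≤ S ^ 2 := sq_nonneg S
  have k4 : 0 ≤ e ^ 2 := sq_nonneg e
  have k5 : (5 * S) * (5 / 4 * S) = 25 / 4 * S ^ 2 := by ring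
  rw [hexp, abs_le]
  constructor <;> linarith [hde'.1, hde'.2]

lemma CholeskyData.abs_main_sub_le {a b c d p σ D q : ℝ} (h : CholeskyData a b c d p σ D q) :
    |(σ * q + σ * D ^ 2 / q) / p - (1 + (a ^ 2 - b ^ 2 - c ^ 2 + d ^ 2) / 2)|
      ≤ 10000 * (a ^ 2 + b ^ 2 + c ^ 2 + d ^ 2) ^ 2 := by
  obtain ⟨h1, h2, h4, h5, -, -⟩ := h.bounds
  obtain ⟨hq1, hq2⟩ := h.q_bounds
  obtain ⟨hD1, hD2⟩ := h.D_sq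
  have ha2 := sq_le_sixteenth h.ha
  have hb2 := sq_le_sixteenth h.hb
  have hc2 := sq_le_sixteenth h.hc
  have hd2 := sq_le_sixteenth h.hd
  have p0 := h.p_pos
  have q0 := h.q_pos
  have s0 := h.σ_pos
  have hpp : 0 < p ^ 2 := by positivity
  have hp8 : 4 / 5 ≤ p ^ 2 := by nlinarith
  have u0 : 0 ≤ a ^ 2 := sq_nonneg a
  have v0 : 0 ≤ b ^ 2 := sq_nonneg b
  have w0 : 0 ≤ c ^ 2 := sq_nonneg c
  have z0 : 0 ≤ d ^ 2 := sq_nonneg d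
  set S := a ^ 2 + b ^ 2 + c ^ 2 + d ^ 2 with hS
  have hS0 : 0 ≤ S := by positivity
  have hS1 : S ≤ 1 := by linarith
  have hinv : (p ^ 2)⁻¹ ≤ 5 / 4 := by
    rw [inv_le_comm₀ hpp (by norm_num)]; linarith
  have hinv0 : 0 ≤ (p ^ 2)⁻¹ := by positivity
  have key : ∀ y : ℝ, 0 ≤ y → y ≤ S → 0 ≤ y / p ^ 2 ∧ y / p ^ 2 ≤ 5 / 4 * S ∧
      |y / p ^ 2 - y| ≤ 5 / 4 * S ^ 2 := fun y hy hyS => by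
    refine ⟨by positivity, by rw [div_eq_mul_inv]; nlinarith, ?_⟩
    have : y / p ^ 2 - y = y * a ^ 2 * (p ^ 2)⁻¹ := by
      have : a ^ 2 = 1 - p ^ 2 := by linarith [h.hp]
      rw [this]; field_simp
    rw [this, abs_of_nonneg (by positivity)]
    have k1 : y * a ^ 2 ≤ S * S := mul_le_mul hyS (by linarith) u0 hS0
    calc y * a ^ 2 * (p ^ 2)⁻¹ ≤ S * S * (5 / 4) := mul_le_mul k1 hinv hinv0 (by positivity)
      _ = _ := by ring
  obtain ⟨kb0, kb1, kb2⟩ := key (b ^ 2) v0 (by linarith)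
  obtain ⟨kc0, kc1, kc2⟩ := key (c ^ 2) w0 (by linarith)
  have x1 : |p⁻¹ - (1 + a ^ 2 / 2)| ≤ 2 * S ^ 2 := by
    refine (abs_inv_sub_one_add_half_le (by linarith) h.hp).trans ?_
    have : a ^ 2 ≤ S := by linarith
    exact mul_le_mul_of_nonneg_left (pow_le_pow_left₀ u0 this 2) (by norm_num)
  have x2 : |σ - (1 + -(c ^ 2 / 2))| ≤ 3 * S ^ 2 := by
    have k := abs_sub_one_add_half_le s0 h.hσ
    have e : σ - (1 + -(c ^ 2 / 2)) = (σ - (1 + -(c ^ 2 / p ^ 2 / 2)))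
      + -((c ^ 2 / p ^ 2 - c ^ 2) / 2) := by ring
    rw [e]
    refine (abs_add_le _ _).trans ?_
    rw [abs_neg, abs_div, abs_of_pos (by norm_num : (0 : ℝ) < 2)]
    have k2 : (c ^ 2 / p ^ 2) ^ 2 ≤ (5 / 4 * S) ^ 2 := pow_le_pow_left₀ kc0 kc1 2
    have k3 : 0 ≤ S ^ 2 := sq_nonneg S
    have k4 : (5 / 4 * S) ^ 2 = 25 / 16 * S ^ 2 := by ring
    linarith
  have x3 : |(1 - b ^ 2 / p ^ 2) - (1 + -b ^ 2)| ≤ 2 * S ^ 2 := by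
    have e : (1 - b ^ 2 / p ^ 2) - (1 + -b ^ 2) = -(b ^ 2 / p ^ 2 - b ^ 2) := by ring
    rw [e, abs_neg]; linarith [sq_nonneg S]
  have x4 : |q⁻¹ - (1 + (b ^ 2 + d ^ 2) / 2)| ≤ 100 * S ^ 2 := by
    have k := abs_inv_sub_one_add_half_le (s := q) (t := b ^ 2 / p ^ 2 + D ^ 2) (by linarith)
      (by linarith [h.hq])
    have e : q⁻¹ - (1 + (b ^ 2 + d ^ 2) / 2) = (q⁻¹ - (1 + (b ^ 2 / p ^ 2 + D ^ 2) / 2))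
      + ((b ^ 2 / p ^ 2 - b ^ 2) / 2 + (D ^ 2 - d ^ 2) / 2) := by ring
    rw [e]
    refine (abs_add_le _ _).trans ?_
    have k2 := abs_add_le ((b ^ 2 / p ^ 2 - b ^ 2) / 2) ((D ^ 2 - d ^ 2) / 2)
    rw [abs_div, abs_div, abs_of_pos (by norm_num : (0 : ℝ) < 2)] at k2
    have k3 : b ^ 2 / p ^ 2 + D ^ 2 ≤ 13 / 2 * S := by linarith
    have k4 : (b ^ 2 / p ^ 2 + D ^ 2) ^ 2 ≤ (13 / 2 * S) ^ 2 :=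
      pow_le_pow_left₀ (by positivity) k3 2
    have k5 : 0 ≤ S ^ 2 := sq_nonneg S
    have k6 : (13 / 2 * S) ^ 2 = 169 / 4 * S ^ 2 := by ring
    linarith
  have y1 := abs_mul_sub_one_add_le hS0 hS1 x1 x2 (M := 1) (M' := 1)
    (by rw [abs_of_nonneg (by positivity)]; linarith)
    (by rw [abs_neg, abs_of_nonneg (by positivity)]; linarith) (by norm_num) (by norm_num)
    (by norm_num) (by norm_num)
  have y2 := abs_mul_sub_one_add_le hS0 hS1 x3 x4 (M := 1) (M' := 1)
    (by rw [abs_neg, abs_of_nonneg (by positivity)]; linarith)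
    (by rw [abs_of_nonneg (by positivity)]; linarith) (by norm_num) (by norm_num)
    (by norm_num) (by norm_num)
  have y3 := abs_mul_sub_one_add_le hS0 hS1 y1 y2 (M := 1) (M' := 1)
    (by rw [abs_le]; constructor <;> linarith)
    (by rw [abs_le]; constructor <;> linarith) (by norm_num) (by norm_num)
    (by norm_num) (by norm_num)
  have e : (σ * q + σ * D ^ 2 / q) / p = p⁻¹ * σ * ((1 - b ^ 2 / p ^ 2) * q⁻¹) := by
    have : 1 - b ^ 2 / p ^ 2 = q ^ 2 + D ^ 2 := by linarith [h.hq]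
    rw [this]; field_simp
  have e2 : 1 + (a ^ 2 - b ^ 2 - c ^ 2 + d ^ 2) / 2
      = 1 + (a ^ 2 / 2 + -(c ^ 2 / 2) + (-b ^ 2 + (b ^ 2 + d ^ 2) / 2)) := by ring
  rw [e, e2]
  refine y3.trans (mul_le_mul_of_nonneg_right (by norm_num) (by positivity))

section

/-- The standard Gaussian measure on the plane. -/
abbrev stdG2 : Measure (ℝ × ℝ) := stdG.prod stdG

lemma abs_integral_tent_affine_sub_le {ε a p x : ℝ} (hε : 0 < ε) (ha : |a| ≤ 1 / 4)
    (hp : 9 / 10 ≤ p) (hx : |x| ≤ ε) :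
    gZero / p * (1 - 2 * ε ^ 2) ≤ ∫ y, tent ε (a * x + p * y) ∂stdG ∧
      ∫ y, tent ε (a * x + p * y) ∂stdG ≤ gZero / p := by
  have hp0 : 0 < p := by linarith
  have hint : Integrable (fun y => tent ε (a * x + p * y)) :=
    ((integrable_tent hε).comp_add_left (a * x)).comp_mul_left' hp0.ne'
  have hval : ∫ y, tent ε (a * x + p * y) = p⁻¹ := by
    have h := Measure.integral_comp_mul_left (fun y => tent ε (a * x + y)) p
    rw [h, integral_add_left_eq_self (tent ε) (a * x), integral_tent hε]
    simp [abs_of_pos hp0]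
  have hnn : ∀ y, 0 ≤ tent ε (a * x + p * y) := fun y => tent_nonneg hε _
  have hmeas : Continuous fun y => tent ε (a * x + p * y) :=
    (continuous_tent ε).comp (by fun_prop)
  have hint2 : Integrable (fun y => gDens y * tent ε (a * x + p * y)) := by
    refine (hint.const_mul gZero).mono' (continuous_gDens.mul hmeas).aestronglyMeasurable
      (Filter.Eventually.of_forall fun y => ?_)
    rw [Real.norm_of_nonneg (mul_nonneg (gDens_nonneg y) (hnn y))]
    exact mul_le_mul_of_nonneg_right (gDens_le y) (hnn y)
  rw [integral_stdG]
  constructor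
  · calc gZero / p * (1 - 2 * ε ^ 2)
        = ∫ y, gZero * (1 - 2 * ε ^ 2) * tent ε (a * x + p * y) := by
          rw [integral_const_mul, hval]; field_simp
      _ ≤ _ := integral_mono (hint.const_mul _) hint2 fun y => by
          rcases le_or_gt ε |a * x + p * y| with h | h
          · simp [tent_eq_zero hε h]
          · refine mul_le_mul_of_nonneg_right (le_trans ?_ (le_gDens y)) (hnn y)
            have h1 : |a * x| ≤ 1 / 4 * ε := by
              rw [abs_mul]; exact mul_le_mul ha hx (abs_nonneg _) (by norm_num)
            have h2 : p * |y| ≤ 5 / 4 * ε := by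
              have : |p * y| ≤ |a * x + p * y| + |a * x| := by
                have := abs_sub (a * x + p * y) (a * x)
                simpa using this
              rw [abs_mul, abs_of_pos hp0] at this
              linarith
            have h3 : |y| ≤ 2 * ε := by nlinarith [abs_nonneg y]
            have h4 : y ^ 2 ≤ (2 * ε) ^ 2 := by rw [← sq_abs]; exact pow_le_pow_left₀ (abs_nonneg y) h3 2
            exact mul_le_mul_of_nonneg_left (by linarith) gZero_pos.le
  · calc _ ≤ ∫ y, gZero * tent ε (a * x + p * y) := integral_mono hint2 (hint.const_mul _) fun y =>
          mul_le_mul_of_nonneg_right (gDens_le y) (hnn y)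
      _ = gZero / p := by rw [integral_const_mul, hval, div_eq_mul_inv]

lemma integrable_tent_mul_tent {ε : ℝ} (hε : 0 < ε) (a p : ℝ) :
    Integrable (fun z : ℝ × ℝ => tent ε z.1 * tent ε (a * z.1 + p * z.2)) stdG2 := by
  refine Integrable.of_bound (C := ε⁻¹ * ε⁻¹) ?_ (Filter.Eventually.of_forall fun z => ?_)
  · exact Continuous.aestronglyMeasurable (((continuous_tent ε).comp continuous_fst).mul
      ((continuous_tent ε).comp (by fun_prop)))
  · rw [Real.norm_of_nonneg (mul_nonneg (tent_nonneg hε _) (tent_nonneg hε _))]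
    exact mul_le_mul (tent_le hε _) (tent_le hε _) (tent_nonneg hε _) (by positivity)

/-- Mass of the smoothed pair density at the origin. -/
lemma integral_tent_mul_tent_bounds {ε a p : ℝ} (hε : 0 < ε) (ha : |a| ≤ 1 / 4)
    (hp : 9 / 10 ≤ p) :
    gZero ^ 2 / p * (1 - 3 * ε ^ 2) ≤ ∫ z, tent ε z.1 * tent ε (a * z.1 + p * z.2) ∂stdG2 ∧
      ∫ z, tent ε z.1 * tent ε (a * z.1 + p * z.2) ∂stdG2 ≤ gZero ^ 2 / p := by
  have hp0 : 0 < p := by linarith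
  have hg := gZero_pos
  have hi := integrable_tent_mul_tent hε a p
  have hfub := integral_prod _ hi
  simp only [integral_const_mul] at hfub
  rw [hfub]
  have hii : Integrable (fun x => tent ε x * ∫ y, tent ε (a * x + p * y) ∂stdG) stdG := by
    have := hi.integral_prod_left
    simpa only [integral_const_mul] using this
  have hti := integrable_tent_stdG hε
  have h1 := integral_tent_stdG_le hε
  have h2 := le_integral_tent_stdG hε
  have hc : 0 < gZero / p := by positivity
  constructor
  · have h3 : ∫ x, tent ε x * (gZero / p * (1 - 2 * ε ^ 2)) ∂stdG
        ≤ ∫ x, tent ε x * ∫ y, tent ε (a * x + p * y) ∂stdG ∂stdG := by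
      refine integral_mono (hti.mul_const _) hii fun x => ?_
      rcases le_or_gt ε |x| with h | h
      · simp [tent_eq_zero hε h]
      · exact mul_le_mul_of_nonneg_left (abs_integral_tent_affine_sub_le hε ha hp h.le).1
          (tent_nonneg hε x)
    refine le_trans ?_ h3
    rw [integral_mul_const]
    have e : gZero ^ 2 / p * (1 - 3 * ε ^ 2) = gZero / p * (gZero * (1 - 3 * ε ^ 2)) := by ring
    have e2 : (∫ x, tent ε x ∂stdG) * (gZero / p * (1 - 2 * ε ^ 2))
        = gZero / p * ((∫ x, tent ε x ∂stdG) * (1 - 2 * ε ^ 2)) := by ring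
    rw [e, e2]
    refine mul_le_mul_of_nonneg_left ?_ hc.le
    nlinarith [sq_nonneg ε]
  · have h3 : ∫ x, tent ε x * ∫ y, tent ε (a * x + p * y) ∂stdG ∂stdG
        ≤ ∫ x, tent ε x * (gZero / p) ∂stdG := by
      refine integral_mono hii (hti.mul_const _) fun x => ?_
      rcases le_or_gt ε |x| with h | h
      · simp [tent_eq_zero hε h]
      · exact mul_le_mul_of_nonneg_left (abs_integral_tent_affine_sub_le hε ha hp h.le).2
          (tent_nonneg hε x)
    refine h3.trans ?_
    rw [integral_mul_const]
    have e : gZero ^ 2 / p = gZero * (gZero / p) := by ring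
    rw [e]
    exact mul_le_mul_of_nonneg_right h1 hc.le

lemma memLp_two_linear (α β : ℝ) : MemLp (fun w : ℝ × ℝ => α * w.1 + β * w.2) 2 stdG2 := by
  have := IsGaussian.memLp_dual stdG2
    (α • ContinuousLinearMap.fst ℝ ℝ ℝ + β • ContinuousLinearMap.snd ℝ ℝ ℝ) 2 (by simp)
  exact this

lemma integrable_abs_mul_abs (u v σ D q : ℝ) :
    Integrable (fun w : ℝ × ℝ => |u + σ * w.1| * |v + (D * w.1 + q * w.2)|) stdG2 := by
  have h1 : MemLp (fun w : ℝ × ℝ => u + σ * w.1) 2 stdG2 := by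
    have h : MemLp (fun w : ℝ × ℝ => u + (σ * w.1 + 0 * w.2)) 2 stdG2 :=
      (memLp_const u).add (memLp_two_linear σ 0)
    simpa only [zero_mul, add_zero] using h
  have h2 : MemLp (fun w : ℝ × ℝ => v + (D * w.1 + q * w.2)) 2 stdG2 :=
    (memLp_const v).add (memLp_two_linear D q)
  exact h1.norm.integrable_mul h2.norm

/-- The mean of `|U V|` for a pair of correlated Gaussian variables. -/
lemma abs_integral_abs_mul_abs_sub_le {σ D q : ℝ} (hσ0 : 0 ≤ σ) (hσ : σ ≤ 1) (hq : 9 / 10 ≤ q) :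
    |∫ w, |σ * w.1| * |D * w.1 + q * w.2| ∂stdG2 - 4 * gZero ^ 2 * (σ * q + σ * D ^ 2 / q)|
      ≤ 8 * D ^ 4 := by
  have hq0 : 0 < q := by linarith
  have hi := integrable_abs_mul_abs 0 0 σ D q
  simp only [zero_add] at hi
  have hfub := integral_prod _ hi
  rw [hfub]
  have hin : ∀ x : ℝ, ∫ y, |σ * x| * |D * x + q * y| ∂stdG
      = σ * q * (|x| * ∫ y, |D * x / q + y| ∂stdG) := fun x => by
    rw [← integral_const_mul, ← integral_const_mul]
    refine integral_congr_ae (ae_of_all _ fun y => ?_)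
    have : D * x + q * y = q * (D * x / q + y) := by field_simp
    simp only [this, abs_mul, abs_of_nonneg hσ0, abs_of_pos hq0]; ring
  have hleft : Integrable (fun x => σ * q * (|x| * ∫ y, |D * x / q + y| ∂stdG)) stdG := by
    have := hi.integral_prod_left
    simpa only [hin] using this
  simp only [hin]
  have hmain : ∫ x, σ * q * (|x| * (2 * gZero * (1 + (D * x / q) ^ 2 / 2))) ∂stdG
      = 4 * gZero ^ 2 * (σ * q + σ * D ^ 2 / q) := by
    have e : ∀ x : ℝ, σ * q * (|x| * (2 * gZero * (1 + (D * x / q) ^ 2 / 2)))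
        = 2 * gZero * σ * q * |x| + gZero * σ * D ^ 2 / q * |x| ^ 3 := fun x => by
      have : |x| ^ 3 = |x| * x ^ 2 := by rw [pow_succ', sq_abs]
      rw [this]; field_simp
    simp_rw [e]
    rw [integral_add (integrable_abs_stdG.const_mul _) ((integrable_abs_pow_stdG 3).const_mul _),
      integral_const_mul, integral_const_mul, integral_abs_stdG, integral_abs_cube_stdG]
    ring
  have hmi : Integrable (fun x => σ * q * (|x| * (2 * gZero * (1 + (D * x / q) ^ 2 / 2)))) stdG := by
    have e : ∀ x : ℝ, σ * q * (|x| * (2 * gZero * (1 + (D * x / q) ^ 2 / 2)))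
        = 2 * gZero * σ * q * |x| + gZero * σ * D ^ 2 / q * |x| ^ 3 := fun x => by
      have : |x| ^ 3 = |x| * x ^ 2 := by rw [pow_succ', sq_abs]
      rw [this]; field_simp
    simp_rw [e]
    exact (integrable_abs_stdG.const_mul _).add ((integrable_abs_pow_stdG 3).const_mul _)
  rw [← hmain, ← integral_sub hleft hmi, ← Real.norm_eq_abs]
  have hbd : Integrable (fun x => σ * q * gZero * (D / q) ^ 4 * |x| ^ 5) stdG :=
    (integrable_abs_pow_stdG 5).const_mul _
  refine (norm_integral_le_of_norm_le hbd (ae_of_all _ fun x => ?_)).trans ?_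
  · rw [Real.norm_eq_abs, ← mul_sub, ← mul_sub, abs_mul (σ * q), abs_mul |x|, abs_abs,
      abs_of_nonneg (mul_nonneg hσ0 hq0.le)]
    have h := abs_integral_abs_add_stdG_sub_le (D * x / q)
    have e : σ * q * gZero * (D / q) ^ 4 * |x| ^ 5
        = σ * q * (|x| * (gZero * (D * x / q) ^ 4)) := by
      have : |x| ^ 5 = |x| * x ^ 4 := by
        rw [pow_succ', ← Even.pow_abs (by decide : Even 4) x]
      rw [this]; field_simp
    rw [e]
    exact mul_le_mul_of_nonneg_left (mul_le_mul_of_nonneg_left h (abs_nonneg x))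
      (mul_nonneg hσ0 hq0.le)
  · rw [integral_const_mul]
    have h5 := integral_abs_pow_stdG 2
    norm_num at h5
    have hf : (Nat.factorial 2 : ℝ) = 2 := by norm_num [Nat.factorial]
    rw [h5]
    have hg := gZero_le
    have hg0 := gZero_pos
    have e : σ * q * gZero * (D / q) ^ 4 * (2 * gZero * 8)
        = D ^ 4 * (16 * gZero ^ 2 * σ * (q⁻¹) ^ 3) := by
      field_simp; ring
    rw [e, mul_comm 8]
    refine mul_le_mul_of_nonneg_left ?_ (by positivity)
    have hqi : q⁻¹ ≤ 10 / 9 := by rw [inv_le_comm₀ hq0 (by norm_num)]; linarith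
    have hqi3 : (q⁻¹) ^ 3 ≤ (10 / 9) ^ 3 := pow_le_pow_left₀ (by positivity) hqi 3
    have hg2 : gZero ^ 2 ≤ 1 / 4 := by nlinarith
    have hg2' : 16 * gZero ^ 2 * σ ≤ 4 := by nlinarith [sq_nonneg gZero]
    calc 16 * gZero ^ 2 * σ * (q⁻¹) ^ 3 ≤ 4 * (10 / 9) ^ 3 :=
          mul_le_mul hg2' hqi3 (by positivity) (by norm_num)
      _ ≤ 8 := by norm_num

end

section

lemma abs_abs_mul_abs_sub_le (u v x y : ℝ) :
    |(|u + x| * |v + y| - |x| * |y|)| ≤ |u| * |v| + |u| * |y| + |v| * |x| := by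
  rw [← abs_mul, ← abs_mul]
  refine (abs_abs_sub_abs_le_abs_sub _ _).trans ?_
  have e : (u + x) * (v + y) - x * y = u * v + u * y + v * x := by ring
  rw [e, ← abs_mul, ← abs_mul, ← abs_mul]
  exact abs_add_three _ _ _

lemma integrable_abs_linear (α β : ℝ) : Integrable (fun w : ℝ × ℝ => |α * w.1 + β * w.2|) stdG2 :=
  ((memLp_two_linear α β).integrable (by norm_num)).norm

lemma integrable_fst_abs : Integrable (fun w : ℝ × ℝ => |w.1|) stdG2 := by
  simpa using integrable_abs_linear 1 0

lemma integrable_snd_abs : Integrable (fun w : ℝ × ℝ => |w.2|) stdG2 := by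
  simpa using integrable_abs_linear 0 1

lemma integral_fst_abs_le : ∫ w : ℝ × ℝ, |w.1| ∂stdG2 ≤ 1 := by
  have : ∫ w : ℝ × ℝ, |w.1| ∂stdG2 = 2 * gZero := by
    rw [integral_fun_fst (fun x : ℝ => |x|), integral_abs_stdG]; simp
  rw [this]; linarith [gZero_le]

lemma integral_snd_abs_le : ∫ w : ℝ × ℝ, |w.2| ∂stdG2 ≤ 1 := by
  have : ∫ w : ℝ × ℝ, |w.2| ∂stdG2 = 2 * gZero := by
    rw [integral_fun_snd (fun x : ℝ => |x|), integral_abs_stdG]; simp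
  rw [this]; linarith [gZero_le]

lemma integral_abs_linear_le (α β : ℝ) :
    ∫ w : ℝ × ℝ, |α * w.1 + β * w.2| ∂stdG2 ≤ |α| + |β| := by
  calc ∫ w : ℝ × ℝ, |α * w.1 + β * w.2| ∂stdG2
      ≤ ∫ w : ℝ × ℝ, (|α| * |w.1| + |β| * |w.2|) ∂stdG2 :=
        integral_mono (integrable_abs_linear α β)
          ((integrable_fst_abs.const_mul _).add (integrable_snd_abs.const_mul _)) fun w => by
          simpa only [abs_mul] using abs_add_le (α * w.1) (β * w.2)
    _ ≤ |α| + |β| := by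
        rw [integral_add (integrable_fst_abs.const_mul _) (integrable_snd_abs.const_mul _),
          integral_const_mul, integral_const_mul]
        have h1 := mul_le_mul_of_nonneg_left integral_fst_abs_le (abs_nonneg α)
        have h2 := mul_le_mul_of_nonneg_left integral_snd_abs_le (abs_nonneg β)
        linarith

/-- Continuity in the means of the absolute product moment. -/
lemma abs_integral_shift_sub_le {ε σ D q u v : ℝ} (hε1 : ε ≤ 1) (hσ0 : 0 ≤ σ)
    (hσ : σ ≤ 1) (hD : |D| ≤ 1 / 3) (hq0 : 0 ≤ q) (hq : q ≤ 1) (hu : |u| ≤ ε) (hv : |v| ≤ ε) :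
    |∫ w, |u + σ * w.1| * |v + (D * w.1 + q * w.2)| ∂stdG2
      - ∫ w, |σ * w.1| * |D * w.1 + q * w.2| ∂stdG2| ≤ 4 * ε := by
  have i1 := integrable_abs_mul_abs u v σ D q
  have i2 := integrable_abs_mul_abs 0 0 σ D q
  simp only [zero_add] at i2
  have hσi : Integrable (fun w : ℝ × ℝ => |σ * w.1|) stdG2 := by
    simpa using integrable_abs_linear σ 0
  have hb1 : Integrable (fun w : ℝ × ℝ => |u| * |v| + |u| * |D * w.1 + q * w.2|) stdG2 :=
    (integrable_const _).add ((integrable_abs_linear D q).const_mul _)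
  have hb : Integrable (fun w : ℝ × ℝ =>
      |u| * |v| + |u| * |D * w.1 + q * w.2| + |v| * |σ * w.1|) stdG2 :=
    hb1.add (hσi.const_mul _)
  rw [← integral_sub i1 i2, ← Real.norm_eq_abs]
  refine (norm_integral_le_of_norm_le hb (ae_of_all _ fun w => ?_)).trans ?_
  · rw [Real.norm_eq_abs]; exact abs_abs_mul_abs_sub_le _ _ _ _
  · rw [integral_add hb1 (hσi.const_mul _), integral_add (integrable_const _)
      ((integrable_abs_linear D q).const_mul _)]
    simp only [integral_const_mul]
    simp only [integral_const, probReal_univ, smul_eq_mul, one_mul]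
    have h1 := integral_abs_linear_le D q
    have h2 : ∫ w : ℝ × ℝ, |σ * w.1| ∂stdG2 ≤ 1 := by
      have := integral_abs_linear_le σ 0
      simp only [zero_mul, add_zero, abs_zero, abs_of_nonneg hσ0] at this
      linarith
    rw [abs_of_nonneg hq0] at h1
    have h0 : 0 ≤ ε := (abs_nonneg u).trans hu
    have k1 : |u| * |v| ≤ ε * 1 := mul_le_mul hu (hv.trans hε1) (abs_nonneg _) h0
    have k2 : |u| * ∫ w : ℝ × ℝ, |D * w.1 + q * w.2| ∂stdG2 ≤ ε * 2 :=
      mul_le_mul hu (by linarith) (integral_nonneg fun _ => abs_nonneg _) h0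
    have k3 : |v| * ∫ w : ℝ × ℝ, |σ * w.1| ∂stdG2 ≤ ε * 1 :=
      mul_le_mul hv h2 (integral_nonneg fun _ => abs_nonneg _) h0
    linarith

/-- The smoothed two-point Kac-Rice integrand. -/
def pairFn (ε : ℝ) (y : (ℝ × ℝ) × (ℝ × ℝ)) : ℝ :=
  tent ε y.1.1 * |y.2.1| * (tent ε y.1.2 * |y.2.2|)

lemma continuous_pairFn (ε : ℝ) : Continuous (pairFn ε) := by
  have := continuous_tent ε
  unfold pairFn
  fun_prop

lemma integrable_pairFn_cholesky {ε : ℝ} (hε : 0 < ε) (a b c p σ D q : ℝ) :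
    Integrable (fun x => pairFn ε (cholesky a b c p σ D q x)) (stdG2.prod stdG2) := by
  have m1 : MemLp (fun x : (ℝ × ℝ) × (ℝ × ℝ) => c/p*x.1.2+σ*x.2.1) 2 (stdG2.prod stdG2) :=
    IsGaussian.memLp_dual (stdG2.prod stdG2)
      ((c/p) • (ContinuousLinearMap.snd ℝ ℝ ℝ).comp (ContinuousLinearMap.fst ℝ (ℝ × ℝ) (ℝ × ℝ))
        + σ • (ContinuousLinearMap.fst ℝ ℝ ℝ).comp (ContinuousLinearMap.snd ℝ (ℝ × ℝ) (ℝ × ℝ)))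
      2 (by simp)
  have m2 : MemLp (fun x : (ℝ × ℝ) × (ℝ × ℝ) => b*x.1.1 - a*b/p*x.1.2 + D*x.2.1 + q*x.2.2) 2
      (stdG2.prod stdG2) :=
    IsGaussian.memLp_dual (stdG2.prod stdG2)
      (b • (ContinuousLinearMap.fst ℝ ℝ ℝ).comp (ContinuousLinearMap.fst ℝ (ℝ × ℝ) (ℝ × ℝ))
        - (a*b/p) • (ContinuousLinearMap.snd ℝ ℝ ℝ).comp
          (ContinuousLinearMap.fst ℝ (ℝ × ℝ) (ℝ × ℝ))
        + D • (ContinuousLinearMap.fst ℝ ℝ ℝ).comp (ContinuousLinearMap.snd ℝ (ℝ × ℝ) (ℝ × ℝ))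
        + q • (ContinuousLinearMap.snd ℝ ℝ ℝ).comp (ContinuousLinearMap.snd ℝ (ℝ × ℝ) (ℝ × ℝ)))
      2 (by simp)
  have hi := m1.norm.integrable_mul m2.norm
  refine (hi.const_mul (ε⁻¹ * ε⁻¹)).mono'
    ((continuous_pairFn ε).comp (continuous_cholesky a b c p σ D q)).aestronglyMeasurable
    (ae_of_all _ fun x => ?_)
  have n1 := tent_nonneg hε x.1.1
  have n2 := tent_nonneg hε (a * x.1.1 + p * x.1.2)
  simp only [pairFn, cholesky, Pi.mul_apply, Real.norm_eq_abs]
  rw [abs_mul, abs_mul, abs_mul, abs_abs, abs_abs, abs_of_nonneg n1, abs_of_nonneg n2]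
  calc _ = (tent ε x.1.1 * tent ε (a * x.1.1 + p * x.1.2)) * (|c/p*x.1.2+σ*x.2.1|
        * |b*x.1.1 - a*b/p*x.1.2 + D*x.2.1 + q*x.2.2|) := by ring
    _ ≤ _ := mul_le_mul_of_nonneg_right (mul_le_mul (tent_le hε _) (tent_le hε _) n2
        (by positivity)) (by positivity)

lemma CholeskyData.abs_shift_le {a b c d p σ D q : ℝ} (h : CholeskyData a b c d p σ D q) {ε x y : ℝ}
    (hx : |x| ≤ ε) (hy : |a * x + p * y| ≤ ε) :
    |c / p * y| ≤ ε ∧ |b * x - a * b / p * y| ≤ ε := by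
  obtain ⟨hp, -⟩ := h.bounds
  have hp0 := h.p_pos
  have hε : 0 ≤ ε := (abs_nonneg x).trans hx
  have h1 : |a * x| ≤ 1 / 4 * ε := by
    rw [abs_mul]; exact mul_le_mul h.ha hx (abs_nonneg _) (by norm_num)
  have h2 : |p * y| ≤ 5 / 4 * ε := by
    have := abs_sub (a * x + p * y) (a * x)
    simp only [add_sub_cancel_left] at this
    linarith
  rw [abs_mul, abs_of_pos hp0] at h2
  have h3 : |y| ≤ 2 * ε := by nlinarith [abs_nonneg y]
  have h4 : |y / p| ≤ 2 * ε := by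
    rw [abs_div, abs_of_pos hp0, div_le_iff₀ hp0]; nlinarith [abs_nonneg y]
  have e1 : c / p * y = c * (y / p) := by ring
  have e2 : a * b / p * y = b * (a * (y / p)) := by ring
  have k : ∀ {s t r : ℝ}, |s| ≤ 1 / 4 → |t| ≤ r → 0 ≤ r → |s * t| ≤ 1 / 4 * r :=
    fun hs ht _ => by rw [abs_mul]; exact mul_le_mul hs ht (abs_nonneg _) (by norm_num)
  have k1 := k h.hc h4 (by positivity)
  have k2 := k h.hb hx hε
  have k3 := k h.hb (k h.ha h4 (by positivity)) (by positivity)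
  rw [e1, e2]
  have := abs_sub (b * x) (b * (a * (y / p)))
  constructor <;> linarith

lemma CholeskyData.abs_integral_pairFn_sub_le {a b c d p σ D q : ℝ}
    (h : CholeskyData a b c d p σ D q) {ε : ℝ} (hε : 0 < ε) (hε1 : ε ≤ 1) :
    |∫ x, pairFn ε (cholesky a b c p σ D q x) ∂(stdG2.prod stdG2)
      - 1 / π ^ 2 * ((σ * q + σ * D ^ 2 / q) / p)| ≤ 8 * ε + 8 * D ^ 4 := by
  obtain ⟨hp, hp1, hσ, hσ1, hD, -⟩ := h.bounds
  obtain ⟨hq, hq1⟩ := h.q_bounds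
  have hp0 := h.p_pos
  set G0 := ∫ w, |σ * w.1| * |D * w.1 + q * w.2| ∂stdG2 with hG0
  set T := fun z : ℝ × ℝ => tent ε z.1 * tent ε (a * z.1 + p * z.2) with hT
  have hTi : Integrable T stdG2 := integrable_tent_mul_tent hε a p
  obtain ⟨hT1, hT2⟩ := integral_tent_mul_tent_bounds hε h.ha hp
  have hi := integrable_pairFn_cholesky hε a b c p σ D q
  have hfub := integral_prod _ hi
  have hin : ∀ z : ℝ × ℝ, ∫ w, pairFn ε (cholesky a b c p σ D q (z, w)) ∂stdG2
      = T z * ∫ w, |c/p*z.2 + σ * w.1| * |(b*z.1 - a*b/p*z.2) + (D * w.1 + q * w.2)| ∂stdG2 :=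
    fun z => by
      rw [← integral_const_mul]
      refine integral_congr_ae (ae_of_all _ fun w => ?_)
      simp only [pairFn, cholesky, hT, add_assoc]; ring
  have hii := hi.integral_prod_left
  simp only [hin] at hfub hii
  rw [hfub]
  have hG := abs_integral_abs_mul_abs_sub_le h.σ_pos.le hσ1 hq (D := D)
  rw [← hG0] at hG
  have hg2 := gZero_sq
  have hgle : gZero ^ 2 ≤ 1 / 4 := by
    have := gZero_le; have := gZero_pos; nlinarith
  have hgp : gZero ^ 2 / p ≤ 1 / 3 := by
    rw [div_le_iff₀ hp0]; linarith
  have hgp0 : 0 ≤ gZero ^ 2 / p := by positivity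
  have hT0 : ∀ z, 0 ≤ T z := fun z => mul_nonneg (tent_nonneg hε _) (tent_nonneg hε _)
  have hstep : |∫ z, T z * ∫ w, |c/p*z.2 + σ * w.1| *
      |(b*z.1 - a*b/p*z.2) + (D * w.1 + q * w.2)| ∂stdG2 ∂stdG2 - G0 * ∫ z, T z ∂stdG2|
      ≤ 4 * ε * ∫ z, T z ∂stdG2 := by
    rw [← integral_const_mul, ← integral_const_mul, ← integral_sub hii (hTi.const_mul _),
      ← Real.norm_eq_abs]
    refine norm_integral_le_of_norm_le (hTi.const_mul _) (ae_of_all _ fun z => ?_)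
    rw [Real.norm_eq_abs, mul_comm G0, ← mul_sub, abs_mul, abs_of_nonneg (hT0 z), mul_comm (4 * ε)]
    rcases le_or_gt ε |z.1| with h1 | h1
    · simp [hT, tent_eq_zero hε h1]
    rcases le_or_gt ε |a * z.1 + p * z.2| with h2 | h2
    · simp [hT, tent_eq_zero hε h2]
    obtain ⟨hu, hv⟩ := h.abs_shift_le h1.le h2.le
    exact mul_le_mul_of_nonneg_left (abs_integral_shift_sub_le hε1 h.σ_pos.le hσ1 hD h.q_pos.le hq1
      hu hv) (hT0 z)
  have hG0n : 0 ≤ G0 := integral_nonneg fun w => by positivity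
  have hG0le : G0 ≤ 2 := by
    have hD4 : D ^ 4 ≤ (1 / 3) ^ 4 := by
      rw [← Even.pow_abs (by decide : Even 4) D]; exact pow_le_pow_left₀ (abs_nonneg _) hD 4
    have hD2 : D ^ 2 ≤ (1 / 3) ^ 2 := by
      rw [← sq_abs D]; exact pow_le_pow_left₀ (abs_nonneg _) hD 2
    have e1 : σ * q ≤ 1 := mul_le_one₀ hσ1 h.q_pos.le hq1
    have e2 : σ * D ^ 2 / q ≤ 1 / 5 := by
      rw [div_le_iff₀ h.q_pos]
      have : σ * D ^ 2 ≤ 1 * (1 / 3) ^ 2 := mul_le_mul hσ1 hD2 (sq_nonneg _) zero_le_one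
      linarith
    have e3 : 4 * gZero ^ 2 * (σ * q + σ * D ^ 2 / q) ≤ 1 * (6 / 5) :=
      mul_le_mul (by linarith) (by linarith)
        (add_nonneg (mul_nonneg h.σ_pos.le h.q_pos.le)
          (div_nonneg (mul_nonneg h.σ_pos.le (sq_nonneg _)) h.q_pos.le)) zero_le_one
    have := (abs_le.1 hG).2
    linarith
  set I := ∫ z, T z ∂stdG2 with hI
  have hI' : |I - gZero ^ 2 / p| ≤ ε := by
    have : gZero ^ 2 / p * (3 * ε ^ 2) ≤ 1 / 3 * (3 * ε ^ 2) :=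
      mul_le_mul_of_nonneg_right hgp (by positivity)
    have hε2 : ε ^ 2 ≤ ε := by nlinarith
    rw [abs_le]; constructor <;> linarith
  have hI1 : I ≤ 1 / 3 := hT2.trans hgp
  have hconst : 1 / π ^ 2 * ((σ * q + σ * D ^ 2 / q) / p)
      = gZero ^ 2 / p * (4 * gZero ^ 2 * (σ * q + σ * D ^ 2 / q)) := by
    have : (1 : ℝ) / π ^ 2 = 4 * (gZero ^ 2) ^ 2 := by
      rw [hg2]; field_simp; norm_num
    rw [this]; ring
  rw [hconst]
  set M := 4 * gZero ^ 2 * (σ * q + σ * D ^ 2 / q)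
  set J := ∫ z, T z * ∫ w, |c/p*z.2 + σ * w.1| *
      |(b*z.1 - a*b/p*z.2) + (D * w.1 + q * w.2)| ∂stdG2 ∂stdG2
  have e : J - gZero ^ 2 / p * M = (J - G0 * I) + G0 * (I - gZero ^ 2 / p)
      + gZero ^ 2 / p * (G0 - M) := by ring
  rw [e]
  refine (abs_add_three _ _ _).trans ?_
  rw [abs_mul, abs_mul, abs_of_nonneg hG0n, abs_of_nonneg hgp0]
  have k1 : G0 * |I - gZero ^ 2 / p| ≤ 2 * ε := mul_le_mul hG0le hI' (abs_nonneg _) (by norm_num)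
  have k2 : gZero ^ 2 / p * |G0 - M| ≤ 1 / 3 * (8 * D ^ 4) :=
    mul_le_mul hgp hG (abs_nonneg _) (by norm_num)
  have k3 : 4 * ε * I ≤ 4 * ε * (1 / 3) := mul_le_mul_of_nonneg_left hI1 (by positivity)
  have : 0 ≤ D ^ 4 := by positivity
  linarith

variable {H : Type} [NormedAddCommGroup H] [InnerProductSpace ℝ H] [FiniteDimensional ℝ H]
  [MeasurableSpace H] [BorelSpace H]

open scoped RealInnerProductSpace

/-- Two-point function of the smoothed count for nearly independent Gaussian vectors. -/
theorem abs_integral_pair_sub_le {f₁ f₂ g₁ g₂ : H} (hf₁ : ‖f₁‖ = 1) (hf₂ : ‖f₂‖ = 1)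
    (hg₁ : ‖g₁‖ = 1) (hg₂ : ‖g₂‖ = 1) (h₁ : ⟪f₁, g₁⟫ = 0) (h₂ : ⟪f₂, g₂⟫ = 0)
    {a b c d : ℝ} (hfa : ⟪f₁, f₂⟫ = a) (hfb : ⟪f₁, g₂⟫ = b) (hfc : ⟪g₁, f₂⟫ = c)
    (hfd : ⟪g₁, g₂⟫ = d)
    (ha : |a| ≤ 1 / 4) (hb : |b| ≤ 1 / 4) (hc : |c| ≤ 1 / 4) (hd : |d| ≤ 1 / 4)
    {ε : ℝ} (hε : 0 < ε) (hε1 : ε ≤ 1) :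
    |∫ ω, pairFn ε ((⟪f₁, ω⟫, ⟪f₂, ω⟫), (⟪g₁, ω⟫, ⟪g₂, ω⟫)) ∂(stdGaussian H)
      - 1 / π ^ 2 * (1 + (a ^ 2 - b ^ 2 - c ^ 2 + d ^ 2) / 2)|
      ≤ 50000 * (a ^ 4 + b ^ 4 + c ^ 4 + d ^ 4) + 8 * ε := by
  obtain ⟨p, σ, D, q, h⟩ := exists_choleskyData ha hb hc hd
  have hmap := map_inner_quad f₁ f₂ g₁ g₂ hf₁ hf₂ hg₁ hg₂ h₁ h₂ hfa hfb hfc hfd h.p_pos.ne' h.hp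
    h.hσ h.hD h.hq
  have e1 : ∫ ω, pairFn ε ((⟪f₁, ω⟫, ⟪f₂, ω⟫), (⟪g₁, ω⟫, ⟪g₂, ω⟫)) ∂(stdGaussian H)
      = ∫ x, pairFn ε (cholesky a b c p σ D q x) ∂(stdG2.prod stdG2) := by
    rw [← integral_map (μ := stdG2.prod stdG2) (f := pairFn ε)
      (continuous_cholesky a b c p σ D q).aemeasurable
      (continuous_pairFn ε).aestronglyMeasurable, ← hmap,
      integral_map (f := pairFn ε) (Continuous.aemeasurable (by fun_prop))
      (continuous_pairFn ε).aestronglyMeasurable]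
  rw [e1]
  have k1 := h.abs_integral_pairFn_sub_le hε hε1
  have k2 := h.abs_main_sub_le
  obtain ⟨k3, -⟩ := h.D_sq
  set S := a ^ 2 + b ^ 2 + c ^ 2 + d ^ 2
  have hD4 : D ^ 4 ≤ 25 * S ^ 2 := by
    have := pow_le_pow_left₀ (sq_nonneg D) k3 2
    calc D ^ 4 = (D ^ 2) ^ 2 := by ring
      _ ≤ _ := this
      _ = _ := by ring
  have hS : S ^ 2 ≤ 4 * (a ^ 4 + b ^ 4 + c ^ 4 + d ^ 4) := by
    have := sq_nonneg (a ^ 2 - b ^ 2)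
    have := sq_nonneg (a ^ 2 - c ^ 2)
    have := sq_nonneg (a ^ 2 - d ^ 2)
    have := sq_nonneg (b ^ 2 - c ^ 2)
    have := sq_nonneg (b ^ 2 - d ^ 2)
    have := sq_nonneg (c ^ 2 - d ^ 2)
    have e : S ^ 2 = 4 * (a ^ 4 + b ^ 4 + c ^ 4 + d ^ 4) - ((a ^ 2 - b ^ 2) ^ 2
      + (a ^ 2 - c ^ 2) ^ 2 + (a ^ 2 - d ^ 2) ^ 2 + (b ^ 2 - c ^ 2) ^ 2 + (b ^ 2 - d ^ 2) ^ 2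
      + (c ^ 2 - d ^ 2) ^ 2) := by simp only [S]; ring
    linarith
  have hπ : 1 / π ^ 2 ≤ 1 := by
    rw [div_le_one (by positivity)]; nlinarith [Real.pi_gt_three]
  have hπ0 : 0 ≤ 1 / π ^ 2 := by positivity
  have k4 : |1 / π ^ 2 * ((σ * q + σ * D ^ 2 / q) / p)
      - 1 / π ^ 2 * (1 + (a ^ 2 - b ^ 2 - c ^ 2 + d ^ 2) / 2)| ≤ 10000 * S ^ 2 := by
    rw [← mul_sub, abs_mul, abs_of_nonneg hπ0]
    calc _ ≤ 1 * (10000 * S ^ 2) := mul_le_mul hπ k2 (abs_nonneg _) zero_le_one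
      _ = _ := one_mul _
  have := abs_sub_le (∫ x, pairFn ε (cholesky a b c p σ D q x) ∂(stdG2.prod stdG2))
    (1 / π ^ 2 * ((σ * q + σ * D ^ 2 / q) / p))
    (1 / π ^ 2 * (1 + (a ^ 2 - b ^ 2 - c ^ 2 + d ^ 2) / 2))
  have : 0 ≤ a ^ 4 + b ^ 4 + c ^ 4 + d ^ 4 := by positivity
  linarith

/-- One-point function of the smoothed count. -/
theorem integral_tent_mul_abs_bounds {f g : H} (hf : ‖f‖ = 1) (hg : ‖g‖ = 1) (h : ⟪f, g⟫ = 0)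
    {ε : ℝ} (hε : 0 < ε) (hε1 : ε ≤ 1) :
    |∫ ω, tent ε ⟪f, ω⟫ * |⟪g, ω⟫| ∂(stdGaussian H) - 1 / π| ≤ ε := by
  have hmap := map_inner_pair f g h
  have ht := continuous_tent ε
  have e1 : ∫ ω, tent ε ⟪f, ω⟫ * |⟪g, ω⟫| ∂(stdGaussian H)
      = ∫ z : ℝ × ℝ, tent ε z.1 * |z.2| ∂stdG2 := by
    have hc : Continuous fun z : ℝ × ℝ => tent ε z.1 * |z.2| := by fun_prop
    have h1 := integral_map (μ := stdGaussian H) (φ := fun ω => (⟪f, ω⟫, ⟪g, ω⟫))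
      (Continuous.aemeasurable (by fun_prop)) hc.aestronglyMeasurable
    rw [hmap, integral_map (Continuous.aemeasurable (by fun_prop)) hc.aestronglyMeasurable] at h1
    simp only [hf, hg, one_mul] at h1
    exact h1.symm
  rw [e1, integral_prod_mul (fun x => tent ε x) (fun y => |y|), integral_abs_stdG]
  have h1 := integral_tent_stdG_le hε
  have h2 := le_integral_tent_stdG hε
  have hp := gZero_pos
  have hq := gZero_le
  have e : 1 / π = gZero * (2 * gZero) := by
    have := gZero_sq
    have : gZero * (2 * gZero) = 2 * gZero ^ 2 := by ring
    rw [this, gZero_sq]; field_simp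
  rw [e, ← sub_mul, abs_mul, abs_of_pos (by positivity : 0 < 2 * gZero)]
  have hε2 : ε ^ 2 ≤ ε := by nlinarith
  have k : |∫ x, tent ε x ∂stdG - gZero| ≤ ε := by
    have : gZero * (ε ^ 2 / 2) ≤ 1 / 2 * (ε ^ 2 / 2) := mul_le_mul_of_nonneg_right hq (by positivity)
    rw [abs_le]; constructor <;> linarith
  calc _ ≤ ε * 1 := mul_le_mul k (by linarith) (by positivity) hε.le
    _ = ε := mul_one ε

end

section

open scoped RealInnerProductSpace

/-- A curve in the unit sphere of a Hilbert space, parametrised by arc length on `[0, T]`,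
together with its successive derivatives. -/
structure UnitCurve {H : Type} [NormedAddCommGroup H] [InnerProductSpace ℝ H]
    (D : ℕ → ℝ → H) (B T : ℝ) : Prop where
  pos : 0 < T
  hasDerivAt : ∀ j t, HasDerivAt (D j) (D (j + 1) t) t
  norm_zero : ∀ t ∈ Set.Icc 0 T, ‖D 0 t‖ = 1
  norm_one : ∀ t ∈ Set.Icc 0 T, ‖D 1 t‖ = 1
  norm_le : ∀ j ≤ 6, ∀ t ∈ Set.Icc 0 T, ‖D j t‖ ≤ B

namespace UnitCurve

variable {H : Type} [NormedAddCommGroup H] [InnerProductSpace ℝ H] {D : ℕ → ℝ → H} {B T : ℝ}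

lemma continuous (h : UnitCurve D B T) (j : ℕ) : Continuous (D j) :=
  continuous_iff_continuousAt.2 fun t => (h.hasDerivAt j t).continuousAt

lemma hasDerivAt_inner (h : UnitCurve D B T) (j : ℕ) (t : ℝ) (ω : H) :
    HasDerivAt (fun t => ⟪D j t, ω⟫) ⟪D (j + 1) t, ω⟫ t := by
  simpa using (h.hasDerivAt j t).inner ℝ (hasDerivAt_const t ω)

lemma continuous_inner (h : UnitCurve D B T) (j : ℕ) (ω : H) :
    Continuous fun t => ⟪D j t, ω⟫ := (h.continuous j).inner continuous_const

lemma continuous_inner_uncurry (h : UnitCurve D B T) (j : ℕ) :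
    Continuous fun x : H × ℝ => ⟪D j x.2, x.1⟫ :=
  ((h.continuous j).comp continuous_snd).inner continuous_fst

lemma inner_self_deriv_eq_zero (h : UnitCurve D B T) {j : ℕ}
    (hj : ∀ t ∈ Set.Icc 0 T, ‖D j t‖ = 1) {t : ℝ} (ht : t ∈ Set.Icc 0 T) :
    ⟪D j t, D (j + 1) t⟫ = 0 := by
  have h1 := (h.hasDerivAt j t).inner ℝ (h.hasDerivAt j t)
  have h2 := h1.eq_zero_of_const_on_Icc h.pos (c := 1)
    (fun s hs => by rw [real_inner_self_eq_norm_sq, hj s hs, one_pow]) ht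
  rw [real_inner_comm (D j t) (D (j + 1) t)] at h2
  linarith

lemma inner_zero_one (h : UnitCurve D B T) {t : ℝ} (ht : t ∈ Set.Icc 0 T) :
    ⟪D 0 t, D 1 t⟫ = 0 := h.inner_self_deriv_eq_zero h.norm_zero ht

lemma inner_one_two (h : UnitCurve D B T) {t : ℝ} (ht : t ∈ Set.Icc 0 T) :
    ⟪D 1 t, D 2 t⟫ = 0 := h.inner_self_deriv_eq_zero h.norm_one ht

lemma one_le_norm_two (h : UnitCurve D B T) {t : ℝ} (ht : t ∈ Set.Icc 0 T) : 1 ≤ ‖D 2 t‖ := by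
  have h1 := (h.hasDerivAt 0 t).inner ℝ (h.hasDerivAt 1 t)
  have h2 := h1.eq_zero_of_const_on_Icc h.pos (c := 0) (fun s hs => h.inner_zero_one hs) ht
  simp only [zero_add, one_add_one_eq_two, real_inner_self_eq_norm_sq, h.norm_one t ht] at h2
  have h3 := abs_real_inner_le_norm (D 0 t) (D 2 t)
  have h4 : ⟪D 0 t, D 2 t⟫ = -1 := by linarith
  rw [h4, h.norm_zero t ht] at h3
  simpa using h3

lemma one_le_bound (h : UnitCurve D B T) : 1 ≤ B := by
  have h0 : (0 : ℝ) ∈ Set.Icc 0 T := ⟨le_rfl, h.pos.le⟩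
  exact (h.norm_zero 0 h0).symm.le.trans (h.norm_le 0 (by norm_num) 0 h0)

end UnitCurve

variable {H : Type} [NormedAddCommGroup H] [InnerProductSpace ℝ H] [FiniteDimensional ℝ H]
  [MeasurableSpace H] [BorelSpace H]

lemma map_inner_stdGaussian (v : H) :
    (stdGaussian H).map (fun ω => ⟪v, ω⟫) = stdG.map (fun x => ‖v‖ * x) := by
  have h := congrArg (fun μ => μ.map Prod.fst) (map_inner_pair v (0 : H) (by simp))
  rw [Measure.map_map measurable_fst (by fun_prop), Measure.map_map measurable_fst (by fun_prop)]
    at h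
  have e : stdG.map (fun x => ‖v‖ * x)
      = ((stdG.prod stdG).map Prod.fst).map (fun x => ‖v‖ * x) := by
    rw [Measure.map_fst_prod]; simp
  rw [e, Measure.map_map (by fun_prop) measurable_fst]
  exact h

/-- The sixth moment of the standard Gaussian. -/
def sixthMoment : ℝ := ∫ x, x ^ 6 ∂stdG

lemma sixthMoment_nonneg : 0 ≤ sixthMoment := integral_nonneg fun _ => by positivity

lemma lintegral_inner_pow_six (v : H) :
    ∫⁻ ω, ENNReal.ofReal (⟪v, ω⟫ ^ 6) ∂(stdGaussian H) = ENNReal.ofReal (‖v‖ ^ 6 * sixthMoment) := by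
  have h1 := lintegral_map (μ := stdGaussian H) (f := fun x : ℝ => ENNReal.ofReal (x ^ 6))
    (g := fun ω => ⟪v, ω⟫) (by fun_prop) (by fun_prop)
  rw [← h1, map_inner_stdGaussian, lintegral_map (by fun_prop) (by fun_prop)]
  have h6 : Integrable (fun x : ℝ => (‖v‖ * x) ^ 6) stdG := by
    simp only [mul_pow]; exact (integrable_pow_stdG 6).const_mul _
  rw [← ofReal_integral_eq_lintegral_ofReal h6 (ae_of_all _ fun x => by positivity)]
  simp only [mul_pow, integral_const_mul, sixthMoment]

lemma measure_inner_eq_zero {v : H} (hv : v ≠ 0) : stdGaussian H {ω | ⟪v, ω⟫ = 0} = 0 := by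
  have h1 : {ω : H | ⟪v, ω⟫ = 0} = (fun ω => ⟪v, ω⟫) ⁻¹' {0} := rfl
  have hv' : ‖v‖ ≠ 0 := norm_ne_zero_iff.2 hv
  rw [h1, ← Measure.map_apply (by fun_prop) (measurableSet_singleton _), map_inner_stdGaussian,
    Measure.map_apply (by fun_prop) (measurableSet_singleton _)]
  have h2 : (fun x => ‖v‖ * x) ⁻¹' {0} ⊆ {x : ℝ | |x| ≤ 0} := fun x hx => by
    have : ‖v‖ * x = 0 := hx
    simp [(mul_eq_zero.1 this).resolve_left hv']
  refine le_antisymm ((measure_mono h2).trans ?_) bot_le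
  simpa using stdG_real_abs_le (le_refl (0 : ℝ))

/-- Small ball estimate for a pair of orthogonal Gaussian coordinates. -/
lemma measure_inner_small_le {u v : H} (hu : 1 ≤ ‖u‖) (hv : 1 ≤ ‖v‖) (huv : ⟪u, v⟫ = 0)
    {x y : ℝ} (hx : 0 ≤ x) (hy : 0 ≤ y) :
    stdGaussian H {ω | |⟪u, ω⟫| ≤ x ∧ |⟪v, ω⟫| ≤ y} ≤ ENNReal.ofReal (x * y) := by
  have hS : MeasurableSet {z : ℝ × ℝ | |z.1| ≤ x ∧ |z.2| ≤ y} :=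
    (measurableSet_le (measurable_fst.abs) measurable_const).inter
      (measurableSet_le (measurable_snd.abs) measurable_const)
  have h1 : {ω : H | |⟪u, ω⟫| ≤ x ∧ |⟪v, ω⟫| ≤ y}
      = (fun ω => (⟪u, ω⟫, ⟪v, ω⟫)) ⁻¹' {z : ℝ × ℝ | |z.1| ≤ x ∧ |z.2| ≤ y} := rfl
  rw [h1, ← Measure.map_apply (by fun_prop) hS, map_inner_pair u v huv,
    Measure.map_apply (by fun_prop) hS]
  have h2 : (fun p : ℝ × ℝ => (‖u‖ * p.1, ‖v‖ * p.2)) ⁻¹' {z : ℝ × ℝ | |z.1| ≤ x ∧ |z.2| ≤ y}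
      ⊆ {r : ℝ | |r| ≤ x} ×ˢ {r : ℝ | |r| ≤ y} := fun p hp => by
    obtain ⟨k1, k2⟩ : |‖u‖ * p.1| ≤ x ∧ |‖v‖ * p.2| ≤ y := hp
    rw [abs_mul, abs_norm] at k1 k2
    exact ⟨(le_mul_of_one_le_left (abs_nonneg _) hu).trans k1,
      (le_mul_of_one_le_left (abs_nonneg _) hv).trans k2⟩
  refine (measure_mono h2).trans ?_
  rw [Measure.prod_prod, ENNReal.ofReal_mul hx]
  exact mul_le_mul' (stdG_real_abs_le hx) (stdG_real_abs_le hy)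

end

lemma Set.encard_le_two_of_lt {s : Set ℝ}
    (h : ∀ x ∈ s, ∀ y ∈ s, ∀ z ∈ s, x < y → y < z → False) : s.encard ≤ 2 := by
  by_contra! hc
  have h3 : (3 : ℕ∞) ≤ s.encard := by
    have := Order.add_one_le_of_lt hc
    norm_num at this; exact this
  obtain ⟨t, hts, ht⟩ := Set.exists_subset_encard_eq h3
  obtain ⟨x, y, z, hxy, hxz, hyz, rfl⟩ := Set.encard_eq_three.1 ht
  have hx : x ∈ s := hts (by simp)
  have hy : y ∈ s := hts (by simp)
  have hz : z ∈ s := hts (by simp)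
  rcases lt_or_gt_of_ne hxy with h1 | h1 <;> rcases lt_or_gt_of_ne hxz with h2 | h2 <;>
    rcases lt_or_gt_of_ne hyz with h3 | h3
  · exact h x hx y hy z hz h1 h3
  · exact h x hx z hz y hy h2 h3
  · linarith
  · exact h z hz x hx y hy h2 h1
  · exact h y hy x hx z hz h1 h2
  · linarith
  · exact h y hy z hz x hx h3 h2
  · exact h z hz y hy x hx h3 h1

lemma exists_deriv_zero {f f' : ℝ → ℝ} (hf : ∀ t, HasDerivAt f (f' t) t) {x y : ℝ} (hxy : x < y)
    (hx : f x = 0) (hy : f y = 0) : ∃ z ∈ Set.Ioo x y, f' z = 0 :=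
  exists_hasDerivAt_eq_zero hxy (fun t _ => (hf t).continuousAt.continuousWithinAt)
    (hx.trans hy.symm) fun t _ => hf t

lemma abs_le_of_zero {f f' : ℝ → ℝ} (hf : ∀ t, HasDerivAt f (f' t) t) {s h M x t : ℝ}
    (hM : ∀ t ∈ Set.Icc s (s + h), |f' t| ≤ M) (hx : x ∈ Set.Icc s (s + h)) (h0 : f x = 0)
    (ht : t ∈ Set.Icc s (s + h)) : |f t| ≤ M * h := by
  have h1 := (convex_Icc s (s + h)).norm_image_sub_le_of_norm_hasDerivWithin_le
    (fun t _ => (hf t).hasDerivWithinAt) hM hx ht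
  rw [h0, sub_zero, Real.norm_eq_abs, Real.norm_eq_abs] at h1
  have hM0 : 0 ≤ M := (abs_nonneg _).trans (hM x hx)
  refine h1.trans (mul_le_mul_of_nonneg_left ?_ hM0)
  rw [abs_le]
  constructor <;> linarith [hx.1, hx.2, ht.1, ht.2]

/-- Three zeros on a short interval force the function and its derivative to be small. -/
lemma abs_le_of_three_zeros {f f₁ f₂ f₃ : ℝ → ℝ} (h0 : ∀ t, HasDerivAt f (f₁ t) t)
    (h1 : ∀ t, HasDerivAt f₁ (f₂ t) t) (h2 : ∀ t, HasDerivAt f₂ (f₃ t) t) {s h M x y z : ℝ}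
    (hM : ∀ t ∈ Set.Icc s (s + h), |f₃ t| ≤ M) (hx : x ∈ Set.Icc s (s + h))
    (hz : z ∈ Set.Icc s (s + h)) (hxy : x < y) (hyz : y < z)
    (fx : f x = 0) (fy : f y = 0) (fz : f z = 0) :
    |f s| ≤ M * h ^ 3 ∧ |f₁ s| ≤ M * h ^ 2 := by
  obtain ⟨u, hu, fu⟩ := exists_deriv_zero h0 hxy fx fy
  obtain ⟨v, hv, fv⟩ := exists_deriv_zero h0 hyz fy fz
  obtain ⟨w, hw, fw⟩ := exists_deriv_zero h1 (hu.2.trans hv.1) fu fv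
  have hu' : u ∈ Set.Icc s (s + h) := ⟨hx.1.trans hu.1.le, (hu.2.trans (hyz)).le.trans hz.2⟩
  have hw' : w ∈ Set.Icc s (s + h) :=
    ⟨hu'.1.trans hw.1.le, (hw.2.trans hv.2).le.trans hz.2⟩
  have hs : s ∈ Set.Icc s (s + h) := ⟨le_rfl, hx.1.trans hx.2⟩
  have b2 : ∀ t ∈ Set.Icc s (s + h), |f₂ t| ≤ M * h := fun t ht => abs_le_of_zero h2 hM hw' fw ht
  have b1 : ∀ t ∈ Set.Icc s (s + h), |f₁ t| ≤ M * h * h := fun t ht => abs_le_of_zero h1 b2 hu' fu ht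
  have b0 := abs_le_of_zero h0 b1 hx fx hs
  constructor
  · calc _ ≤ _ := b0
      _ = _ := by ring
  · calc _ ≤ _ := b1 s hs
      _ = _ := by ring

lemma abs_le_of_double_zero {f f₁ f₂ : ℝ → ℝ} (h0 : ∀ t, HasDerivAt f (f₁ t) t)
    (h1 : ∀ t, HasDerivAt f₁ (f₂ t) t) {s h M x : ℝ}
    (hM : ∀ t ∈ Set.Icc s (s + h), |f₂ t| ≤ M) (hx : x ∈ Set.Icc s (s + h))
    (fx : f x = 0) (fy : f₁ x = 0) : |f s| ≤ M * h ^ 2 ∧ |f₁ s| ≤ M * h := by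
  have hs : s ∈ Set.Icc s (s + h) := ⟨le_rfl, hx.1.trans hx.2⟩
  have b1 : ∀ t ∈ Set.Icc s (s + h), |f₁ t| ≤ M * h := fun t ht => abs_le_of_zero h1 hM hx fy ht
  have b0 := abs_le_of_zero h0 b1 hx fx hs
  refine ⟨?_, b1 s hs⟩
  calc _ ≤ _ := b0
    _ = _ := by ring

/-- The `k`-th point of the subdivision of `[a, b]` into `n` equal parts. -/
def gridPt (a b : ℝ) (n k : ℕ) : ℝ := a + k * ((b - a) / n)

lemma gridPt_zero (a b : ℝ) (n : ℕ) : gridPt a b n 0 = a := by simp [gridPt]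

lemma gridPt_self (a b : ℝ) {n : ℕ} (hn : 0 < n) : gridPt a b n n = b := by
  have : (n : ℝ) ≠ 0 := by positivity
  rw [gridPt]; field_simp; ring

lemma gridPt_succ (a b : ℝ) (n k : ℕ) : gridPt a b n (k + 1) = gridPt a b n k + (b - a) / n := by
  rw [gridPt, gridPt]; push_cast; ring

lemma gridPt_mem {a b : ℝ} (hab : a ≤ b) {n k : ℕ} (hn : 0 < n) (hk : k ≤ n) :
    gridPt a b n k ∈ Set.Icc a b := by
  have hn' : (0 : ℝ) < n := by positivity
  have hk' : (k : ℝ) ≤ n := by exact_mod_cast hk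
  have h1 : (k : ℝ) * ((b - a) / n) ≤ n * ((b - a) / n) :=
    mul_le_mul_of_nonneg_right hk' (div_nonneg (by linarith) hn'.le)
  have h2 : (n : ℝ) * ((b - a) / n) = b - a := by field_simp
  constructor
  · have : 0 ≤ (k : ℝ) * ((b - a) / n) := mul_nonneg (by positivity) (div_nonneg (by linarith) hn'.le)
    rw [gridPt]; linarith
  · rw [gridPt]; linarith

lemma exists_gridPt {a b t : ℝ} {n : ℕ} (hn : 0 < n) (ht : t ∈ Set.Icc a b) :
    ∃ k < n, t ∈ Set.Icc (gridPt a b n k) (gridPt a b n k + (b - a) / n) := by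
  have hex : ∃ k, t ≤ gridPt a b n (k + 1) := ⟨n - 1, by
    rw [Nat.sub_add_cancel hn, gridPt_self a b hn]; exact ht.2⟩
  classical
  refine ⟨Nat.find hex, ?_, ?_, ?_⟩
  · have : Nat.find hex ≤ n - 1 := Nat.find_min' hex (by
      rw [Nat.sub_add_cancel hn, gridPt_self a b hn]; exact ht.2)
    omega
  · rcases Nat.eq_zero_or_pos (Nat.find hex) with h0 | h0
    · rw [h0, gridPt_zero]; exact ht.1
    · have := Nat.find_min hex (m := Nat.find hex - 1) (by omega)
      rw [Nat.sub_add_cancel h0] at this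
      exact (not_le.1 this).le
  · rw [← gridPt_succ]; exact Nat.find_spec hex

lemma gridPt_Icc_subset {a b : ℝ} (hab : a ≤ b) {n k : ℕ} (hk : k < n) :
    Set.Icc (gridPt a b n k) (gridPt a b n k + (b - a) / n) ⊆ Set.Icc a b := by
  rw [← gridPt_succ]
  exact Set.Icc_subset_Icc (gridPt_mem hab (by omega) hk.le).1 (gridPt_mem hab (by omega) hk).2

/-- Nondegeneracy on a grid bounds the number of zeros. -/
lemma encard_zero_le_of_grid {f f₁ f₂ f₃ : ℝ → ℝ} (h0 : ∀ t, HasDerivAt f (f₁ t) t)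
    (h1 : ∀ t, HasDerivAt f₁ (f₂ t) t) (h2 : ∀ t, HasDerivAt f₂ (f₃ t) t) {a b M : ℝ} {n : ℕ}
    (hab : a < b) (hn : 0 < n) (hM : ∀ t ∈ Set.Icc a b, |f₃ t| ≤ M)
    (hg : ∀ k < n, ¬ (|f (gridPt a b n k)| ≤ M * ((b - a) / n) ^ 3 ∧
      |f₁ (gridPt a b n k)| ≤ M * ((b - a) / n) ^ 2)) :
    {t | t ∈ Set.Icc a b ∧ f t = 0}.encard ≤ (2 * n : ℕ) := by
  have hsub : {t | t ∈ Set.Icc a b ∧ f t = 0} ⊆ ⋃ k ∈ Finset.range n,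
      {t | t ∈ Set.Icc (gridPt a b n k) (gridPt a b n k + (b - a) / n) ∧ f t = 0} := by
    rintro t ⟨ht, ft⟩
    obtain ⟨k, hk, hkt⟩ := exists_gridPt hn ht
    simp only [Set.mem_iUnion]
    exact ⟨k, Finset.mem_range.2 hk, hkt, ft⟩
  refine (Set.encard_le_encard hsub).trans ((Finset.set_encard_biUnion_le _ _).trans ?_)
  calc _ ≤ ∑ k ∈ Finset.range n, (2 : ℕ∞) := Finset.sum_le_sum fun k hk => ?_
    _ = (2 * n : ℕ) := by simp [mul_comm]
  refine Set.encard_le_two_of_lt fun x hx y hy z hz hxy hyz => ?_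
  exact hg k (Finset.mem_range.1 hk) (abs_le_of_three_zeros h0 h1 h2
    (fun t ht => hM t (gridPt_Icc_subset hab.le (Finset.mem_range.1 hk) ht)) hx.1 hz.1 hxy hyz
    hx.2 hy.2 hz.2)

lemma ne_zero_of_grid {f f₁ f₂ : ℝ → ℝ} (h0 : ∀ t, HasDerivAt f (f₁ t) t)
    (h1 : ∀ t, HasDerivAt f₁ (f₂ t) t) {a b M : ℝ} {n : ℕ}
    (hab : a < b) (hn : 0 < n) (hM : ∀ t ∈ Set.Icc a b, |f₂ t| ≤ M)
    (hg : ∀ k < n, ¬ (|f (gridPt a b n k)| ≤ M * ((b - a) / n) ^ 2 ∧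
      |f₁ (gridPt a b n k)| ≤ M * ((b - a) / n))) :
    ∀ t ∈ Set.Icc a b, f t = 0 → f₁ t ≠ 0 := by
  intro t ht ft ft1
  obtain ⟨k, hk, hkt⟩ := exists_gridPt hn ht
  exact hg k hk (abs_le_of_double_zero h0 h1
    (fun t ht => hM t (gridPt_Icc_subset hab.le hk ht)) hkt ft ft1)

/-- A Sobolev bound for the sixth power. -/
lemma pow_six_le_sobolev {f f' : ℝ → ℝ} (hf : ∀ t, HasDerivAt f (f' t) t) (hf' : Continuous f')
    {a b t : ℝ} (ht : t ∈ Set.Icc a b) :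
    f t ^ 6 ≤ f a ^ 6 + ∫ s in a..b, (5 * f s ^ 6 + f' s ^ 6) := by
  have hfc : Continuous f := continuous_iff_continuousAt.2 fun t => (hf t).continuousAt
  have hcd : Continuous fun s => 6 * f s ^ 5 * f' s := by fun_prop
  have hce : Continuous fun s => 5 * f s ^ 6 + f' s ^ 6 := by fun_prop
  have h1 : ∫ s in a..t, 6 * f s ^ 5 * f' s = f t ^ 6 - f a ^ 6 :=
    intervalIntegral.integral_eq_sub_of_hasDerivAt
      (fun s _ => ((hf s).pow 6).congr_deriv (by push_cast; ring)) (hcd.intervalIntegrable _ _)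
  have young : ∀ x y : ℝ, 6 * x ^ 5 * y ≤ 5 * x ^ 6 + y ^ 6 := fun x y => by
    have e : 5 * x ^ 6 + y ^ 6 - 6 * x ^ 5 * y
        = (x - y) ^ 2 * (3 * x ^ 4 + 2 * (x ^ 2 + x * y) ^ 2 + (x * y + y ^ 2) ^ 2) := by ring
    have : 0 ≤ (x - y) ^ 2 * (3 * x ^ 4 + 2 * (x ^ 2 + x * y) ^ 2 + (x * y + y ^ 2) ^ 2) := by
      positivity
    linarith
  have h2 : ∫ s in a..t, 6 * f s ^ 5 * f' s ≤ ∫ s in a..t, (5 * f s ^ 6 + f' s ^ 6) :=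
    intervalIntegral.integral_mono_on ht.1 (hcd.intervalIntegrable _ _)
      (hce.intervalIntegrable _ _) fun s _ => young _ _
  have h3 : ∫ s in a..t, (5 * f s ^ 6 + f' s ^ 6) ≤ ∫ s in a..b, (5 * f s ^ 6 + f' s ^ 6) := by
    rw [← intervalIntegral.integral_add_adjacent_intervals (hce.intervalIntegrable a t)
      (hce.intervalIntegrable t b)]
    have := intervalIntegral.integral_nonneg (μ := volume) ht.2
      fun s _ => (by positivity : 0 ≤ 5 * f s ^ 6 + f' s ^ 6)
    linarith
  linarith

section

open scoped RealInnerProductSpace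

variable {H : Type} [NormedAddCommGroup H] [InnerProductSpace ℝ H]

/-- A bound for the supremum of the sixth power of the `i`-th derivative over `[a, b]`. -/
def sobolevBound (D : ℕ → ℝ → H) (i : ℕ) (a b : ℝ) (ω : H) : ℝ :=
  ⟪D i a, ω⟫ ^ 6 + ∫ s in a..b, (5 * ⟪D i s, ω⟫ ^ 6 + ⟪D (i + 1) s, ω⟫ ^ 6)

/-- The event that the nondegeneracy needed to control zeros fails at scale `n`. -/
def badSet (D : ℕ → ℝ → H) (i j e : ℕ) (a b : ℝ) (n : ℕ) : Set H :=
  {ω | (n : ℝ) ^ 3 < sobolevBound D i a b ω} ∪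
    ⋃ k ∈ Finset.range n, {ω | |⟪D j (gridPt a b n k), ω⟫| ≤ √n * ((b - a) / n) ^ (e + 1) ∧
      |⟪D (j + 1) (gridPt a b n k), ω⟫| ≤ √n * ((b - a) / n) ^ e}

variable {D : ℕ → ℝ → H} {B T : ℝ}

lemma UnitCurve.continuous_sobolevBound (h : UnitCurve D B T) (i : ℕ) (a b : ℝ) :
    Continuous (sobolevBound D i a b) := by
  have h1 := h.continuous_inner_uncurry i
  have h2 := h.continuous_inner_uncurry (i + 1)
  refine Continuous.add (by fun_prop) ?_
  refine intervalIntegral.continuous_parametric_intervalIntegral_of_continuous' ?_ a b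
  exact Continuous.add (continuous_const.mul (h1.pow 6)) (h2.pow 6)

lemma UnitCurve.pow_six_le (h : UnitCurve D B T) (i : ℕ) {a b t : ℝ} (ht : t ∈ Set.Icc a b)
    (ω : H) : ⟪D i t, ω⟫ ^ 6 ≤ sobolevBound D i a b ω :=
  pow_six_le_sobolev (fun t => h.hasDerivAt_inner i t ω) (h.continuous_inner (i + 1) ω) ht

lemma UnitCurve.abs_le_sqrt (h : UnitCurve D B T) {i n : ℕ} {a b t : ℝ} (ht : t ∈ Set.Icc a b)
    {ω : H} (hω : sobolevBound D i a b ω ≤ (n : ℝ) ^ 3) : |⟪D i t, ω⟫| ≤ √n := by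
  refine (pow_le_pow_iff_left₀ (abs_nonneg _) (sqrt_nonneg _) (by norm_num : 6 ≠ 0)).1 ?_
  have e : √(n : ℝ) ^ 6 = (n : ℝ) ^ 3 := by
    rw [show (6 : ℕ) = 2 * 3 by norm_num, pow_mul, sq_sqrt (Nat.cast_nonneg n)]
  rw [e, Even.pow_abs (by decide)]
  exact (h.pow_six_le i ht ω).trans hω

variable [FiniteDimensional ℝ H] [MeasurableSpace H] [BorelSpace H]

lemma UnitCurve.measurableSet_badSet (h : UnitCurve D B T) (i j e : ℕ) (a b : ℝ) (n : ℕ) :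
    MeasurableSet (badSet D i j e a b n) := by
  refine MeasurableSet.union ?_ (Finset.measurableSet_biUnion _ fun k _ => ?_)
  · exact measurableSet_lt measurable_const (h.continuous_sobolevBound i a b).measurable
  · have hm : ∀ v : H, Measurable fun ω : H => |⟪v, ω⟫| := fun v => by fun_prop
    exact (measurableSet_le (hm _) measurable_const).inter
      (measurableSet_le (hm _) measurable_const)

lemma UnitCurve.lintegral_sobolevBound_le (h : UnitCurve D B T) {i : ℕ} (hi : i ≤ 5) {a b : ℝ}
    (ha : 0 ≤ a) (hab : a < b) (hb : b ≤ T) (hδ : b - a ≤ 1) :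
    ∫⁻ ω, ENNReal.ofReal (sobolevBound D i a b ω) ∂(stdGaussian H)
      ≤ ENNReal.ofReal (7 * B ^ 6 * sixthMoment) := by
  have hC := sixthMoment_nonneg
  have hB : 0 ≤ B := zero_le_one.trans h.one_le_bound
  have key : ∀ j ≤ 6, ∀ t ∈ Set.Icc a b, ∫⁻ ω, ENNReal.ofReal (⟪D j t, ω⟫ ^ 6) ∂(stdGaussian H)
      ≤ ENNReal.ofReal (B ^ 6 * sixthMoment) := fun j hj t ht => by
    rw [lintegral_inner_pow_six]
    exact ENNReal.ofReal_le_ofReal (mul_le_mul_of_nonneg_right (pow_le_pow_left₀ (norm_nonneg _)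
      (h.norm_le j hj t ⟨ha.trans ht.1, ht.2.trans hb⟩) 6) hC)
  have hcont : ∀ j, Continuous fun x : H × ℝ => ⟪D j x.2, x.1⟫ := h.continuous_inner_uncurry
  have e1 : ∀ ω, ENNReal.ofReal (sobolevBound D i a b ω) = ENNReal.ofReal (⟪D i a, ω⟫ ^ 6)
      + ∫⁻ s in Set.Ioc a b, ENNReal.ofReal (5 * ⟪D i s, ω⟫ ^ 6 + ⟪D (i + 1) s, ω⟫ ^ 6) := fun ω => by
    have hc : Continuous fun s => 5 * ⟪D i s, ω⟫ ^ 6 + ⟪D (i + 1) s, ω⟫ ^ 6 := by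
      have := h.continuous_inner i ω
      have := h.continuous_inner (i + 1) ω
      fun_prop
    have hnn : ∀ s, 0 ≤ 5 * ⟪D i s, ω⟫ ^ 6 + ⟪D (i + 1) s, ω⟫ ^ 6 := fun s => by positivity
    rw [sobolevBound, ENNReal.ofReal_add (by positivity)
      (intervalIntegral.integral_nonneg hab.le fun s _ => hnn s),
      intervalIntegral.integral_of_le hab.le, ofReal_integral_eq_lintegral_ofReal
        (hc.integrableOn_Ioc) (ae_of_all _ hnn)]
  simp_rw [e1]
  have hm : Continuous fun x : H × ℝ => 5 * ⟪D i x.2, x.1⟫ ^ 6 + ⟪D (i + 1) x.2, x.1⟫ ^ 6 :=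
    (continuous_const.mul ((hcont i).pow 6)).add ((hcont (i + 1)).pow 6)
  rw [lintegral_add_left (by fun_prop)]
  have hswap := lintegral_lintegral_swap (μ := stdGaussian H) (ν := volume.restrict (Set.Ioc a b))
    (f := fun ω s => ENNReal.ofReal (5 * ⟪D i s, ω⟫ ^ 6 + ⟪D (i + 1) s, ω⟫ ^ 6))
    (hm.measurable.ennreal_ofReal.aemeasurable)
  rw [hswap]
  have hin : ∀ s ∈ Set.Icc a b, ∫⁻ ω, ENNReal.ofReal (5 * ⟪D i s, ω⟫ ^ 6 + ⟪D (i + 1) s, ω⟫ ^ 6)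
      ∂(stdGaussian H) ≤ ENNReal.ofReal (6 * (B ^ 6 * sixthMoment)) := fun s hs => by
    have e2 : ∀ ω, ENNReal.ofReal (5 * ⟪D i s, ω⟫ ^ 6 + ⟪D (i + 1) s, ω⟫ ^ 6)
        = ENNReal.ofReal 5 * ENNReal.ofReal (⟪D i s, ω⟫ ^ 6)
          + ENNReal.ofReal (⟪D (i + 1) s, ω⟫ ^ 6) := fun ω => by
      rw [ENNReal.ofReal_add (by positivity) (by positivity), ENNReal.ofReal_mul (by norm_num)]
    simp_rw [e2]
    rw [lintegral_add_left (by fun_prop), lintegral_const_mul _ (by fun_prop)]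
    calc _ ≤ ENNReal.ofReal 5 * ENNReal.ofReal (B ^ 6 * sixthMoment)
          + ENNReal.ofReal (B ^ 6 * sixthMoment) :=
          add_le_add (mul_le_mul' le_rfl (key i (by omega) s hs)) (key (i + 1) (by omega) s hs)
      _ = _ := by
          rw [← ENNReal.ofReal_mul (by norm_num), ← ENNReal.ofReal_add (by positivity)
            (by positivity)]
          congr 1; ring
  have hout : ∫⁻ s in Set.Ioc a b, ∫⁻ ω, ENNReal.ofReal (5 * ⟪D i s, ω⟫ ^ 6
      + ⟪D (i + 1) s, ω⟫ ^ 6) ∂(stdGaussian H) ≤ ENNReal.ofReal (6 * (B ^ 6 * sixthMoment)) := by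
    refine (setLIntegral_mono measurable_const fun s hs => hin s ⟨hs.1.le, hs.2⟩).trans ?_
    rw [setLIntegral_const, Real.volume_Ioc]
    calc _ ≤ ENNReal.ofReal (6 * (B ^ 6 * sixthMoment)) * 1 :=
          mul_le_mul' le_rfl (by simpa using ENNReal.ofReal_le_ofReal hδ)
      _ = _ := mul_one _
  refine (add_le_add (key i (by omega) a ⟨le_rfl, hab.le⟩) hout).trans ?_
  rw [← ENNReal.ofReal_add (by positivity) (by positivity)]
  exact ENNReal.ofReal_le_ofReal (le_of_eq (by ring))

lemma UnitCurve.measure_badSet_le (h : UnitCurve D B T) {i j e : ℕ} (hi : i ≤ 5)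
    (hj : ∀ t ∈ Set.Icc 0 T, 1 ≤ ‖D j t‖ ∧ 1 ≤ ‖D (j + 1) t‖ ∧ ⟪D j t, D (j + 1) t⟫ = 0)
    {a b : ℝ} (ha : 0 ≤ a) (hab : a < b) (hb : b ≤ T) (hδ : b - a ≤ 1) {n : ℕ} (hn : 0 < n) :
    stdGaussian H (badSet D i j e a b n)
      ≤ ENNReal.ofReal (7 * B ^ 6 * sixthMoment * (n : ℝ)⁻¹ ^ 3 + (n : ℝ) ^ 2 * (n : ℝ)⁻¹ ^ (2 * e + 1)) := by
  have hC := sixthMoment_nonneg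
  have hB : 0 ≤ B := zero_le_one.trans h.one_le_bound
  have hn' : (0 : ℝ) < n := by positivity
  rw [ENNReal.ofReal_add (by positivity) (by positivity)]
  refine (measure_union_le _ _).trans (add_le_add ?_ ?_)
  · have h1 := meas_ge_le_lintegral_div (μ := stdGaussian H)
      (f := fun ω => ENNReal.ofReal (sobolevBound D i a b ω))
      (h.continuous_sobolevBound i a b).measurable.ennreal_ofReal.aemeasurable
      (ε := ENNReal.ofReal ((n : ℝ) ^ 3)) (by simp; positivity) ENNReal.ofReal_ne_top
    refine (measure_mono fun ω hω => ?_).trans (h1.trans ?_)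
    · exact ENNReal.ofReal_le_ofReal (le_of_lt hω)
    · refine (ENNReal.div_le_div_right (h.lintegral_sobolevBound_le hi ha hab hb hδ) _).trans ?_
      rw [← ENNReal.ofReal_div_of_pos (by positivity), inv_pow, div_eq_mul_inv]
  · refine (measure_biUnion_finset_le _ _).trans ?_
    have hδn : 0 ≤ (b - a) / n := div_nonneg (by linarith) hn'.le
    have hδn' : (b - a) / n ≤ (n : ℝ)⁻¹ := by
      rw [div_eq_mul_inv]; exact mul_le_of_le_one_left (by positivity) hδ
    have hk : ∀ k ∈ Finset.range n, stdGaussian H {ω |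
        |⟪D j (gridPt a b n k), ω⟫| ≤ √n * ((b - a) / n) ^ (e + 1) ∧
        |⟪D (j + 1) (gridPt a b n k), ω⟫| ≤ √n * ((b - a) / n) ^ e}
        ≤ ENNReal.ofReal (n * (n : ℝ)⁻¹ ^ (2 * e + 1)) := fun k hk => by
      have hg := gridPt_mem hab.le hn (Finset.mem_range.1 hk).le
      obtain ⟨j1, j2, j3⟩ := hj _ ⟨ha.trans hg.1, hg.2.trans hb⟩
      refine (measure_inner_small_le j1 j2 j3 (by positivity) (by positivity)).trans
        (ENNReal.ofReal_le_ofReal ?_)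
      have : √(n : ℝ) * ((b - a) / n) ^ (e + 1) * (√n * ((b - a) / n) ^ e)
          = (√n * √n) * ((b - a) / n) ^ (2 * e + 1) := by ring
      rw [this, mul_self_sqrt hn'.le]
      exact mul_le_mul_of_nonneg_left (pow_le_pow_left₀ hδn hδn' _) hn'.le
    refine (Finset.sum_le_sum hk).trans ?_
    rw [Finset.sum_const, Finset.card_range, nsmul_eq_mul, ← ENNReal.ofReal_natCast n,
      ← ENNReal.ofReal_mul hn'.le]
    exact ENNReal.ofReal_le_ofReal (le_of_eq (by ring))

end

section

open scoped RealInnerProductSpace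

variable {H : Type} [NormedAddCommGroup H] [InnerProductSpace ℝ H] {D : ℕ → ℝ → H} {B T : ℝ}

lemma UnitCurve.encard_zero_le (h : UnitCurve D B T) {a b : ℝ} (hab : a < b)
    {n : ℕ} (hn : 0 < n) {ω : H} (hω : ω ∉ badSet D 4 1 2 a b n) :
    {t | t ∈ Set.Icc a b ∧ ⟪D 1 t, ω⟫ = 0}.encard ≤ (2 * n : ℕ) := by
  simp only [badSet, Set.mem_union, Set.mem_iUnion, not_or, not_exists, Set.mem_ofPred_eq,
    not_lt] at hω
  refine encard_zero_le_of_grid (fun t => h.hasDerivAt_inner 1 t ω)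
    (fun t => h.hasDerivAt_inner 2 t ω) (fun t => h.hasDerivAt_inner 3 t ω) hab hn
    (fun t ht => h.abs_le_sqrt ht hω.1) fun k hk => ?_
  exact hω.2 k (Finset.mem_range.2 hk)

lemma UnitCurve.nondegenerate (h : UnitCurve D B T) {a b : ℝ} (hab : a < b)
    {n : ℕ} (hn : 0 < n) {ω : H} (hω : ω ∉ badSet D 2 0 1 a b n) :
    ∀ t ∈ Set.Icc a b, ⟪D 0 t, ω⟫ = 0 → ⟪D 1 t, ω⟫ ≠ 0 := by
  simp only [badSet, Set.mem_union, Set.mem_iUnion, not_or, not_exists, Set.mem_ofPred_eq,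
    not_lt] at hω
  refine ne_zero_of_grid (fun t => h.hasDerivAt_inner 0 t ω)
    (fun t => h.hasDerivAt_inner 1 t ω) hab hn (fun t ht => h.abs_le_sqrt ht hω.1) fun k hk => ?_
  have := hω.2 k (Finset.mem_range.2 hk)
  simpa only [pow_one] using this

/-- A random variable dominating the square of the number of zeros. -/
def domCount (D : ℕ → ℝ → H) (a b : ℝ) (ω : H) : ENNReal :=
  9 + ∑' n : ℕ, (badSet D 4 1 2 a b (n + 1)).indicator (fun _ => ((8 * n + 16 : ℕ) : ENNReal)) ω

lemma UnitCurve.one_two_spec (h : UnitCurve D B T) : ∀ t ∈ Set.Icc 0 T,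
    1 ≤ ‖D 1 t‖ ∧ 1 ≤ ‖D (1 + 1) t‖ ∧ ⟪D 1 t, D (1 + 1) t⟫ = 0 :=
  fun t ht => ⟨(h.norm_one t ht).ge, h.one_le_norm_two ht, h.inner_one_two ht⟩

lemma UnitCurve.zero_one_spec (h : UnitCurve D B T) : ∀ t ∈ Set.Icc 0 T,
    1 ≤ ‖D 0 t‖ ∧ 1 ≤ ‖D (0 + 1) t‖ ∧ ⟪D 0 t, D (0 + 1) t⟫ = 0 :=
  fun t ht => ⟨(h.norm_zero t ht).ge, (h.norm_one t ht).ge, h.inner_zero_one ht⟩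

lemma le_domCount {a b : ℝ} {ω : H} {m : ℕ} (hm : ∀ j < m, ω ∈ badSet D 4 1 2 a b (j + 1)) :
    ((2 * (m + 1) + 1 : ℕ) : ENNReal) ^ 2 ≤ domCount D a b ω := by
  have hsum : ∀ m : ℕ, (2 * (m + 1) + 1) ^ 2 = 9 + ∑ j ∈ Finset.range m, (8 * j + 16) := fun m => by
    induction m with
    | zero => simp
    | succ k ih => rw [Finset.sum_range_succ, ← add_assoc, ← ih]; ring
  have h1 : ((2 * (m + 1) + 1 : ℕ) : ENNReal) ^ 2
      = 9 + ∑ j ∈ Finset.range m, ((8 * j + 16 : ℕ) : ENNReal) := by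
    rw [← Nat.cast_pow, hsum]; push_cast; rfl
  rw [h1, domCount]
  refine add_le_add le_rfl (le_trans (le_of_eq ?_) (ENNReal.sum_le_tsum (Finset.range m)))
  exact Finset.sum_congr rfl fun j hj => by
    rw [Set.indicator_of_mem (hm j (Finset.mem_range.1 hj))]

variable [FiniteDimensional ℝ H] [MeasurableSpace H] [BorelSpace H]

lemma UnitCurve.ae_exists_notMem_badSet (h : UnitCurve D B T) {i j e : ℕ} (hi : i ≤ 5) (he : 1 ≤ e)
    (hj : ∀ t ∈ Set.Icc 0 T, 1 ≤ ‖D j t‖ ∧ 1 ≤ ‖D (j + 1) t‖ ∧ ⟪D j t, D (j + 1) t⟫ = 0)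
    {a b : ℝ} (ha : 0 ≤ a) (hab : a < b) (hb : b ≤ T) (hδ : b - a ≤ 1) :
    ∀ᵐ ω ∂(stdGaussian H), ∃ n, ω ∉ badSet D i j e a b (n + 1) := by
  have hC := sixthMoment_nonneg
  have hB : 0 ≤ B := zero_le_one.trans h.one_le_bound
  rw [ae_iff]
  refine le_antisymm ?_ bot_le
  have hle : ∀ n : ℕ, stdGaussian H {ω | ¬ ∃ n, ω ∉ badSet D i j e a b (n + 1)}
      ≤ ENNReal.ofReal ((7 * B ^ 6 * sixthMoment + 1) * (1 / ((n : ℝ) + 1))) := fun n => by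
    refine (measure_mono fun ω hω => ?_).trans
      ((h.measure_badSet_le (e := e) hi hj ha hab hb hδ n.succ_pos).trans
        (ENNReal.ofReal_le_ofReal ?_))
    · simp only [Set.mem_ofPred_eq, not_exists, not_not] at hω
      exact hω n
    · push_cast
      rw [one_div]
      set r := ((n : ℝ) + 1)⁻¹ with hr
      have hn1 : (0 : ℝ) < n + 1 := by positivity
      have hr0 : 0 < r := inv_pos.2 hn1
      have hr1 : r ≤ 1 := inv_le_one_of_one_le₀ (by linarith [(Nat.cast_nonneg n : (0 : ℝ) ≤ n)])
      have e1 : r ^ 3 ≤ r := by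
        simpa using pow_le_pow_of_le_one hr0.le hr1 (by norm_num : 1 ≤ 3)
      have e2 : ((n : ℝ) + 1) ^ 2 * r ^ (2 * e + 1) ≤ r := by
        have : r ^ (2 * e + 1) ≤ r ^ 3 := pow_le_pow_of_le_one hr0.le hr1 (by omega)
        calc ((n : ℝ) + 1) ^ 2 * r ^ (2 * e + 1) ≤ ((n : ℝ) + 1) ^ 2 * r ^ 3 :=
              mul_le_mul_of_nonneg_left this (by positivity)
          _ = r := by rw [hr]; field_simp
      have e3 := mul_le_mul_of_nonneg_left e1 (by positivity : 0 ≤ 7 * B ^ 6 * sixthMoment)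
      linarith
  have ht : Filter.Tendsto (fun n : ℕ =>
      ENNReal.ofReal ((7 * B ^ 6 * sixthMoment + 1) * (1 / ((n : ℝ) + 1)))) Filter.atTop
      (nhds 0) := by
    have h1 := (tendsto_one_div_add_atTop_nhds_zero_nat (𝕜 := ℝ)).const_mul
      (7 * B ^ 6 * sixthMoment + 1)
    rw [mul_zero] at h1
    simpa using ENNReal.tendsto_ofReal h1
  exact ge_of_tendsto' ht hle

/-- A bound for the second moment of the number of zeros on a short interval. -/
def momentConst (B : ℝ) : ℝ :=
  9 + ∑' n : ℕ, 16 * (7 * B ^ 6 * sixthMoment + 1) * (1 / ((n : ℝ) + 1) ^ 2)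

lemma UnitCurve.measurable_domCount (h : UnitCurve D B T) (a b : ℝ) :
    Measurable (domCount D a b) := by
  have : Measurable fun ω : H => ∑' n : ℕ, (badSet D 4 1 2 a b (n + 1)).indicator
      (fun _ => ((8 * n + 16 : ℕ) : ENNReal)) ω := Measurable.tsum fun n =>
    measurable_const.indicator (h.measurableSet_badSet 4 1 2 a b (n + 1))
  exact measurable_const.add this

lemma summable_momentConst (B : ℝ) :
    Summable fun n : ℕ => 16 * (7 * B ^ 6 * sixthMoment + 1) * (1 / ((n : ℝ) + 1) ^ 2) := by
  have h1 := (summable_nat_add_iff 1).2 (Real.summable_one_div_nat_pow.2 one_lt_two)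
  push_cast at h1
  exact h1.mul_left _

lemma UnitCurve.lintegral_domCount_le (h : UnitCurve D B T) {a b : ℝ} (ha : 0 ≤ a) (hab : a < b)
    (hb : b ≤ T) (hδ : b - a ≤ 1) :
    ∫⁻ ω, domCount D a b ω ∂(stdGaussian H) ≤ ENNReal.ofReal (momentConst B) := by
  have hC := sixthMoment_nonneg
  have hB : 0 ≤ B := zero_le_one.trans h.one_le_bound
  have hnn : ∀ n : ℕ, 0 ≤ 16 * (7 * B ^ 6 * sixthMoment + 1) * (1 / ((n : ℝ) + 1) ^ 2) :=
    fun n => by positivity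
  simp only [domCount]
  rw [lintegral_add_left measurable_const, lintegral_const, measure_univ, mul_one,
    lintegral_tsum fun n => (measurable_const.indicator
      (h.measurableSet_badSet 4 1 2 a b (n + 1))).aemeasurable, momentConst,
    ENNReal.ofReal_add (by norm_num) (tsum_nonneg hnn),
    ENNReal.ofReal_tsum_of_nonneg hnn (summable_momentConst B)]
  refine add_le_add (by simp) (ENNReal.tsum_le_tsum fun n => ?_)
  rw [lintegral_indicator_const (h.measurableSet_badSet 4 1 2 a b (n + 1))]
  refine (mul_le_mul' le_rfl (h.measure_badSet_le (e := 2) (by norm_num) h.one_two_spec ha hab hb hδ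
    n.succ_pos)).trans ?_
  rw [← ENNReal.ofReal_natCast, ← ENNReal.ofReal_mul (Nat.cast_nonneg _)]
  refine ENNReal.ofReal_le_ofReal ?_
  push_cast
  have hn1 : (0 : ℝ) < n + 1 := by positivity
  have e : 7 * B ^ 6 * sixthMoment * ((n : ℝ) + 1)⁻¹ ^ 3
      + ((n : ℝ) + 1) ^ 2 * ((n : ℝ) + 1)⁻¹ ^ (2 * 2 + 1)
      = (7 * B ^ 6 * sixthMoment + 1) * ((n : ℝ) + 1)⁻¹ ^ 3 := by
    have : ((n : ℝ) + 1) ^ 2 * ((n : ℝ) + 1)⁻¹ ^ (2 * 2 + 1) = ((n : ℝ) + 1)⁻¹ ^ 3 := by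
      norm_num; field_simp
    rw [this]; ring
  rw [e]
  have e2 : 16 * (7 * B ^ 6 * sixthMoment + 1) * (1 / ((n : ℝ) + 1) ^ 2)
      = 16 * ((n : ℝ) + 1) * ((7 * B ^ 6 * sixthMoment + 1) * ((n : ℝ) + 1)⁻¹ ^ 3) := by
    field_simp
  rw [e2]
  exact mul_le_mul_of_nonneg_right (by linarith [(Nat.cast_nonneg n : (0 : ℝ) ≤ n)]) (by positivity)

/-- Almost surely the Kac counting functionals converge, with a common square integrable bound. -/
theorem UnitCurve.ae_kacProp (h : UnitCurve D B T) {a b : ℝ} (ha : 0 ≤ a) (hab : a < b)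
    (hb : b ≤ T) (hδ : b - a ≤ 1) :
    ∀ᵐ ω ∂(stdGaussian H), ⟪D 0 a, ω⟫ ≠ 0 ∧ ⟪D 0 b, ω⟫ ≠ 0 ∧
      ∃ k : ℕ, KacProp (fun t => ⟪D 0 t, ω⟫) (fun t => ⟪D 1 t, ω⟫) a b k ∧
        (k : ENNReal) ^ 2 ≤ domCount D a b ω := by
  have hz : ∀ t ∈ Set.Icc 0 T, ∀ᵐ ω ∂(stdGaussian H), ⟪D 0 t, ω⟫ ≠ 0 := fun t ht => by
    rw [ae_iff]
    simp only [not_not]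
    exact measure_inner_eq_zero (norm_ne_zero_iff.1 (by rw [h.norm_zero t ht]; norm_num))
  filter_upwards [hz a ⟨ha, hab.le.trans hb⟩, hz b ⟨ha.trans hab.le, hb⟩,
    h.ae_exists_notMem_badSet (i := 2) (e := 1) (by norm_num) le_rfl h.zero_one_spec ha hab hb hδ,
    h.ae_exists_notMem_badSet (i := 4) (e := 2) (by norm_num) (by norm_num) h.one_two_spec ha hab
      hb hδ] with ω za zb ⟨n, hn⟩ hex
  refine ⟨za, zb, ?_⟩
  classical
  have hm := Nat.find_spec hex
  have hm' : ∀ j < Nat.find hex, ω ∈ badSet D 4 1 2 a b (j + 1) := fun j hj =>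
    not_not.1 (Nat.find_min hex hj)
  set m := Nat.find hex
  have hcard := h.encard_zero_le hab m.succ_pos hm
  have hcard' : {t | t ∈ Set.Ioo a b ∧ ⟪D 1 t, ω⟫ = 0}.encard ≤ (2 * (m + 1) : ℕ) :=
    (Set.encard_le_encard (t := {t | t ∈ Set.Icc a b ∧ ⟪D 1 t, ω⟫ = 0})
      fun t ht => ⟨Set.Ioo_subset_Icc_self ht.1, ht.2⟩).trans hcard
  have hfin : {t | t ∈ Set.Ioo a b ∧ ⟪D 1 t, ω⟫ = 0}.Finite :=
    Set.finite_of_encard_le_coe hcard'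
  refine ⟨_, kacProp_of_finite (fun t => h.hasDerivAt_inner 0 t ω) (h.continuous_inner 1 ω) _ a b hab
    hfin rfl (h.nondegenerate hab n.succ_pos hn) za zb, ?_⟩
  refine le_trans ?_ (le_domCount hm')
  have : {t | t ∈ Set.Ioo a b ∧ ⟪D 1 t, ω⟫ = 0}.ncard ≤ 2 * (m + 1) := by
    rw [← Nat.cast_le (α := ℕ∞), hfin.cast_ncard_eq]; exact hcard'
  gcongr

end

section

open scoped RealInnerProductSpace

variable {H : Type} [NormedAddCommGroup H] [InnerProductSpace ℝ H]

/-- Intervals in `[0, T]` of positive length at most one. -/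
structure IsCell (T a b : ℝ) : Prop where
  nonneg : 0 ≤ a
  lt : a < b
  le : b ≤ T
  length_le : b - a ≤ 1

/-- The number of zeros on `[a, b]` of the Gaussian function `t ↦ ⟪D 0 t, ω⟫`. -/
def cellCount (D : ℕ → ℝ → H) (a b : ℝ) (ω : H) : ℝ :=
  ((zeroSet (fun t => ⟪D 0 t, ω⟫) a b).ncard : ℝ)

/-- The regularised number of zeros on `[a, b]`. -/
def cellKac (D : ℕ → ℝ → H) (ε a b : ℝ) (ω : H) : ℝ :=
  kacInt (fun t => ⟪D 0 t, ω⟫) (fun t => ⟪D 1 t, ω⟫) ε a b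

/-- A bound for the square of the number of zeros on `[a, b]`. -/
def cellDom (D : ℕ → ℝ → H) (a b : ℝ) (ω : H) : ℝ := (domCount D a b ω).toReal

variable {D : ℕ → ℝ → H} {B T a b a' b' : ℝ}

lemma UnitCurve.continuous_kacIntegrand (h : UnitCurve D B T) (ε : ℝ) :
    Continuous fun x : H × ℝ => tent ε ⟪D 0 x.2, x.1⟫ * |⟪D 1 x.2, x.1⟫| :=
  ((continuous_tent ε).comp (h.continuous_inner_uncurry 0)).mul
    (h.continuous_inner_uncurry 1).abs

lemma UnitCurve.continuous_cellKac (h : UnitCurve D B T) (ε a b : ℝ) :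
    Continuous (cellKac D ε a b) :=
  intervalIntegral.continuous_parametric_intervalIntegral_of_continuous'
    (h.continuous_kacIntegrand ε) a b

lemma cellKac_nonneg {ε : ℝ} (hε : 0 < ε) (hab : a ≤ b) (ω : H) : 0 ≤ cellKac D ε a b ω :=
  intervalIntegral.integral_nonneg hab fun _ _ => mul_nonneg (tent_nonneg hε _) (abs_nonneg _)

variable [FiniteDimensional ℝ H] [MeasurableSpace H] [BorelSpace H]

lemma UnitCurve.ae_domCount_lt_top (h : UnitCurve D B T) (hc : IsCell T a b) :
    ∀ᵐ ω ∂(stdGaussian H), domCount D a b ω < ⊤ := by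
  refine ae_lt_top (h.measurable_domCount a b) ?_
  exact ((h.lintegral_domCount_le hc.nonneg hc.lt hc.le hc.length_le).trans_lt
    ENNReal.ofReal_lt_top).ne

lemma UnitCurve.ae_cell (h : UnitCurve D B T) (hc : IsCell T a b) :
    ∀ᵐ ω ∂(stdGaussian H), cellCount D a b ω ^ 2 ≤ cellDom D a b ω ∧
      (∀ ε > 0, cellKac D ε a b ω ^ 2 ≤ cellDom D a b ω) ∧
      Filter.Tendsto (fun ε => cellKac D ε a b ω) (nhdsWithin 0 (Set.Ioi 0))
        (nhds (cellCount D a b ω)) := by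
  filter_upwards [h.ae_kacProp hc.nonneg hc.lt hc.le hc.length_le, h.ae_domCount_lt_top hc]
    with ω ⟨_, _, k, ⟨h1, _, h3, h4⟩, hk⟩ hlt
  have hk' : (k : ℝ) ^ 2 ≤ cellDom D a b ω := by
    have := ENNReal.toReal_mono hlt.ne hk
    simpa [cellDom] using this
  refine ⟨le_trans ?_ hk', fun ε hε => le_trans ?_ hk', h4⟩
  · unfold cellCount
    have : ((zeroSet (fun t => ⟪D 0 t, ω⟫) a b).ncard : ℝ) ≤ k := by exact_mod_cast h3
    gcongr
  · have := h1 ε hε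
    have h0 := cellKac_nonneg (D := D) hε hc.lt.le ω
    unfold cellKac at h0 ⊢
    gcongr

lemma UnitCurve.ae_endpoints (h : UnitCurve D B T) (hc : IsCell T a b) :
    ∀ᵐ ω ∂(stdGaussian H), ⟪D 0 a, ω⟫ ≠ 0 ∧ ⟪D 0 b, ω⟫ ≠ 0 ∧
      (zeroSet (fun t => ⟪D 0 t, ω⟫) a b).Finite := by
  filter_upwards [h.ae_kacProp hc.nonneg hc.lt hc.le hc.length_le]
    with ω ⟨h0, h1, k, ⟨_, h2, _⟩, _⟩
  exact ⟨h0, h1, h2⟩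

lemma UnitCurve.integrable_cellDom (h : UnitCurve D B T) (hc : IsCell T a b) :
    Integrable (cellDom D a b) (stdGaussian H) :=
  integrable_toReal_of_lintegral_ne_top (h.measurable_domCount a b).aemeasurable
    ((h.lintegral_domCount_le hc.nonneg hc.lt hc.le hc.length_le).trans_lt
      ENNReal.ofReal_lt_top).ne

lemma momentConst_nonneg (B : ℝ) : 0 ≤ momentConst B := by
  have hC := sixthMoment_nonneg
  have : 0 ≤ ∑' n : ℕ, 16 * (7 * B ^ 6 * sixthMoment + 1) * (1 / ((n : ℝ) + 1) ^ 2) :=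
    tsum_nonneg fun n => by positivity
  unfold momentConst; linarith

lemma UnitCurve.integral_cellDom_le (h : UnitCurve D B T) (hc : IsCell T a b) :
    ∫ ω, cellDom D a b ω ∂(stdGaussian H) ≤ momentConst B := by
  unfold cellDom
  rw [integral_toReal (h.measurable_domCount a b).aemeasurable (h.ae_domCount_lt_top hc)]
  exact ENNReal.toReal_le_of_le_ofReal (momentConst_nonneg B)
    (h.lintegral_domCount_le hc.nonneg hc.lt hc.le hc.length_le)

lemma UnitCurve.aestronglyMeasurable_cellCount (h : UnitCurve D B T) (hc : IsCell T a b) :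
    AEStronglyMeasurable (cellCount D a b) (stdGaussian H) := by
  refine aestronglyMeasurable_of_tendsto_ae (nhdsWithin (0 : ℝ) (Set.Ioi 0))
    (f := fun ε => cellKac D ε a b) (fun ε => (h.continuous_cellKac ε a b).aestronglyMeasurable) ?_
  filter_upwards [h.ae_cell hc] with ω hω
  exact hω.2.2

lemma UnitCurve.memLp_cellCount (h : UnitCurve D B T) (hc : IsCell T a b) :
    MemLp (cellCount D a b) 2 (stdGaussian H) := by
  rw [memLp_two_iff_integrable_sq (h.aestronglyMeasurable_cellCount hc)]
  refine (h.integrable_cellDom hc).mono' ((h.aestronglyMeasurable_cellCount hc).pow 2) ?_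
  filter_upwards [h.ae_cell hc] with ω hω
  rw [Real.norm_of_nonneg (sq_nonneg _)]
  exact hω.1

lemma UnitCurve.tendsto_integral_cellKac (h : UnitCurve D B T) (hc : IsCell T a b) :
    Filter.Tendsto (fun ε => ∫ ω, cellKac D ε a b ω ∂(stdGaussian H))
      (nhdsWithin 0 (Set.Ioi 0)) (nhds (∫ ω, cellCount D a b ω ∂(stdGaussian H))) := by
  refine tendsto_integral_filter_of_dominated_convergence (fun ω => 1 + cellDom D a b ω)
    (Filter.Eventually.of_forall fun ε => (h.continuous_cellKac ε a b).aestronglyMeasurable) ?_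
    ((integrable_const _).add (h.integrable_cellDom hc)) ?_
  · filter_upwards [self_mem_nhdsWithin] with ε hε
    filter_upwards [h.ae_cell hc] with ω hω
    have := hω.2.1 ε hε
    rw [Real.norm_of_nonneg (cellKac_nonneg hε hc.lt.le ω)]
    nlinarith [sq_nonneg (cellKac D ε a b ω - 1)]
  · filter_upwards [h.ae_cell hc] with ω hω
    exact hω.2.2

lemma UnitCurve.tendsto_integral_cellKac_mul (h : UnitCurve D B T) (hc : IsCell T a b)
    (hc' : IsCell T a' b') :
    Filter.Tendsto (fun ε => ∫ ω, cellKac D ε a b ω * cellKac D ε a' b' ω ∂(stdGaussian H))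
      (nhdsWithin 0 (Set.Ioi 0))
      (nhds (∫ ω, cellCount D a b ω * cellCount D a' b' ω ∂(stdGaussian H))) := by
  refine tendsto_integral_filter_of_dominated_convergence
    (fun ω => cellDom D a b ω + cellDom D a' b' ω)
    (Filter.Eventually.of_forall fun ε => ((h.continuous_cellKac ε a b).mul
      (h.continuous_cellKac ε a' b')).aestronglyMeasurable) ?_
    ((h.integrable_cellDom hc).add (h.integrable_cellDom hc')) ?_
  · filter_upwards [self_mem_nhdsWithin] with ε hε
    filter_upwards [h.ae_cell hc, h.ae_cell hc'] with ω hω hω'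
    have h1 := hω.2.1 ε hε
    have h2 := hω'.2.1 ε hε
    rw [Real.norm_of_nonneg (mul_nonneg (cellKac_nonneg hε hc.lt.le ω)
      (cellKac_nonneg hε hc'.lt.le ω))]
    nlinarith [sq_nonneg (cellKac D ε a b ω - cellKac D ε a' b' ω),
      sq_nonneg (cellKac D ε a b ω + cellKac D ε a' b' ω)]
  · filter_upwards [h.ae_cell hc, h.ae_cell hc'] with ω hω hω'
    exact hω.2.2.mul hω'.2.2

end

section

open scoped RealInnerProductSpace

lemma abs_integral_swap_sub_le {Ω X : Type*} [MeasurableSpace Ω] [MeasurableSpace X]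
    {μ : Measure Ω} {ν : Measure X} [SFinite μ] [SFinite ν] {F : Ω → X → ℝ}
    (hF : Integrable (Function.uncurry F) (μ.prod ν)) {m e : X → ℝ} (hm : Integrable m ν)
    (he : Integrable e ν) (h : ∀ᵐ x ∂ν, |∫ ω, F ω x ∂μ - m x| ≤ e x) :
    |∫ ω, ∫ x, F ω x ∂ν ∂μ - ∫ x, m x ∂ν| ≤ ∫ x, e x ∂ν := by
  have hK : Integrable (fun x => ∫ ω, F ω x ∂μ) ν := hF.integral_prod_right
  rw [integral_integral_swap hF, ← integral_sub hK hm]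
  exact norm_integral_le_of_norm_le (f := fun x => ∫ ω, F ω x ∂μ - m x) he h

variable {H : Type} [NormedAddCommGroup H] [InnerProductSpace ℝ H]
variable {D : ℕ → ℝ → H} {B T a b a' b' : ℝ}

lemma IsCell.mem_Icc (hc : IsCell T a b) {t : ℝ} (ht : t ∈ Set.Ioc a b) : t ∈ Set.Icc 0 T :=
  ⟨hc.nonneg.trans ht.1.le, ht.2.trans hc.le⟩

lemma UnitCurve.kacIntegrand_le (h : UnitCurve D B T) {ε : ℝ} (hε : 0 < ε) {t : ℝ}
    (ht : t ∈ Set.Icc 0 T) (ω : H) :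
    tent ε ⟪D 0 t, ω⟫ * |⟪D 1 t, ω⟫| ≤ ε⁻¹ * ‖ω‖ := by
  have h1 := tent_le hε ⟪D 0 t, ω⟫
  have h2 : |⟪D 1 t, ω⟫| ≤ ‖ω‖ := by
    have := abs_real_inner_le_norm (D 1 t) ω
    rwa [h.norm_one t ht, one_mul] at this
  exact mul_le_mul h1 h2 (abs_nonneg _) (inv_pos.2 hε).le

/-- Lebesgue measure on the product of two intervals. -/
def rectMeasure (a b a' b' : ℝ) : Measure (ℝ × ℝ) :=
  (volume.restrict (Set.Ioc a b)).prod (volume.restrict (Set.Ioc a' b'))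

instance : IsFiniteMeasure (rectMeasure a b a' b') := by unfold rectMeasure; infer_instance

lemma ae_rectMeasure (a b a' b' : ℝ) :
    ∀ᵐ z ∂(rectMeasure a b a' b'), z.1 ∈ Set.Ioc a b ∧ z.2 ∈ Set.Ioc a' b' := by
  have h1 : ∀ᵐ z ∂(rectMeasure a b a' b'), z.1 ∈ Set.Ioc a b :=
    Measure.quasiMeasurePreserving_fst.ae (ae_restrict_mem measurableSet_Ioc)
  have h2 : ∀ᵐ z ∂(rectMeasure a b a' b'), z.2 ∈ Set.Ioc a' b' :=
    Measure.quasiMeasurePreserving_snd.ae (ae_restrict_mem measurableSet_Ioc)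
  exact h1.and h2

lemma rectMeasure_univ (hab : a ≤ b) (hab' : a' ≤ b') :
    (rectMeasure a b a' b').real Set.univ = (b - a) * (b' - a') := by
  unfold rectMeasure
  rw [← Set.univ_prod_univ, measureReal_prod_prod]
  simp [hab, hab']

lemma integrable_rectMeasure {f : ℝ × ℝ → ℝ} (hf : Continuous f) :
    Integrable f (rectMeasure a b a' b') := by
  obtain ⟨C, hC⟩ := (isCompact_Icc.prod isCompact_Icc :
    IsCompact (Set.Icc a b ×ˢ Set.Icc a' b')).exists_bound_of_continuousOn hf.continuousOn
  refine Integrable.of_bound hf.aestronglyMeasurable C ?_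
  filter_upwards [ae_rectMeasure a b a' b'] with z hz
  exact hC z ⟨Set.Ioc_subset_Icc_self hz.1, Set.Ioc_subset_Icc_self hz.2⟩

lemma integral_rectMeasure {f : ℝ × ℝ → ℝ} (hf : Continuous f) (hab : a ≤ b) (hab' : a' ≤ b') :
    ∫ z, f z ∂(rectMeasure a b a' b') = ∫ t in a..b, ∫ s in a'..b', f (t, s) := by
  have h1 := integrable_rectMeasure (a := a) (b := b) (a' := a') (b' := b') hf
  unfold rectMeasure at h1 ⊢
  rw [integral_prod _ h1, intervalIntegral.integral_of_le hab]
  refine integral_congr_ae (Filter.Eventually.of_forall fun t => ?_)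
  simp only [intervalIntegral.integral_of_le hab']

variable [FiniteDimensional ℝ H] [MeasurableSpace H] [BorelSpace H]

lemma integrable_norm_stdGaussian : Integrable (fun ω : H => ‖ω‖) (stdGaussian H) :=
  (IsGaussian.memLp_id (stdGaussian H) 1 (by simp)).integrable le_rfl |>.norm

lemma integrable_norm_sq_stdGaussian : Integrable (fun ω : H => ‖ω‖ ^ 2) (stdGaussian H) :=
  (IsGaussian.memLp_id (stdGaussian H) 2 (by simp)).integrable_norm_pow (by norm_num)

lemma UnitCurve.integral_cellCount (h : UnitCurve D B T) (hc : IsCell T a b) :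
    ∫ ω, cellCount D a b ω ∂(stdGaussian H) = (b - a) / π := by
  have key : ∀ ε > 0, ε ≤ 1 →
      |∫ ω, cellKac D ε a b ω ∂(stdGaussian H) - (b - a) / π| ≤ (b - a) * ε := fun ε hε hε1 => by
    have hi : Integrable (Function.uncurry fun (ω : H) (t : ℝ) =>
        tent ε ⟪D 0 t, ω⟫ * |⟪D 1 t, ω⟫|)
        ((stdGaussian H).prod (volume.restrict (Set.Ioc a b))) := by
      refine Integrable.mono' ((integrable_norm_stdGaussian.comp_fst _).const_mul ε⁻¹)
        (h.continuous_kacIntegrand ε).aestronglyMeasurable ?_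
      have : ∀ᵐ p : H × ℝ ∂((stdGaussian H).prod (volume.restrict (Set.Ioc a b))),
          p.2 ∈ Set.Ioc a b :=
        Measure.quasiMeasurePreserving_snd.ae (ae_restrict_mem measurableSet_Ioc)
      filter_upwards [this] with p hp
      have h0 := mul_nonneg (tent_nonneg hε ⟪D 0 p.2, p.1⟫) (abs_nonneg ⟪D 1 p.2, p.1⟫)
      rw [Function.uncurry, Real.norm_of_nonneg h0]
      exact h.kacIntegrand_le hε (hc.mem_Icc hp) p.1
    have := abs_integral_swap_sub_le hi (integrable_const (1 / π)) (integrable_const ε) (by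
      filter_upwards [ae_restrict_mem measurableSet_Ioc] with t ht
      have ht' := hc.mem_Icc ht
      exact integral_tent_mul_abs_bounds (h.norm_zero t ht') (h.norm_one t ht')
        (h.inner_zero_one ht') hε hε1)
    simp only [integral_const, smul_eq_mul, measureReal_restrict_apply_univ,
      Real.volume_real_Ioc_of_le hc.lt.le] at this
    rw [mul_one_div] at this
    convert this using 4
    funext ω
    unfold cellKac kacInt
    rw [intervalIntegral.integral_of_le hc.lt.le]
  have h1 := ((h.tendsto_integral_cellKac hc).sub_const ((b - a) / π)).abs
  have h2 : Filter.Tendsto (fun ε : ℝ => (b - a) * ε) (nhdsWithin 0 (Set.Ioi 0)) (nhds 0) := by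
    have : Filter.Tendsto (fun ε : ℝ => (b - a) * ε) (nhds 0) (nhds ((b - a) * 0)) :=
      (continuous_const.mul continuous_id).tendsto 0
    rw [mul_zero] at this
    exact this.mono_left nhdsWithin_le_nhds
  have h3 := le_of_tendsto_of_tendsto h1 h2 (by
    filter_upwards [Ioc_mem_nhdsGT (zero_lt_one' ℝ)] with ε hε
    exact key ε hε.1 hε.2)
  exact sub_eq_zero.1 (abs_nonpos_iff.1 h3)

/-- The leading term of the two-point correlation. -/
def corrMain (D : ℕ → ℝ → H) (z : ℝ × ℝ) : ℝ :=
  ⟪D 0 z.1, D 0 z.2⟫ ^ 2 - ⟪D 0 z.1, D 1 z.2⟫ ^ 2 - ⟪D 1 z.1, D 0 z.2⟫ ^ 2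
    + ⟪D 1 z.1, D 1 z.2⟫ ^ 2

/-- The error term of the two-point correlation. -/
def corrErr (D : ℕ → ℝ → H) (z : ℝ × ℝ) : ℝ :=
  ⟪D 0 z.1, D 0 z.2⟫ ^ 4 + ⟪D 0 z.1, D 1 z.2⟫ ^ 4 + ⟪D 1 z.1, D 0 z.2⟫ ^ 4
    + ⟪D 1 z.1, D 1 z.2⟫ ^ 4

end

section

open scoped RealInnerProductSpace

variable {H : Type} [NormedAddCommGroup H] [InnerProductSpace ℝ H]
variable {D : ℕ → ℝ → H} {B T a b a' b' : ℝ}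

lemma UnitCurve.continuous_entry (h : UnitCurve D B T) (i j : ℕ) :
    Continuous fun z : ℝ × ℝ => ⟪D i z.1, D j z.2⟫ :=
  ((h.continuous i).comp continuous_fst).inner ((h.continuous j).comp continuous_snd)

lemma UnitCurve.continuous_corrMain (h : UnitCurve D B T) : Continuous (corrMain D) :=
  ((((h.continuous_entry 0 0).pow 2).sub ((h.continuous_entry 0 1).pow 2)).sub
    ((h.continuous_entry 1 0).pow 2)).add ((h.continuous_entry 1 1).pow 2)

lemma UnitCurve.continuous_corrErr (h : UnitCurve D B T) : Continuous (corrErr D) :=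
  ((((h.continuous_entry 0 0).pow 4).add ((h.continuous_entry 0 1).pow 4)).add
    ((h.continuous_entry 1 0).pow 4)).add ((h.continuous_entry 1 1).pow 4)

lemma corrErr_nonneg (D : ℕ → ℝ → H) (z : ℝ × ℝ) : 0 ≤ corrErr D z := by
  unfold corrErr; positivity

variable [FiniteDimensional ℝ H] [MeasurableSpace H] [BorelSpace H]

lemma UnitCurve.abs_integral_cellKac_mul_sub_le (h : UnitCurve D B T) (hc : IsCell T a b)
    (hc' : IsCell T a' b') (hsmall : ∀ z : ℝ × ℝ, z.1 ∈ Set.Ioc a b → z.2 ∈ Set.Ioc a' b' →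
      ∀ i ≤ 1, ∀ j ≤ 1, |⟪D i z.1, D j z.2⟫| ≤ 1 / 4) {ε : ℝ} (hε : 0 < ε) (hε1 : ε ≤ 1) :
    |∫ ω, cellKac D ε a b ω * cellKac D ε a' b' ω ∂(stdGaussian H)
      - ∫ z, 1 / π ^ 2 * (1 + corrMain D z / 2) ∂(rectMeasure a b a' b')|
      ≤ ∫ z, (50000 * corrErr D z + 8 * ε) ∂(rectMeasure a b a' b') := by
  let F : H → ℝ × ℝ → ℝ := fun ω z => (tent ε ⟪D 0 z.1, ω⟫ * |⟪D 1 z.1, ω⟫|) *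
    (tent ε ⟪D 0 z.2, ω⟫ * |⟪D 1 z.2, ω⟫|)
  have hFc : Continuous (Function.uncurry F) :=
    ((h.continuous_kacIntegrand ε).comp (f := fun p : H × ℝ × ℝ => (p.1, p.2.1))
      (by fun_prop)).mul
    ((h.continuous_kacIntegrand ε).comp (f := fun p : H × ℝ × ℝ => (p.1, p.2.2)) (by fun_prop))
  have hi : Integrable (Function.uncurry F) ((stdGaussian H).prod (rectMeasure a b a' b')) := by
    refine Integrable.mono' ((integrable_norm_sq_stdGaussian.comp_fst _).const_mul (ε⁻¹ ^ 2))
      hFc.aestronglyMeasurable ?_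
    have : ∀ᵐ p : H × ℝ × ℝ ∂((stdGaussian H).prod (rectMeasure a b a' b')),
        p.2.1 ∈ Set.Ioc a b ∧ p.2.2 ∈ Set.Ioc a' b' :=
      Measure.quasiMeasurePreserving_snd.ae (ae_rectMeasure a b a' b')
    filter_upwards [this] with p hp
    have h1 := mul_nonneg (tent_nonneg hε ⟪D 0 p.2.1, p.1⟫) (abs_nonneg ⟪D 1 p.2.1, p.1⟫)
    have h2 := mul_nonneg (tent_nonneg hε ⟪D 0 p.2.2, p.1⟫) (abs_nonneg ⟪D 1 p.2.2, p.1⟫)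
    have h3 := h.kacIntegrand_le hε (hc.mem_Icc hp.1) p.1
    have h4 := h.kacIntegrand_le hε (hc'.mem_Icc hp.2) p.1
    change ‖_ * _‖ ≤ _
    rw [Real.norm_of_nonneg (mul_nonneg h1 h2)]
    refine (mul_le_mul h3 h4 h2 (h1.trans h3)).trans (le_of_eq (by ring))
  have hm := integrable_rectMeasure (a := a) (b := b) (a' := a') (b' := b')
    (f := fun z => 1 / π ^ 2 * (1 + corrMain D z / 2))
    (continuous_const.mul (continuous_const.add (h.continuous_corrMain.div_const 2)))
  have he := integrable_rectMeasure (a := a) (b := b) (a' := a') (b' := b')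
    (f := fun z => 50000 * corrErr D z + 8 * ε)
    ((continuous_const.mul h.continuous_corrErr).add continuous_const)
  have key := abs_integral_swap_sub_le hi hm he (by
    filter_upwards [ae_rectMeasure a b a' b'] with z hz
    have ht := hc.mem_Icc hz.1
    have hs := hc'.mem_Icc hz.2
    have hsm := hsmall z hz.1 hz.2
    have := abs_integral_pair_sub_le (h.norm_zero _ ht) (h.norm_zero _ hs) (h.norm_one _ ht)
      (h.norm_one _ hs) (h.inner_zero_one ht) (h.inner_zero_one hs) rfl rfl rfl rfl
      (hsm 0 zero_le_one 0 zero_le_one) (hsm 0 zero_le_one 1 le_rfl)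
      (hsm 1 le_rfl 0 zero_le_one) (hsm 1 le_rfl 1 le_rfl) hε hε1
    exact this)
  convert key using 5 with ω
  unfold rectMeasure cellKac kacInt
  rw [intervalIntegral.integral_of_le hc.lt.le, intervalIntegral.integral_of_le hc'.lt.le]
  exact (integral_prod_mul _ _).symm

lemma UnitCurve.abs_cov_sub_le (h : UnitCurve D B T) (hc : IsCell T a b)
    (hc' : IsCell T a' b') (hsmall : ∀ z : ℝ × ℝ, z.1 ∈ Set.Ioc a b → z.2 ∈ Set.Ioc a' b' →
      ∀ i ≤ 1, ∀ j ≤ 1, |⟪D i z.1, D j z.2⟫| ≤ 1 / 4) :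
    |cov[cellCount D a b, cellCount D a' b'; stdGaussian H]
      - 1 / (2 * π ^ 2) * ∫ z, corrMain D z ∂(rectMeasure a b a' b')|
      ≤ 50000 * ∫ z, corrErr D z ∂(rectMeasure a b a' b') := by
  have hm := integrable_rectMeasure (a := a) (b := b) (a' := a') (b' := b') h.continuous_corrMain
  have he := integrable_rectMeasure (a := a) (b := b) (a' := a') (b' := b') h.continuous_corrErr
  have em : ∫ z, 1 / π ^ 2 * (1 + corrMain D z / 2) ∂(rectMeasure a b a' b')
      = (b - a) / π * ((b' - a') / π)
        + 1 / (2 * π ^ 2) * ∫ z, corrMain D z ∂(rectMeasure a b a' b') := by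
    rw [integral_const_mul, integral_add (integrable_const _) (hm.div_const 2),
      integral_div, integral_const, rectMeasure_univ hc.lt.le hc'.lt.le]
    simp only [smul_eq_mul]
    field_simp
  have ee : ∀ ε : ℝ, ∫ z, (50000 * corrErr D z + 8 * ε) ∂(rectMeasure a b a' b')
      = 50000 * ∫ z, corrErr D z ∂(rectMeasure a b a' b') + (b - a) * (b' - a') * (8 * ε) := by
    intro ε
    rw [integral_add (he.const_mul _) (integrable_const _), integral_const_mul, integral_const,
      rectMeasure_univ hc.lt.le hc'.lt.le, smul_eq_mul]
  rw [covariance_eq_sub (h.memLp_cellCount hc) (h.memLp_cellCount hc'), h.integral_cellCount hc,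
    h.integral_cellCount hc']
  have h1 := ((h.tendsto_integral_cellKac_mul hc hc').sub_const
    (∫ z, 1 / π ^ 2 * (1 + corrMain D z / 2) ∂(rectMeasure a b a' b'))).abs
  have h2 : Filter.Tendsto (fun ε : ℝ => 50000 * ∫ z, corrErr D z ∂(rectMeasure a b a' b')
      + (b - a) * (b' - a') * (8 * ε)) (nhdsWithin 0 (Set.Ioi 0))
      (nhds (50000 * ∫ z, corrErr D z ∂(rectMeasure a b a' b'))) := by
    have : Continuous (fun ε : ℝ => 50000 * ∫ z, corrErr D z ∂(rectMeasure a b a' b')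
      + (b - a) * (b' - a') * (8 * ε)) := by fun_prop
    have := this.tendsto 0
    rw [mul_zero, mul_zero, add_zero] at this
    exact this.mono_left nhdsWithin_le_nhds
  have h3 := le_of_tendsto_of_tendsto h1 h2 (by
    filter_upwards [Ioc_mem_nhdsGT (zero_lt_one' ℝ)] with ε hε
    have := h.abs_integral_cellKac_mul_sub_le hc hc' hsmall hε.1 hε.2
    rwa [ee] at this)
  rw [em, ← sub_sub] at h3
  exact h3

end

section

open scoped RealInnerProductSpace

variable {H : Type} [NormedAddCommGroup H] [InnerProductSpace ℝ H]
variable {D : ℕ → ℝ → H} {B T a b a' b' : ℝ}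

lemma UnitCurve.norm_sub_le (h : UnitCurve D B T) {i : ℕ} (hi : i ≤ 1) {t t' : ℝ}
    (ht : t ∈ Set.Icc 0 T) (ht' : t' ∈ Set.Icc 0 T) : ‖D i t - D i t'‖ ≤ B * |t - t'| :=
  (convex_Icc 0 T).norm_image_sub_le_of_norm_hasDerivWithin_le
    (fun x _ => (h.hasDerivAt i x).hasDerivWithinAt) (fun x hx => h.norm_le _ (by omega) x hx)
    ht' ht

lemma UnitCurve.norm_eq_one (h : UnitCurve D B T) {i : ℕ} (hi : i ≤ 1) {t : ℝ}
    (ht : t ∈ Set.Icc 0 T) : ‖D i t‖ = 1 := by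
  interval_cases i
  exacts [h.norm_zero t ht, h.norm_one t ht]

lemma UnitCurve.abs_entry_le (h : UnitCurve D B T) {i j : ℕ} (hi : i ≤ 1) (hj : j ≤ 1) {t s : ℝ}
    (ht : t ∈ Set.Icc 0 T) (hs : s ∈ Set.Icc 0 T) : |⟪D i t, D j s⟫| ≤ 1 := by
  have := abs_real_inner_le_norm (D i t) (D j s)
  rwa [h.norm_eq_one hi ht, h.norm_eq_one hj hs, one_mul] at this

lemma UnitCurve.abs_entry_sub_le (h : UnitCurve D B T) {i j : ℕ} (hi : i ≤ 1) (hj : j ≤ 1)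
    {t s t' s' : ℝ} (ht : t ∈ Set.Icc 0 T) (hs : s ∈ Set.Icc 0 T) (ht' : t' ∈ Set.Icc 0 T)
    (hs' : s' ∈ Set.Icc 0 T) :
    |⟪D i t, D j s⟫ - ⟪D i t', D j s'⟫| ≤ B * |t - t'| + B * |s - s'| := by
  have e : ⟪D i t, D j s⟫ - ⟪D i t', D j s'⟫
      = ⟪D i t - D i t', D j s⟫ + ⟪D i t', D j s - D j s'⟫ := by
    rw [inner_sub_left, inner_sub_right]; ring
  rw [e]
  refine (abs_add_le _ _).trans (add_le_add ?_ ?_)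
  · refine (abs_real_inner_le_norm _ _).trans ?_
    rw [h.norm_eq_one hj hs, mul_one]
    exact h.norm_sub_le hi ht ht'
  · refine (abs_real_inner_le_norm _ _).trans ?_
    rw [h.norm_eq_one hi ht', one_mul]
    exact h.norm_sub_le hj hs hs'

lemma pow_four_le_corrErr (D : ℕ → ℝ → H) {i j : ℕ} (hi : i ≤ 1) (hj : j ≤ 1) (z : ℝ × ℝ) :
    ⟪D i z.1, D j z.2⟫ ^ 4 ≤ corrErr D z := by
  have h1 : 0 ≤ ⟪D 0 z.1, D 0 z.2⟫ ^ 4 := by positivity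
  have h2 : 0 ≤ ⟪D 0 z.1, D 1 z.2⟫ ^ 4 := by positivity
  have h3 : 0 ≤ ⟪D 1 z.1, D 0 z.2⟫ ^ 4 := by positivity
  have h4 : 0 ≤ ⟪D 1 z.1, D 1 z.2⟫ ^ 4 := by positivity
  unfold corrErr
  interval_cases i <;> interval_cases j <;> linarith

lemma UnitCurve.abs_corrMain_le (h : UnitCurve D B T) {z : ℝ × ℝ} (h1 : z.1 ∈ Set.Icc 0 T)
    (h2 : z.2 ∈ Set.Icc 0 T) : |corrMain D z| ≤ 2 := by
  have hb : ∀ i ≤ 1, ∀ j ≤ 1, ⟪D i z.1, D j z.2⟫ ^ 2 ≤ 1 := fun i hi j hj =>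
    (sq_le_one_iff_abs_le_one _).2 (h.abs_entry_le hi hj h1 h2)
  have k1 := hb 0 zero_le_one 0 zero_le_one
  have k2 := hb 0 zero_le_one 1 le_rfl
  have k3 := hb 1 le_rfl 0 zero_le_one
  have k4 := hb 1 le_rfl 1 le_rfl
  have l1 := sq_nonneg ⟪D 0 z.1, D 0 z.2⟫
  have l2 := sq_nonneg ⟪D 0 z.1, D 1 z.2⟫
  have l3 := sq_nonneg ⟪D 1 z.1, D 0 z.2⟫
  have l4 := sq_nonneg ⟪D 1 z.1, D 1 z.2⟫
  unfold corrMain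
  rw [abs_le]; constructor <;> linarith

variable [FiniteDimensional ℝ H] [MeasurableSpace H] [BorelSpace H]

lemma UnitCurve.abs_cov_le (h : UnitCurve D B T) (hc : IsCell T a b) (hc' : IsCell T a' b') :
    |cov[cellCount D a b, cellCount D a' b'; stdGaussian H]| ≤ 2 * momentConst B + 1 := by
  rw [covariance_eq_sub (h.memLp_cellCount hc) (h.memLp_cellCount hc'), h.integral_cellCount hc,
    h.integral_cellCount hc']
  have h1 : |∫ ω, (cellCount D a b * cellCount D a' b') ω ∂(stdGaussian H)|
      ≤ 2 * momentConst B := by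
    have := norm_integral_le_of_norm_le (f := cellCount D a b * cellCount D a' b')
      ((h.integrable_cellDom hc).add (h.integrable_cellDom hc')) (by
        filter_upwards [h.ae_cell hc, h.ae_cell hc'] with ω hω hω'
        have h1 := hω.1
        have h2 := hω'.1
        rw [Pi.add_apply, Pi.mul_apply, Real.norm_eq_abs, abs_le]
        constructor <;> nlinarith [sq_nonneg (cellCount D a b ω - cellCount D a' b' ω),
          sq_nonneg (cellCount D a b ω + cellCount D a' b' ω)])
    rw [integral_add' (h.integrable_cellDom hc) (h.integrable_cellDom hc')] at this
    have k1 := h.integral_cellDom_le hc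
    have k2 := h.integral_cellDom_le hc'
    rw [Real.norm_eq_abs] at this
    linarith
  have hq : ∀ {x y : ℝ}, IsCell T x y → 0 ≤ (y - x) / π ∧ (y - x) / π ≤ 1 := fun {x y} hx =>
    ⟨div_nonneg (sub_nonneg.2 hx.lt.le) pi_pos.le, by
      rw [div_le_one pi_pos]; linarith [hx.length_le, pi_gt_three]⟩
  obtain ⟨p1, p2⟩ := hq hc
  obtain ⟨q1, q2⟩ := hq hc'
  have h2 : |(b - a) / π * ((b' - a') / π)| ≤ 1 := by
    rw [abs_of_nonneg (mul_nonneg p1 q1)]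
    exact mul_le_one₀ p2 q1 q2
  exact (abs_sub _ _).trans (add_le_add h1 h2)

/-- The constant in the comparison of covariances of zero counts on cells of length `≥ ℓ`. -/
def cellConst (B ℓ : ℝ) : ℝ := 50000 + 4096 * (2 * momentConst B + 2) / ℓ ^ 2

lemma cellConst_ge (B ℓ : ℝ) : 50000 ≤ cellConst B ℓ := by
  have := momentConst_nonneg B
  unfold cellConst
  have : 0 ≤ 4096 * (2 * momentConst B + 2) / ℓ ^ 2 := by positivity
  linarith

theorem UnitCurve.abs_cov_sub_le_cellConst (h : UnitCurve D B T) (hc : IsCell T a b)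
    (hc' : IsCell T a' b') {ℓ : ℝ} (hℓ : 0 < ℓ) (hl : ℓ ≤ b - a) (hl' : ℓ ≤ b' - a')
    (hB : 16 * B * (b - a) ≤ 1) (hB' : 16 * B * (b' - a') ≤ 1) :
    |cov[cellCount D a b, cellCount D a' b'; stdGaussian H]
      - 1 / (2 * π ^ 2) * ∫ z, corrMain D z ∂(rectMeasure a b a' b')|
      ≤ cellConst B ℓ * ∫ z, corrErr D z ∂(rectMeasure a b a' b') := by
  have he := integrable_rectMeasure (a := a) (b := b) (a' := a') (b' := b') h.continuous_corrErr
  have hE : 0 ≤ ∫ z, corrErr D z ∂(rectMeasure a b a' b') :=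
    integral_nonneg fun z => corrErr_nonneg D z
  by_cases hs : ∀ z : ℝ × ℝ, z.1 ∈ Set.Ioc a b → z.2 ∈ Set.Ioc a' b' →
      ∀ i ≤ 1, ∀ j ≤ 1, |⟪D i z.1, D j z.2⟫| ≤ 1 / 4
  · exact (h.abs_cov_sub_le hc hc' hs).trans (mul_le_mul_of_nonneg_right (cellConst_ge B ℓ) hE)
  push Not at hs
  obtain ⟨w, hw1, hw2, i, hi, j, hj, hw⟩ := hs
  have hM := momentConst_nonneg B
  have hB1 := h.one_le_bound
  have hlow : ∀ z : ℝ × ℝ, z.1 ∈ Set.Ioc a b ∧ z.2 ∈ Set.Ioc a' b' → 1 / 4096 ≤ corrErr D z := by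
    intro z ⟨hz1, hz2⟩
    have k := h.abs_entry_sub_le hi hj (hc.mem_Icc hw1) (hc'.mem_Icc hw2) (hc.mem_Icc hz1)
      (hc'.mem_Icc hz2)
    have k1 : |w.1 - z.1| ≤ b - a := by
      rw [abs_le]; constructor <;> linarith [hw1.1, hw1.2, hz1.1, hz1.2]
    have k2 : |w.2 - z.2| ≤ b' - a' := by
      rw [abs_le]; constructor <;> linarith [hw2.1, hw2.2, hz2.1, hz2.2]
    have k3 := mul_le_mul_of_nonneg_left k1 (zero_le_one.trans hB1)
    have k4 := mul_le_mul_of_nonneg_left k2 (zero_le_one.trans hB1)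
    have k5 := abs_sub_abs_le_abs_sub ⟪D i w.1, D j w.2⟫ ⟪D i z.1, D j z.2⟫
    have k6 : 1 / 8 ≤ |⟪D i z.1, D j z.2⟫| := by linarith
    have k7 := pow_le_pow_left₀ (by norm_num) k6 4
    rw [Even.pow_abs (by decide)] at k7
    have k8 := pow_four_le_corrErr D hi hj z
    linarith
  have harea := rectMeasure_univ hc.lt.le hc'.lt.le
  have hElow : ℓ ^ 2 / 4096 ≤ ∫ z, corrErr D z ∂(rectMeasure a b a' b') := by
    have := integral_mono_ae (integrable_const (1 / 4096 : ℝ)) he (by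
      filter_upwards [ae_rectMeasure a b a' b'] with z hz
      exact hlow z hz)
    rw [integral_const, harea, smul_eq_mul] at this
    have := mul_le_mul hl hl' hℓ.le (hℓ.le.trans hl)
    nlinarith
  have hmain : |∫ z, corrMain D z ∂(rectMeasure a b a' b')| ≤ 2 := by
    have := norm_integral_le_of_norm_le_const (μ := rectMeasure a b a' b') (f := corrMain D)
      (C := 2) (by
        filter_upwards [ae_rectMeasure a b a' b'] with z hz
        exact h.abs_corrMain_le (hc.mem_Icc hz.1) (hc'.mem_Icc hz.2))
    rw [harea] at this
    have k := mul_le_one₀ hc.length_le (sub_nonneg.2 hc'.lt.le) hc'.length_le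
    rw [Real.norm_eq_abs] at this
    linarith
  have hpi : 1 / (2 * π ^ 2) ≤ 1 / 2 := by
    apply one_div_le_one_div_of_le two_pos
    nlinarith [pi_gt_three]
  have hpi0 : 0 ≤ 1 / (2 * π ^ 2) := by positivity
  have hmain' : |1 / (2 * π ^ 2) * ∫ z, corrMain D z ∂(rectMeasure a b a' b')| ≤ 1 := by
    rw [abs_mul, abs_of_nonneg hpi0]
    calc _ ≤ 1 / 2 * 2 := mul_le_mul hpi hmain (abs_nonneg _) (by norm_num)
      _ = 1 := by norm_num
  have htot := (abs_sub (cov[cellCount D a b, cellCount D a' b'; stdGaussian H])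
    (1 / (2 * π ^ 2) * ∫ z, corrMain D z ∂(rectMeasure a b a' b'))).trans
    (add_le_add (h.abs_cov_le hc hc') hmain')
  refine htot.trans ?_
  have hfac : 2 * momentConst B + 2 ≤
      4096 * (2 * momentConst B + 2) / ℓ ^ 2 * ∫ z, corrErr D z ∂(rectMeasure a b a' b') := by
    calc 2 * momentConst B + 2 = 4096 * (2 * momentConst B + 2) / ℓ ^ 2 * (ℓ ^ 2 / 4096) := by
          field_simp
      _ ≤ _ := mul_le_mul_of_nonneg_left hElow (by positivity)
  unfold cellConst
  rw [add_mul]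
  linarith

end

section

open scoped RealInnerProductSpace

lemma ncard_zeroSet_eq_sum {f : ℝ → ℝ} {g : ℕ → ℝ} (hg : Monotone g) {n : ℕ}
    (hne : ∀ k ≤ n, f (g k) ≠ 0) (hfin : ∀ k < n, (zeroSet f (g k) (g (k + 1))).Finite) :
    (zeroSet f (g 0) (g n)).Finite ∧ (zeroSet f (g 0) (g n)).ncard =
      ∑ k ∈ Finset.range n, (zeroSet f (g k) (g (k + 1))).ncard := by
  induction n with
  | zero =>
    have : zeroSet f (g 0) (g 0) = ∅ := by
      ext t
      simp only [zeroSet, Set.Icc_self, Set.mem_singleton_iff, Set.mem_ofPred_eq,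
        Set.mem_empty_iff_false, iff_false, not_and]
      rintro rfl
      exact hne 0 le_rfl
    simp [this]
  | succ n ih =>
    obtain ⟨h1, h2⟩ := ih (fun k hk => hne k (by omega)) (fun k hk => hfin k (by omega))
    have h3 := hfin n (by omega)
    have hac := hg (Nat.zero_le n)
    have hcb := hg (Nat.le_succ n)
    have h4 := ncard_zeroSet_add hac hcb (hne n (by omega)) h1 h3
    refine ⟨?_, ?_⟩
    · rw [zeroSet_union hac hcb]; exact h1.union h3
    · rw [Finset.sum_range_succ, ← h2]; exact h4

variable {H : Type} [NormedAddCommGroup H] [InnerProductSpace ℝ H]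
variable {D : ℕ → ℝ → H} {B T a b a' b' : ℝ}

lemma sum_integral_rectMeasure {f : ℝ × ℝ → ℝ} (hf : Continuous f) {g : ℕ → ℝ} (hg : Monotone g)
    (n : ℕ) : ∑ i ∈ Finset.range n, ∑ j ∈ Finset.range n,
      ∫ z, f z ∂(rectMeasure (g i) (g (i + 1)) (g j) (g (j + 1)))
      = ∫ t in (g 0)..(g n), ∫ s in (g 0)..(g n), f (t, s) := by
  have hc : ∀ x y : ℝ, Continuous fun t => ∫ s in x..y, f (t, s) := fun x y =>
    intervalIntegral.continuous_parametric_intervalIntegral_of_continuous' (by fun_prop) x y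
  have h1 : ∀ i, ∑ j ∈ Finset.range n,
      ∫ z, f z ∂(rectMeasure (g i) (g (i + 1)) (g j) (g (j + 1)))
      = ∫ t in (g i)..(g (i + 1)), ∫ s in (g 0)..(g n), f (t, s) := fun i => by
    have h2 : ∀ t, ∫ s in (g 0)..(g n), f (t, s)
        = ∑ j ∈ Finset.range n, ∫ s in (g j)..(g (j + 1)), f (t, s) := fun t =>
      (intervalIntegral.sum_integral_adjacent_intervals fun j _ =>
        Continuous.intervalIntegrable (by fun_prop) _ _).symm
    simp only [h2]
    rw [intervalIntegral.integral_finsetSum fun j _ => (hc _ _).intervalIntegrable _ _]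
    exact Finset.sum_congr rfl fun j _ =>
      integral_rectMeasure hf (hg (Nat.le_succ i)) (hg (Nat.le_succ j))
  simp only [h1]
  exact intervalIntegral.sum_integral_adjacent_intervals fun j _ => (hc _ _).intervalIntegrable _ _

variable [FiniteDimensional ℝ H] [MeasurableSpace H] [BorelSpace H]

lemma UnitCurve.ae_cellCount_eq_sum (h : UnitCurve D B T) {g : ℕ → ℝ} (hg : Monotone g) {n : ℕ}
    (hn : 0 < n) (hcell : ∀ k < n, IsCell T (g k) (g (k + 1))) :
    ∀ᵐ ω ∂(stdGaussian H), cellCount D (g 0) (g n) ω =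
      ∑ k ∈ Finset.range n, cellCount D (g k) (g (k + 1)) ω := by
  have hall : ∀ᵐ ω ∂(stdGaussian H), ∀ k : ℕ, k < n → ⟪D 0 (g k), ω⟫ ≠ 0 ∧
      ⟪D 0 (g (k + 1)), ω⟫ ≠ 0 ∧ (zeroSet (fun t => ⟪D 0 t, ω⟫) (g k) (g (k + 1))).Finite := by
    rw [ae_all_iff]
    intro k
    by_cases hk : k < n
    · filter_upwards [h.ae_endpoints (hcell k hk)] with ω hω _ using hω
    · exact Filter.Eventually.of_forall fun ω hk' => absurd hk' hk
  filter_upwards [hall] with ω hω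
  have := (ncard_zeroSet_eq_sum (f := fun t => ⟪D 0 t, ω⟫) hg (n := n) (fun k hk => by
    rcases hk.lt_or_eq with hk | rfl
    · exact (hω k hk).1
    · have := (hω (k - 1) (by omega)).2.1
      rwa [Nat.sub_add_cancel hn] at this) (fun k hk => (hω k hk).2.2)).2
  unfold cellCount
  rw [this]
  push_cast; rfl

theorem UnitCurve.abs_variance_sub_le (h : UnitCurve D B T) {T₀ : ℝ} (hT₀ : 0 < T₀) (hT : T₀ ≤ T) :
    |Var[cellCount D 0 T; stdGaussian H]
      - 1 / (2 * π ^ 2) * ∫ t in (0 : ℝ)..T, ∫ s in (0 : ℝ)..T, corrMain D (t, s)|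
      ≤ cellConst B (T₀ / (16 * B * T₀ + 1)) *
        ∫ t in (0 : ℝ)..T, ∫ s in (0 : ℝ)..T, corrErr D (t, s) := by
  have hB := h.one_le_bound
  have hTp := h.pos
  set n := ⌈16 * B * T⌉₊ with hn
  have hBT : 0 < 16 * B * T := by positivity
  have hn0 : 0 < n := Nat.ceil_pos.2 hBT
  have hnR : (0 : ℝ) < n := by exact_mod_cast hn0
  have hn1 : 16 * B * T ≤ n := Nat.le_ceil _
  have hn2 : (n : ℝ) ≤ 16 * B * T + 1 := (Nat.ceil_lt_add_one hBT.le).le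
  have hstep : ∀ k, gridPt 0 T n (k + 1) = gridPt 0 T n k + T / n := fun k => by
    rw [gridPt_succ, sub_zero]
  have hδ0 : 0 < T / n := by positivity
  have hδB : 16 * B * (T / n) ≤ 1 := by
    rw [← mul_div_assoc, div_le_one hnR]; exact hn1
  have hδ1 : T / n ≤ 1 := by nlinarith
  have hℓ : T₀ / (16 * B * T₀ + 1) ≤ T / n := by
    rw [div_le_div_iff₀ (by positivity) hnR]
    nlinarith
  have hmono : Monotone (gridPt 0 T n) := monotone_nat_of_le_succ fun k => by
    rw [hstep]; linarith
  have hcell : ∀ k < n, IsCell T (gridPt 0 T n k) (gridPt 0 T n (k + 1)) := fun k hk =>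
    ⟨(gridPt_mem hTp.le hn0 hk.le).1, by rw [hstep]; linarith,
      (gridPt_mem hTp.le hn0 hk).2, by rw [hstep]; linarith⟩
  have hlen : ∀ k, gridPt 0 T n (k + 1) - gridPt 0 T n k = T / n := fun k => by
    rw [hstep]; ring
  have hae := h.ae_cellCount_eq_sum hmono hn0 hcell
  rw [gridPt_zero, gridPt_self 0 T hn0] at hae
  have hmem : ∀ k ∈ Finset.range n, MemLp (cellCount D (gridPt 0 T n k) (gridPt 0 T n (k + 1))) 2
      (stdGaussian H) := fun k hk => h.memLp_cellCount (hcell k (Finset.mem_range.1 hk))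
  have hvar : Var[cellCount D 0 T; stdGaussian H] = ∑ i ∈ Finset.range n, ∑ j ∈ Finset.range n,
      cov[cellCount D (gridPt 0 T n i) (gridPt 0 T n (i + 1)),
        cellCount D (gridPt 0 T n j) (gridPt 0 T n (j + 1)); stdGaussian H] := by
    rw [variance_congr hae, ← covariance_self]
    · exact covariance_fun_sum_fun_sum' hmem hmem
    · have := memLp_finsetSum _ hmem
      exact this.aestronglyMeasurable.aemeasurable
  have hm := sum_integral_rectMeasure h.continuous_corrMain hmono n
  have he := sum_integral_rectMeasure h.continuous_corrErr hmono n
  rw [gridPt_zero, gridPt_self 0 T hn0] at hm he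
  rw [hvar, ← hm, ← he, Finset.mul_sum, Finset.mul_sum, ← Finset.sum_sub_distrib]
  refine (Finset.abs_sum_le_sum_abs _ _).trans (Finset.sum_le_sum fun i hi => ?_)
  rw [Finset.mul_sum, Finset.mul_sum, ← Finset.sum_sub_distrib]
  refine (Finset.abs_sum_le_sum_abs _ _).trans (Finset.sum_le_sum fun j hj => ?_)
  have hi' := Finset.mem_range.1 hi
  have hj' := Finset.mem_range.1 hj
  refine h.abs_cov_sub_le_cellConst (hcell i hi') (hcell j hj') (by positivity) ?_ ?_ ?_ ?_
  all_goals rw [hlen]; assumption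

end

section

/-- The number of radians per unit length of a wave of energy `m`, up to a factor `√2`. -/
def freq (m : ℕ) : ℝ := √(2 * π ^ 2 * m)

lemma freq_sq (m : ℕ) : freq m ^ 2 = 2 * π ^ 2 * m := sq_sqrt (by positivity)

lemma freq_pos {m : ℕ} (hm : 0 < m) : 0 < freq m := sqrt_pos.2 (by positivity)

lemma freq_eq (m : ℕ) : freq m = √2 * π * √m := by
  rw [freq, sqrt_mul (by positivity), sqrt_mul (by norm_num), sqrt_sq pi_pos.le]

lemma sqrt_two_mul_pi_le_freq {m : ℕ} (hm : 0 < m) : √2 * π ≤ freq m := by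
  rw [freq_eq]
  have : (1 : ℝ) ≤ √m := one_le_sqrt.2 (by exact_mod_cast hm)
  exact le_mul_of_one_le_right (by positivity) this

lemma one_le_freq {m : ℕ} (hm : 0 < m) : 1 ≤ freq m := by
  have h1 : (1 : ℝ) ≤ √2 := one_le_sqrt.2 one_le_two
  have := sqrt_two_mul_pi_le_freq hm
  nlinarith [pi_gt_three]

/-- The wave of frequency `μ` along the curve `γ`, at speed `(freq m)⁻¹`. -/
def planeWave (m : ℕ) (γ : ℝ → ℝ × ℝ) (μ : ℤ × ℤ) (u : ℝ) : ℂ :=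
  Complex.exp (Complex.I * phase γ μ ((freq m)⁻¹ * u))

/-- The derivative of the phase, normalised by `freq m`. -/
def phaseSpeed (m : ℕ) (γ : ℝ → ℝ × ℝ) (μ : ℤ × ℤ) (t : ℝ) : ℝ :=
  (freq m)⁻¹ * (2 * π * ((μ.1 : ℝ) * (deriv γ t).1 + (μ.2 : ℝ) * (deriv γ t).2))

variable {γ : ℝ → ℝ × ℝ} {m : ℕ} {μ : ℤ × ℤ}

lemma contDiff_phase (hγ : ContDiff ℝ (⊤ : ℕ∞) γ) (μ : ℤ × ℤ) :
    ContDiff ℝ (⊤ : ℕ∞) (phase γ μ) := by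
  unfold phase; fun_prop

lemma contDiff_phase_comp (hγ : ContDiff ℝ (⊤ : ℕ∞) γ) (m : ℕ) (μ : ℤ × ℤ) :
    ContDiff ℝ (⊤ : ℕ∞) fun u => phase γ μ ((freq m)⁻¹ * u) :=
  (contDiff_phase hγ μ).comp (contDiff_const.mul contDiff_id)

lemma contDiff_cexp_I : ContDiff ℝ (⊤ : ℕ∞) fun x : ℝ => Complex.exp (Complex.I * x) :=
  (contDiff_const.mul Complex.ofRealCLM.contDiff).cexp

lemma contDiff_planeWave (hγ : ContDiff ℝ (⊤ : ℕ∞) γ) (m : ℕ) (μ : ℤ × ℤ) :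
    ContDiff ℝ (⊤ : ℕ∞) (planeWave m γ μ) :=
  contDiff_cexp_I.comp (contDiff_phase_comp hγ m μ)

lemma hasDerivAt_cexp_I (x : ℝ) :
    HasDerivAt (fun x : ℝ => Complex.exp (Complex.I * x)) (Complex.I * Complex.exp (Complex.I * x))
      x := by
  have h1 : HasDerivAt (fun x : ℝ => (x : ℂ)) 1 x := Complex.ofRealCLM.hasDerivAt
  exact ((h1.const_mul Complex.I).cexp).congr_deriv (by ring)

lemma norm_iteratedDeriv_cexp_I (k : ℕ) (x : ℝ) :
    ‖iteratedDeriv k (fun x : ℝ => Complex.exp (Complex.I * x)) x‖ = 1 := by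
  have : ∀ k, iteratedDeriv k (fun x : ℝ => Complex.exp (Complex.I * x))
      = fun x : ℝ => Complex.I ^ k * Complex.exp (Complex.I * x) := fun k => by
    induction k with
    | zero => simp
    | succ k ih =>
      rw [iteratedDeriv_succ, ih]
      funext x
      rw [((hasDerivAt_cexp_I x).const_mul (Complex.I ^ k)).deriv]
      ring
  rw [this]
  simp [mul_comm Complex.I, Complex.norm_exp_ofReal_mul_I]

lemma hasDerivAt_iteratedDeriv_planeWave (hγ : ContDiff ℝ (⊤ : ℕ∞) γ) (m : ℕ) (μ : ℤ × ℤ) (j : ℕ)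
    (u : ℝ) : HasDerivAt (iteratedDeriv j (planeWave m γ μ))
      (iteratedDeriv (j + 1) (planeWave m γ μ) u) u := by
  rw [iteratedDeriv_succ]
  exact ((contDiff_planeWave hγ m μ).differentiable_iteratedDeriv j
    (by exact_mod_cast WithTop.coe_lt_top _)).differentiableAt.hasDerivAt

lemma hasDerivAt_planeWave (hγ : ContDiff ℝ (⊤ : ℕ∞) γ) (m : ℕ) (μ : ℤ × ℤ) (u : ℝ) :
    HasDerivAt (planeWave m γ μ)
      (Complex.I * phaseSpeed m γ μ ((freq m)⁻¹ * u) * planeWave m γ μ u) u := by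
  have h1 : HasDerivAt (fun u => phase γ μ ((freq m)⁻¹ * u))
      (phaseSpeed m γ μ ((freq m)⁻¹ * u)) u := by
    have := HasDerivAt.scomp u (hasDerivAt_phase (hγ.hasDerivAt_top ((freq m)⁻¹ * u)) μ)
      ((hasDerivAt_id u).const_mul (freq m)⁻¹)
    refine this.congr_deriv ?_
    simp [phaseSpeed]
  exact ((hasDerivAt_cexp_I _).scomp u h1).congr_deriv (by
    simp only [Complex.real_smul, planeWave]; ring)

lemma iteratedDeriv_one_planeWave (hγ : ContDiff ℝ (⊤ : ℕ∞) γ) (m : ℕ) (μ : ℤ × ℤ) (u : ℝ) :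
    iteratedDeriv 1 (planeWave m γ μ) u =
      Complex.I * phaseSpeed m γ μ ((freq m)⁻¹ * u) * planeWave m γ μ u := by
  rw [iteratedDeriv_one, (hasDerivAt_planeWave hγ m μ u).deriv]

lemma abs_le_sqrt_of_mem_latticeSet (hμ : μ ∈ latticeSet m) :
    |(μ.1 : ℝ)| ≤ √m ∧ |(μ.2 : ℝ)| ≤ √m := by
  have h : (μ.1 : ℝ) ^ 2 + (μ.2 : ℝ) ^ 2 = m := by exact_mod_cast mem_latticeSet.1 hμ
  constructor <;> apply Real.abs_le_sqrt <;> nlinarith [sq_nonneg (μ.1 : ℝ), sq_nonneg (μ.2 : ℝ)]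

lemma exists_derivBound (L : ℝ) (hγ : ContDiff ℝ (⊤ : ℕ∞) γ) :
    ∃ M : ℝ, 1 ≤ M ∧ ∀ i ≤ 6, ∀ t ∈ Set.Icc 0 L,
      |iteratedDeriv i (fun t => (γ t).1) t| + |iteratedDeriv i (fun t => (γ t).2) t| ≤ M := by
  have hc : Continuous fun t => ∑ i ∈ Finset.range 7,
      (|iteratedDeriv i (fun t => (γ t).1) t| + |iteratedDeriv i (fun t => (γ t).2) t|) := by
    have h1 : ContDiff ℝ (⊤ : ℕ∞) fun t => (γ t).1 := by fun_prop
    have h2 : ContDiff ℝ (⊤ : ℕ∞) fun t => (γ t).2 := by fun_prop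
    refine continuous_finsetSum _ fun i _ => ?_
    exact ((h1.continuous_iteratedDeriv i (by exact_mod_cast le_top)).abs).add
      ((h2.continuous_iteratedDeriv i (by exact_mod_cast le_top)).abs)
  obtain ⟨M, hM⟩ := (isCompact_Icc (a := (0 : ℝ)) (b := L)).exists_bound_of_continuousOn
    hc.continuousOn
  refine ⟨max M 1, le_max_right _ _, fun i hi t ht => ?_⟩
  refine le_trans ?_ ((le_abs_self _).trans ((hM t ht).trans (le_max_left _ _)))
  exact Finset.single_le_sum (f := fun i => |iteratedDeriv i (fun t => (γ t).1) t|
    + |iteratedDeriv i (fun t => (γ t).2) t|) (fun i _ => by positivity)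
    (Finset.mem_range.2 (by omega))

lemma iteratedDeriv_phase (hγ : ContDiff ℝ (⊤ : ℕ∞) γ) (μ : ℤ × ℤ) (i : ℕ) (t : ℝ) :
    iteratedDeriv i (phase γ μ) t = 2 * π * ((μ.1 : ℝ) * iteratedDeriv i (fun t => (γ t).1) t
      + (μ.2 : ℝ) * iteratedDeriv i (fun t => (γ t).2) t) := by
  have h1 : ContDiff ℝ i fun t => (μ.1 : ℝ) * (γ t).1 :=
    ContDiff.of_le (n := ((⊤ : ℕ∞) : WithTop ℕ∞)) (by fun_prop) (by exact_mod_cast le_top)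
  have h2 : ContDiff ℝ i fun t => (μ.2 : ℝ) * (γ t).2 :=
    ContDiff.of_le (n := ((⊤ : ℕ∞) : WithTop ℕ∞)) (by fun_prop) (by exact_mod_cast le_top)
  unfold phase
  rw [iteratedDeriv_const_mul_field, iteratedDeriv_fun_add h1.contDiffAt h2.contDiffAt,
    iteratedDeriv_const_mul_field, iteratedDeriv_const_mul_field]

lemma norm_iteratedDeriv_planeWave_le {L M : ℝ} (hγ : ContDiff ℝ (⊤ : ℕ∞) γ) (hM1 : 1 ≤ M)
    (hM : ∀ i ≤ 6, ∀ t ∈ Set.Icc 0 L,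
      |iteratedDeriv i (fun t => (γ t).1) t| + |iteratedDeriv i (fun t => (γ t).2) t| ≤ M)
    (hm : 0 < m) (hμ : μ ∈ latticeSet m) {j : ℕ} (hj : j ≤ 6) {u : ℝ}
    (hu : (freq m)⁻¹ * u ∈ Set.Icc 0 L) :
    ‖iteratedDeriv j (planeWave m γ μ) u‖ ≤ 720 * (2 * M) ^ 6 := by
  have hf := freq_pos hm
  have hD : ∀ i, 1 ≤ i → i ≤ j →
      ‖iteratedFDeriv ℝ i (fun u => phase γ μ ((freq m)⁻¹ * u)) u‖ ≤ (2 * M) ^ i := by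
    intro i hi hij
    rw [norm_iteratedFDeriv_eq_norm_iteratedDeriv,
      iteratedDeriv_comp_const_mul ((contDiff_phase hγ μ).of_le (by exact_mod_cast le_top))]
    change ‖(freq m)⁻¹ ^ i * iteratedDeriv i (phase γ μ) ((freq m)⁻¹ * u)‖ ≤ _
    rw [iteratedDeriv_phase hγ]
    have hb := hM i (by omega) _ hu
    set x := iteratedDeriv i (fun t => (γ t).1) ((freq m)⁻¹ * u)
    set y := iteratedDeriv i (fun t => (γ t).2) ((freq m)⁻¹ * u)
    obtain ⟨h1, h2⟩ := abs_le_sqrt_of_mem_latticeSet hμ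
    have h3 : |(μ.1 : ℝ) * x + μ.2 * y| ≤ √m * M := by
      calc _ ≤ |(μ.1 : ℝ) * x| + |(μ.2 : ℝ) * y| := abs_add_le _ _
        _ ≤ √m * |x| + √m * |y| := by
          rw [abs_mul, abs_mul]; gcongr
        _ = √m * (|x| + |y|) := by ring
        _ ≤ _ := by gcongr
    have h4 : (freq m)⁻¹ ^ i ≤ (freq m)⁻¹ := by
      have := pow_le_pow_of_le_one (inv_pos.2 hf).le (inv_le_one_of_one_le₀ (one_le_freq hm)) hi
      rwa [pow_one] at this
    have h5 : (freq m)⁻¹ * (2 * π * √m) ≤ 2 := by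
      rw [inv_mul_le_iff₀ hf, freq_eq]
      have : (1 : ℝ) ≤ √2 := one_le_sqrt.2 one_le_two
      have : 0 ≤ π * √m := by positivity
      nlinarith
    rw [norm_mul, norm_mul, Real.norm_of_nonneg (by positivity), Real.norm_of_nonneg (by positivity),
      Real.norm_eq_abs]
    calc _ ≤ (freq m)⁻¹ * (2 * π * (√m * M)) := by gcongr
      _ = (freq m)⁻¹ * (2 * π * √m) * M := by ring
      _ ≤ 2 * M := by gcongr
      _ ≤ (2 * M) ^ i := le_self_pow₀ (by linarith) (by omega)
  have := norm_iteratedFDeriv_comp_le contDiff_cexp_I (contDiff_phase_comp hγ m μ)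
    (n := j) (by exact_mod_cast le_top) u (C := 1) (D := 2 * M) (fun i _ => by
      rw [norm_iteratedFDeriv_eq_norm_iteratedDeriv, norm_iteratedDeriv_cexp_I]) hD
  rw [norm_iteratedFDeriv_eq_norm_iteratedDeriv] at this
  refine this.trans ?_
  have hfac : (j.factorial : ℝ) ≤ 720 := by
    exact_mod_cast Nat.factorial_le hj
  rw [mul_one]
  have : (2 * M) ^ j ≤ (2 * M) ^ 6 := pow_le_pow_right₀ (by linarith) hj
  gcongr

end

section

open scoped RealInnerProductSpace ComplexConjugate

/-- The coefficient space of the wave. -/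
abbrev CoefSpace (m : ℕ) : Type := EuclideanSpace ℝ (latticeSet m ⊕ latticeSet m)

/-- The curve of coefficient vectors representing the wave along `γ`, and its derivatives. -/
def waveVec (m : ℕ) (γ : ℝ → ℝ × ℝ) (j : ℕ) (u : ℝ) : CoefSpace m :=
  WithLp.toLp 2 (Sum.elim
    (fun μ => (√(latN m))⁻¹ * (iteratedDeriv j (planeWave m γ μ) u).re)
    (fun μ => (√(latN m))⁻¹ * (iteratedDeriv j (planeWave m γ μ) u).im))

variable {γ : ℝ → ℝ × ℝ} {m : ℕ} {μ : ℤ × ℤ}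

lemma inner_waveVec (m : ℕ) (γ : ℝ → ℝ × ℝ) (i j : ℕ) (t s : ℝ) :
    ⟪waveVec m γ i t, waveVec m γ j s⟫ = (latN m : ℝ)⁻¹ * ∑ μ ∈ latticeSet m,
      (iteratedDeriv i (planeWave m γ μ) t * conj (iteratedDeriv j (planeWave m γ μ) s)).re := by
  have e : (√(latN m : ℝ))⁻¹ * (√(latN m : ℝ))⁻¹ = (latN m : ℝ)⁻¹ := by
    rw [← mul_inv, mul_self_sqrt (Nat.cast_nonneg _)]
  rw [PiLp.inner_apply, Fintype.sum_sum_type, ← Finset.sum_add_distrib, Finset.mul_sum,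
    ← Finset.sum_coe_sort (latticeSet m)]
  refine Finset.sum_congr rfl fun μ _ => ?_
  simp only [waveVec, Sum.elim_inl, Sum.elim_inr, RCLike.inner_apply, conj_trivial, Complex.mul_re,
    Complex.conj_re, Complex.conj_im]
  rw [← e]; ring

lemma hasDerivAt_waveVec (hγ : ContDiff ℝ (⊤ : ℕ∞) γ) (m : ℕ) (j : ℕ) (u : ℝ) :
    HasDerivAt (waveVec m γ j) (waveVec m γ (j + 1) u) u := by
  have h : HasDerivAt (fun u => Sum.elim
      (fun μ : latticeSet m => (√(latN m))⁻¹ * (iteratedDeriv j (planeWave m γ μ) u).re)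
      (fun μ : latticeSet m => (√(latN m))⁻¹ * (iteratedDeriv j (planeWave m γ μ) u).im))
      (Sum.elim
      (fun μ : latticeSet m => (√(latN m))⁻¹ * (iteratedDeriv (j + 1) (planeWave m γ μ) u).re)
      (fun μ : latticeSet m => (√(latN m))⁻¹ * (iteratedDeriv (j + 1) (planeWave m γ μ) u).im)) u := by
    rw [hasDerivAt_pi]
    rintro (μ | μ)
    · have := Complex.reCLM.hasFDerivAt.comp_hasDerivAt u
        (hasDerivAt_iteratedDeriv_planeWave hγ m μ j u)
      exact this.const_mul _
    · have := Complex.imCLM.hasFDerivAt.comp_hasDerivAt u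
        (hasDerivAt_iteratedDeriv_planeWave hγ m μ j u)
      exact this.const_mul _
  exact (EuclideanSpace.equiv (latticeSet m ⊕ latticeSet m) ℝ).symm.toContinuousLinearMap.hasFDerivAt.comp_hasDerivAt u h

lemma norm_sq_waveVec (m : ℕ) (γ : ℝ → ℝ × ℝ) (j : ℕ) (u : ℝ) :
    ‖waveVec m γ j u‖ ^ 2 = (latN m : ℝ)⁻¹ * ∑ μ ∈ latticeSet m,
      ‖iteratedDeriv j (planeWave m γ μ) u‖ ^ 2 := by
  rw [← real_inner_self_eq_norm_sq, inner_waveVec]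
  congr 1
  refine Finset.sum_congr rfl fun μ _ => ?_
  rw [Complex.mul_conj, Complex.ofReal_re, Complex.normSq_eq_norm_sq]

lemma norm_waveVec_le (hN : 0 < latN m) {j : ℕ} {u B : ℝ} (hB : 0 ≤ B)
    (h : ∀ μ ∈ latticeSet m, ‖iteratedDeriv j (planeWave m γ μ) u‖ ≤ B) :
    ‖waveVec m γ j u‖ ≤ B := by
  refine (pow_le_pow_iff_left₀ (norm_nonneg _) hB two_ne_zero).1 ?_
  have hN' : (0 : ℝ) < latN m := by exact_mod_cast hN
  rw [norm_sq_waveVec, inv_mul_le_iff₀ hN']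
  calc _ ≤ ∑ μ ∈ latticeSet m, B ^ 2 := Finset.sum_le_sum fun μ hμ =>
        pow_le_pow_left₀ (norm_nonneg _) (h μ hμ) 2
    _ = _ := by rw [Finset.sum_const, nsmul_eq_mul]; rfl

lemma norm_planeWave (m : ℕ) (γ : ℝ → ℝ × ℝ) (μ : ℤ × ℤ) (u : ℝ) : ‖planeWave m γ μ u‖ = 1 := by
  rw [planeWave, mul_comm, Complex.norm_exp_ofReal_mul_I]

lemma norm_waveVec_zero (hN : 0 < latN m) (γ : ℝ → ℝ × ℝ) (u : ℝ) : ‖waveVec m γ 0 u‖ = 1 := by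
  have hN' : (0 : ℝ) < latN m := by exact_mod_cast hN
  have := norm_sq_waveVec m γ 0 u
  simp only [iteratedDeriv_zero, norm_planeWave, one_pow, Finset.sum_const, nsmul_eq_mul,
    mul_one] at this
  rw [show ((latticeSet m).card : ℝ) = latN m from rfl, inv_mul_cancel₀ hN'.ne'] at this
  exact (pow_eq_one_iff_of_nonneg (norm_nonneg _) two_ne_zero).1 this

lemma sum_latticeSet_neg {M : Type*} [AddCommMonoid M] (m : ℕ) (f : ℤ × ℤ → M) :
    ∑ μ ∈ latticeSet m, f (-μ) = ∑ μ ∈ latticeSet m, f μ := by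
  have hm : ∀ μ, μ ∈ latticeSet m → -μ ∈ latticeSet m := fun μ hμ => by
    rw [mem_latticeSet] at hμ ⊢; simpa using hμ
  exact Finset.sum_nbij' (fun μ => -μ) (fun μ => -μ) hm hm (by simp) (by simp) (by simp)

lemma sum_latticeSet_sq (m : ℕ) (x y : ℝ) :
    ∑ μ ∈ latticeSet m, ((μ.1 : ℝ) * x + (μ.2 : ℝ) * y) ^ 2 =
      latN m * m / 2 * (x ^ 2 + y ^ 2) := by
  have h0 : ∑ μ ∈ latticeSet m, ((μ.1 : ℝ) ^ 2 + (μ.2 : ℝ) ^ 2) = latN m * m := by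
    rw [Finset.sum_congr rfl (g := fun _ => (m : ℝ)) fun μ hμ => by
      exact_mod_cast mem_latticeSet.1 hμ]
    rw [Finset.sum_const, nsmul_eq_mul]; rfl
  have h1 : ∑ μ ∈ latticeSet m, (μ.2 : ℝ) ^ 2 = ∑ μ ∈ latticeSet m, (μ.1 : ℝ) ^ 2 := by
    have hm : ∀ μ, μ ∈ latticeSet m → μ.swap ∈ latticeSet m := fun μ hμ => by
      rw [mem_latticeSet] at hμ ⊢; simpa [add_comm] using hμ
    exact Finset.sum_nbij' Prod.swap Prod.swap hm hm (by simp) (by simp) (by simp)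
  have h2 : ∑ μ ∈ latticeSet m, (μ.1 : ℝ) * μ.2 = 0 := by
    have hm : ∀ μ, μ ∈ latticeSet m → (-μ.1, μ.2) ∈ latticeSet m := fun μ hμ => by
      rw [mem_latticeSet] at hμ ⊢; simpa using hμ
    have : ∑ μ ∈ latticeSet m, (μ.1 : ℝ) * μ.2 = ∑ μ ∈ latticeSet m, -((μ.1 : ℝ) * μ.2) :=
      Finset.sum_nbij' (fun μ => (-μ.1, μ.2)) (fun μ => (-μ.1, μ.2)) hm hm (by simp) (by simp)
        (by simp)
    rw [Finset.sum_neg_distrib] at this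
    linarith
  rw [Finset.sum_add_distrib, h1] at h0
  have e : ∀ μ : ℤ × ℤ, ((μ.1 : ℝ) * x + (μ.2 : ℝ) * y) ^ 2
      = (μ.1 : ℝ) ^ 2 * x ^ 2 + (μ.2 : ℝ) ^ 2 * y ^ 2 + (μ.1 : ℝ) * μ.2 * (2 * x * y) :=
    fun μ => by ring
  simp only [e, Finset.sum_add_distrib, ← Finset.sum_mul, h1, h2]
  have : ∑ μ ∈ latticeSet m, (μ.1 : ℝ) ^ 2 = latN m * m / 2 := by linarith
  rw [this]; ring

lemma sum_phaseSpeed_sq (hm : 0 < m) (hN : 0 < latN m) {t : ℝ}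
    (ht : (deriv γ t).1 ^ 2 + (deriv γ t).2 ^ 2 = 1) :
    (latN m : ℝ)⁻¹ * ∑ μ ∈ latticeSet m, phaseSpeed m γ μ t ^ 2 = 1 := by
  have hN' : (0 : ℝ) < latN m := by exact_mod_cast hN
  have hm' : (0 : ℝ) < m := by exact_mod_cast hm
  have e : ∀ μ : ℤ × ℤ, phaseSpeed m γ μ t ^ 2 = (freq m ^ 2)⁻¹ * (2 * π) ^ 2 *
      ((μ.1 : ℝ) * (deriv γ t).1 + (μ.2 : ℝ) * (deriv γ t).2) ^ 2 := fun μ => by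
    unfold phaseSpeed; rw [inv_eq_one_div, inv_eq_one_div]; ring
  simp only [e, ← Finset.mul_sum, sum_latticeSet_sq, ht, freq_sq]
  field_simp

lemma norm_waveVec_one (hγ : ContDiff ℝ (⊤ : ℕ∞) γ) (hm : 0 < m) (hN : 0 < latN m) {u : ℝ}
    (hu : (deriv γ ((freq m)⁻¹ * u)).1 ^ 2 + (deriv γ ((freq m)⁻¹ * u)).2 ^ 2 = 1) :
    ‖waveVec m γ 1 u‖ = 1 := by
  have := norm_sq_waveVec m γ 1 u
  simp only [iteratedDeriv_one_planeWave hγ, norm_mul, norm_planeWave, Complex.norm_I, one_mul,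
    mul_one, Complex.norm_real, Real.norm_eq_abs, sq_abs] at this
  rw [sum_phaseSpeed_sq hm hN hu] at this
  exact (pow_eq_one_iff_of_nonneg (norm_nonneg _) two_ne_zero).1 this

/-- The bound for the derivatives of the wave, in terms of a bound for those of the curve. -/
def waveBound (M : ℝ) : ℝ := 720 * (2 * M) ^ 6

lemma unitCurve_waveVec {L M : ℝ} (hL : 0 < L) (hγ : ContDiff ℝ (⊤ : ℕ∞) γ)
    (hunit : ∀ t ∈ Set.Icc (0 : ℝ) L, (deriv γ t).1 ^ 2 + (deriv γ t).2 ^ 2 = 1) (hM1 : 1 ≤ M)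
    (hM : ∀ i ≤ 6, ∀ t ∈ Set.Icc 0 L,
      |iteratedDeriv i (fun t => (γ t).1) t| + |iteratedDeriv i (fun t => (γ t).2) t| ≤ M)
    (hm : 0 < m) (hN : 0 < latN m) :
    UnitCurve (waveVec m γ) (waveBound M) (freq m * L) := by
  have hf := freq_pos hm
  have hmem : ∀ u ∈ Set.Icc 0 (freq m * L), (freq m)⁻¹ * u ∈ Set.Icc 0 L := fun u hu =>
    ⟨mul_nonneg (inv_pos.2 hf).le hu.1, (inv_mul_le_iff₀ hf).2 hu.2⟩
  refine ⟨by positivity, fun j t => hasDerivAt_waveVec hγ m j t,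
    fun t _ => norm_waveVec_zero hN γ t,
    fun t ht => norm_waveVec_one hγ hm hN (hunit _ (hmem t ht)), fun j hj t ht => ?_⟩
  refine norm_waveVec_le hN (by unfold waveBound; positivity) fun μ hμ => ?_
  exact norm_iteratedDeriv_planeWave_le hγ hM1 hM hm hμ hj (hmem t ht)

end

section

open scoped RealInnerProductSpace ComplexConjugate

variable {γ : ℝ → ℝ × ℝ} {m : ℕ} {μ : ℤ × ℤ}

/-- The amplitude of the `j`-th derivative of a plane wave along `γ`, for `j ≤ 1`. -/
def waveAmp (m : ℕ) (γ : ℝ → ℝ × ℝ) (j : ℕ) (μ : ℤ × ℤ) (t : ℝ) : ℂ :=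
  (Complex.I * phaseSpeed m γ μ t) ^ j

/-- The derivative of `waveAmp`. -/
def waveAmpDeriv (m : ℕ) (γ : ℝ → ℝ × ℝ) (j : ℕ) (μ : ℤ × ℤ) (t : ℝ) : ℂ :=
  j * (Complex.I * phaseSpeed m γ μ t) ^ (j - 1) * (Complex.I * phaseSpeed m (deriv γ) μ t)

lemma hasDerivAt_phaseSpeed (hγ : ContDiff ℝ (⊤ : ℕ∞) γ) (m : ℕ) (μ : ℤ × ℤ) (t : ℝ) :
    HasDerivAt (phaseSpeed m γ μ) (phaseSpeed m (deriv γ) μ t) t := by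
  have h := hγ.deriv_top.hasDerivAt_top t
  exact (((h.prod_fst.const_mul (μ.1 : ℝ)).add (h.prod_snd.const_mul (μ.2 : ℝ))).const_mul
    (2 * π)).const_mul (freq m)⁻¹

lemma hasDerivAt_waveAmp (hγ : ContDiff ℝ (⊤ : ℕ∞) γ) (m : ℕ) (j : ℕ) (μ : ℤ × ℤ) (t : ℝ) :
    HasDerivAt (waveAmp m γ j μ) (waveAmpDeriv m γ j μ t) t :=
  (((hasDerivAt_phaseSpeed hγ m μ t).ofReal_comp).const_mul Complex.I).fun_pow j

lemma continuous_phaseSpeed (hγ : ContDiff ℝ (⊤ : ℕ∞) γ) (m : ℕ) (μ : ℤ × ℤ) :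
    Continuous (phaseSpeed m γ μ) :=
  continuous_iff_continuousAt.2 fun t => (hasDerivAt_phaseSpeed hγ m μ t).continuousAt

lemma continuous_waveAmpDeriv (hγ : ContDiff ℝ (⊤ : ℕ∞) γ) (m : ℕ) (j : ℕ) (μ : ℤ × ℤ) :
    Continuous (waveAmpDeriv m γ j μ) := by
  have h1 := continuous_phaseSpeed hγ m μ
  have h2 := continuous_phaseSpeed hγ.deriv_top m μ
  unfold waveAmpDeriv
  fun_prop

lemma abs_phaseSpeed_le (hm : 0 < m) (hμ : μ ∈ latticeSet m) {t M : ℝ}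
    (hM : |(deriv γ t).1| + |(deriv γ t).2| ≤ M) : |phaseSpeed m γ μ t| ≤ 2 * M := by
  have hf := freq_pos hm
  obtain ⟨h1, h2⟩ := abs_le_sqrt_of_mem_latticeSet hμ
  have h3 : |(μ.1 : ℝ) * (deriv γ t).1 + μ.2 * (deriv γ t).2| ≤ √m * M := by
    calc _ ≤ |(μ.1 : ℝ) * (deriv γ t).1| + |(μ.2 : ℝ) * (deriv γ t).2| := abs_add_le _ _
      _ ≤ √m * |(deriv γ t).1| + √m * |(deriv γ t).2| := by
        rw [abs_mul, abs_mul]; gcongr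
      _ = √m * (|(deriv γ t).1| + |(deriv γ t).2|) := by ring
      _ ≤ _ := by gcongr
  have hM0 : 0 ≤ M := le_trans (by positivity) hM
  have h5 : (freq m)⁻¹ * (2 * π * √m) ≤ 2 := by
    rw [inv_mul_le_iff₀ hf, freq_eq]
    have : (1 : ℝ) ≤ √2 := one_le_sqrt.2 one_le_two
    have : 0 ≤ π * √m := by positivity
    nlinarith
  rw [phaseSpeed, abs_mul, abs_mul, abs_of_pos (inv_pos.2 hf), abs_of_pos two_pi_pos]
  calc _ ≤ (freq m)⁻¹ * (2 * π * (√m * M)) := by gcongr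
    _ = (freq m)⁻¹ * (2 * π * √m) * M := by ring
    _ ≤ 2 * M := by gcongr

lemma exists_abs_deriv_le (L : ℝ) (hγ : ContDiff ℝ (⊤ : ℕ∞) γ) :
    ∃ M : ℝ, ∀ t ∈ Set.Icc 0 L, |(deriv γ t).1| + |(deriv γ t).2| ≤ M := by
  have hc := hγ.deriv_top.continuous
  obtain ⟨M, hM⟩ := (isCompact_Icc (a := (0 : ℝ)) (b := L)).exists_bound_of_continuousOn
    (f := fun t => |(deriv γ t).1| + |(deriv γ t).2|) (by fun_prop)
  exact ⟨M, fun t ht => (le_abs_self _).trans (hM t ht)⟩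

lemma norm_waveAmp_le {t M : ℝ} (hM1 : 1 ≤ M) {j : ℕ} (hj : j ≤ 1)
    (h1 : |phaseSpeed m γ μ t| ≤ M) (h2 : |phaseSpeed m (deriv γ) μ t| ≤ M) :
    ‖waveAmp m γ j μ t‖ ≤ M ∧ ‖waveAmpDeriv m γ j μ t‖ ≤ M := by
  interval_cases j <;> simp [waveAmp, waveAmpDeriv] <;> constructor <;> linarith

lemma iteratedDeriv_planeWave_eq (hγ : ContDiff ℝ (⊤ : ℕ∞) γ) (hm : 0 < m) {j : ℕ} (hj : j ≤ 1)
    (μ : ℤ × ℤ) (t : ℝ) : iteratedDeriv j (planeWave m γ μ) (freq m * t) =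
      waveAmp m γ j μ t * Complex.exp (Complex.I * phase γ μ t) := by
  have e := inv_mul_cancel_left₀ (freq_pos hm).ne' t
  interval_cases j
  · simp [waveAmp, planeWave, e]
  · rw [iteratedDeriv_one_planeWave hγ]
    simp [waveAmp, planeWave, e]

lemma conj_cexp_phase (γ : ℝ → ℝ × ℝ) (μ : ℤ × ℤ) (t : ℝ) :
    conj (Complex.exp (Complex.I * phase γ μ t)) = Complex.exp (Complex.I * phase γ (-μ) t) := by
  rw [← Complex.exp_conj, map_mul, Complex.conj_I, Complex.conj_ofReal, phase_neg]
  push_cast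
  ring_nf

lemma phaseSpeed_neg (m : ℕ) (γ : ℝ → ℝ × ℝ) (μ : ℤ × ℤ) (t : ℝ) :
    phaseSpeed m γ (-μ) t = -phaseSpeed m γ μ t := by
  simp only [phaseSpeed, Prod.fst_neg, Prod.snd_neg, Int.cast_neg]; ring

lemma conj_waveAmp (m : ℕ) (γ : ℝ → ℝ × ℝ) (j : ℕ) (μ : ℤ × ℤ) (t : ℝ) :
    conj (waveAmp m γ j μ t) = waveAmp m γ j (-μ) t := by
  simp [waveAmp, phaseSpeed_neg]

lemma inner_waveVec_eq (hγ : ContDiff ℝ (⊤ : ℕ∞) γ) (hm : 0 < m) {i j : ℕ} (hi : i ≤ 1)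
    (hj : j ≤ 1) (t s : ℝ) :
    ((⟪waveVec m γ i (freq m * t), waveVec m γ j (freq m * s)⟫ : ℝ) : ℂ) =
      (latN m : ℂ)⁻¹ * ∑ μ ∈ latticeSet m,
        (waveAmp m γ i μ t * Complex.exp (Complex.I * phase γ μ t)) *
          (conj (waveAmp m γ j μ s) * Complex.exp (Complex.I * phase γ (-μ) s)) := by
  set f : ℤ × ℤ → ℂ := fun μ =>
    (waveAmp m γ i μ t * Complex.exp (Complex.I * phase γ μ t)) *
      (conj (waveAmp m γ j μ s) * Complex.exp (Complex.I * phase γ (-μ) s)) with hf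
  have h1 : ∀ μ, iteratedDeriv i (planeWave m γ μ) (freq m * t) *
      conj (iteratedDeriv j (planeWave m γ μ) (freq m * s)) = f μ := fun μ => by
    rw [iteratedDeriv_planeWave_eq hγ hm hi, iteratedDeriv_planeWave_eq hγ hm hj, map_mul,
      conj_cexp_phase]
  have h2 : conj (∑ μ ∈ latticeSet m, f μ) = ∑ μ ∈ latticeSet m, f μ := by
    rw [map_sum, ← sum_latticeSet_neg m f]
    refine Finset.sum_congr rfl fun μ _ => ?_
    simp only [hf, map_mul, conj_cexp_phase, conj_waveAmp, neg_neg]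
  rw [inner_waveVec]
  simp only [h1]
  rw [← Complex.re_sum, Complex.ofReal_mul, Complex.conj_eq_iff_re.1 h2]
  push_cast
  rfl

lemma exists_integral_inner_waveVec_pow_four_le {L : ℝ} (hL : 0 < L)
    (hγ : ContDiff ℝ (⊤ : ℕ∞) γ)
    (hunit : ∀ t ∈ Set.Icc (0 : ℝ) L, (deriv γ t).1 ^ 2 + (deriv γ t).2 ^ 2 = 1)
    (hcurv : ∀ t ∈ Set.Icc (0 : ℝ) L, deriv (deriv γ) t ≠ 0) :
    ∃ C > 0, ∀ m : ℕ, 0 < m → 0 < latN m → ∀ i ≤ 1, ∀ j ≤ 1,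
      ∫ t in (0 : ℝ)..L, ∫ s in (0 : ℝ)..L,
        ⟪waveVec m γ i (freq m * t), waveVec m γ j (freq m * s)⟫ ^ 4 ≤
          C / (latN m * √(latN m)) := by
  obtain ⟨M₁, hM₁⟩ := exists_abs_deriv_le L hγ
  obtain ⟨M₂, hM₂⟩ := exists_abs_deriv_le L hγ.deriv_top
  set K := max 1 (max (2 * M₁) (2 * M₂)) with hK
  have hK1 : 1 ≤ K := le_max_left _ _
  obtain ⟨C, hC, h⟩ := exists_integral_pow_four_le hL hγ hunit hcurv hK1
  refine ⟨C, hC, fun m hm hN i hi j hj => ?_⟩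
  have hb : ∀ j ≤ 1, ∀ μ ∈ latticeSet m, ∀ t ∈ Set.Icc 0 L,
      ‖waveAmp m γ j μ t‖ ≤ K ∧ ‖waveAmpDeriv m γ j μ t‖ ≤ K := fun j hj μ hμ t ht =>
    norm_waveAmp_le hK1 hj
      ((abs_phaseSpeed_le hm hμ (hM₁ t ht)).trans ((le_max_left _ _).trans (le_max_right _ _)))
      ((abs_phaseSpeed_le hm hμ (hM₂ t ht)).trans ((le_max_right _ _).trans (le_max_right _ _)))
  refine h m hm.ne' hN (waveAmp m γ i) (waveAmpDeriv m γ i) (fun μ t => conj (waveAmp m γ j μ t))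
    (fun μ t => conj (waveAmpDeriv m γ j μ t)) (hasDerivAt_waveAmp hγ m i)
    (continuous_waveAmpDeriv hγ m i)
    (fun μ t => Complex.conjCLE.toContinuousLinearMap.hasFDerivAt.comp_hasDerivAt t
      (hasDerivAt_waveAmp hγ m j μ t))
    (fun μ => Complex.continuous_conj.comp (continuous_waveAmpDeriv hγ m j μ)) (hb i hi)
    (fun μ hμ t ht => by simpa only [RCLike.norm_conj] using hb j hj μ hμ t ht) _
    (inner_waveVec_eq hγ hm hi hj)

end

section

open scoped RealInnerProductSpace ComplexConjugate

variable {γ : ℝ → ℝ × ℝ} {m : ℕ}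

/-- The coefficients of the wave as a vector of the coefficient space. -/
def coefEquiv (m : ℕ) : WaveSpace m ≃ᵐ CoefSpace m :=
  (MeasurableEquiv.sumPiEquivProdPi fun _ : latticeSet m ⊕ latticeSet m => ℝ).symm.trans
    (MeasurableEquiv.toLp 2 (latticeSet m ⊕ latticeSet m → ℝ))

lemma coefEquiv_apply (m : ℕ) (ω : WaveSpace m) :
    coefEquiv m ω = WithLp.toLp 2 (Sum.elim ω.1 ω.2) := by
  ext (i | i) <;> rfl

lemma map_coefEquiv (m : ℕ) : (waveMeasure m).map (coefEquiv m) = stdGaussian (CoefSpace m) := by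
  have h := (measurePreserving_sumPiEquivProdPi_symm
    fun _ : latticeSet m ⊕ latticeSet m => gaussianReal 0 1).map_eq
  rw [← map_pi_eq_stdGaussian, ← h, Measure.map_map (by fun_prop) (MeasurableEquiv.measurable _)]
  rfl

lemma wave_eq_inner (hm : 0 < m) (γ : ℝ → ℝ × ℝ) (ω : WaveSpace m) (t : ℝ) :
    wave m ω (γ t) = ⟪waveVec m γ 0 (freq m * t), coefEquiv m ω⟫ := by
  have e := inv_mul_cancel_left₀ (freq_pos hm).ne' t
  rw [PiLp.inner_apply, Fintype.sum_sum_type, ← Finset.sum_add_distrib, wave, Finset.mul_sum]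
  refine Finset.sum_congr rfl fun μ _ => ?_
  simp only [coefEquiv_apply, waveVec, Sum.elim_inl, Sum.elim_inr, RCLike.inner_apply, conj_trivial,
    iteratedDeriv_zero, planeWave, e, mul_comm Complex.I, Complex.exp_ofReal_mul_I_re,
    Complex.exp_ofReal_mul_I_im, phase]
  ring

lemma nodalCount_eq_cellCount (hm : 0 < m) (γ : ℝ → ℝ × ℝ) (L : ℝ) (ω : WaveSpace m) :
    (nodalCount m γ L ω : ℝ) = cellCount (waveVec m γ) 0 (freq m * L) (coefEquiv m ω) := by
  have hf := freq_pos hm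
  rw [nodalCount, cellCount, ← Set.ncard_image_of_injective _ (mul_right_injective₀ hf.ne')]
  congr 2
  ext u
  simp only [zeroSet, Set.mem_image, Set.mem_ofPred_eq, wave_eq_inner hm]
  constructor
  · rintro ⟨t, ⟨⟨h0, h1⟩, h2⟩, rfl⟩
    exact ⟨⟨by positivity, by gcongr⟩, h2⟩
  · rintro ⟨⟨h0, h1⟩, h2⟩
    refine ⟨(freq m)⁻¹ * u, ⟨⟨by positivity, (inv_mul_le_iff₀ hf).2 h1⟩, ?_⟩, ?_⟩
    · rwa [mul_inv_cancel_left₀ hf.ne']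
    · exact mul_inv_cancel_left₀ hf.ne' u

lemma variance_nodalCount (hm : 0 < m) (γ : ℝ → ℝ × ℝ) (L : ℝ) :
    Var[fun ω => (nodalCount m γ L ω : ℝ); waveMeasure m] =
      Var[cellCount (waveVec m γ) 0 (freq m * L); stdGaussian (CoefSpace m)] := by
  rw [← map_coefEquiv, variance_map_equiv]
  exact congrArg (fun X => Var[X; waveMeasure m]) (funext (nodalCount_eq_cellCount hm γ L))

lemma covFn_eq (hm : 0 < m) (γ : ℝ → ℝ × ℝ) (t s : ℝ) :
    covFn m γ t s = ⟪waveVec m γ 0 (freq m * t), waveVec m γ 0 (freq m * s)⟫ := by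
  rw [inner_waveVec, covFn]
  congr 1
  refine Finset.sum_congr rfl fun μ _ => ?_
  have e := fun t => inv_mul_cancel_left₀ (freq_pos hm).ne' t
  simp only [iteratedDeriv_zero, planeWave, e, conj_cexp_phase, phase_neg]
  rw [← Complex.exp_add, ← mul_add, ← Complex.ofReal_add, mul_comm Complex.I,
    Complex.exp_ofReal_mul_I_re]
  congr 1
  simp only [phase, Prod.fst_sub, Prod.snd_sub]
  ring

lemma hasDerivAt_waveVec_freq (hγ : ContDiff ℝ (⊤ : ℕ∞) γ) (m j : ℕ) (t : ℝ) :
    HasDerivAt (fun t => waveVec m γ j (freq m * t)) (freq m • waveVec m γ (j + 1) (freq m * t))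
      t := by
  have := (hasDerivAt_waveVec hγ m j (freq m * t)).scomp t
    ((hasDerivAt_id t).const_mul (freq m))
  rwa [mul_one] at this

lemma deriv_inner_left (hγ : ContDiff ℝ (⊤ : ℕ∞) γ) (m j : ℕ) (v : CoefSpace m) (t : ℝ) :
    deriv (fun t => ⟪waveVec m γ j (freq m * t), v⟫) t =
      freq m * ⟪waveVec m γ (j + 1) (freq m * t), v⟫ := by
  rw [((hasDerivAt_waveVec_freq hγ m j t).inner ℝ (hasDerivAt_const t v)).deriv]
  simp [inner_smul_left]

lemma deriv_inner_right (hγ : ContDiff ℝ (⊤ : ℕ∞) γ) (m j : ℕ) (v : CoefSpace m) (t : ℝ) :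
    deriv (fun t => ⟪v, waveVec m γ j (freq m * t)⟫) t =
      freq m * ⟪v, waveVec m γ (j + 1) (freq m * t)⟫ := by
  simp only [real_inner_comm _ v]
  exact deriv_inner_left hγ m j v t

lemma covFn1_eq (hγ : ContDiff ℝ (⊤ : ℕ∞) γ) (hm : 0 < m) (t s : ℝ) :
    covFn1 m γ t s = freq m * ⟪waveVec m γ 1 (freq m * t), waveVec m γ 0 (freq m * s)⟫ := by
  simp only [covFn1, covFn_eq hm]
  exact deriv_inner_left hγ m 0 _ t

lemma covFn2_eq (hγ : ContDiff ℝ (⊤ : ℕ∞) γ) (hm : 0 < m) (t s : ℝ) :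
    covFn2 m γ t s = freq m * ⟪waveVec m γ 0 (freq m * t), waveVec m γ 1 (freq m * s)⟫ := by
  simp only [covFn2, covFn_eq hm]
  exact deriv_inner_right hγ m 0 _ s

lemma covFn12_eq (hγ : ContDiff ℝ (⊤ : ℕ∞) γ) (hm : 0 < m) (t s : ℝ) :
    covFn12 m γ t s = freq m ^ 2 * ⟪waveVec m γ 1 (freq m * t), waveVec m γ 1 (freq m * s)⟫ := by
  simp only [covFn12, covFn_eq hm, deriv_inner_right hγ]
  rw [deriv_const_mul_field, deriv_inner_left hγ]
  ring

lemma corrMain_waveVec (hγ : ContDiff ℝ (⊤ : ℕ∞) γ) (hm : 0 < m) (t s : ℝ) :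
    covFn m γ t s ^ 2 - covFn1 m γ t s ^ 2 / (2 * π ^ 2 * m)
      - covFn2 m γ t s ^ 2 / (2 * π ^ 2 * m) + covFn12 m γ t s ^ 2 / (2 * π ^ 2 * m) ^ 2 =
      corrMain (waveVec m γ) (freq m * t, freq m * s) := by
  have hf := (freq_pos hm).ne'
  rw [← freq_sq, covFn_eq hm, covFn1_eq hγ hm, covFn2_eq hγ hm, covFn12_eq hγ hm]
  simp only [corrMain]
  field_simp
  ring

lemma integral_integral_comp_mul_left (f : ℝ × ℝ → ℝ) (c L : ℝ) :
    ∫ t in (0 : ℝ)..c * L, ∫ s in (0 : ℝ)..c * L, f (t, s) =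
      c ^ 2 * ∫ t in (0 : ℝ)..L, ∫ s in (0 : ℝ)..L, f (c * t, c * s) := by
  have h : ∀ g : ℝ → ℝ, ∫ t in (0 : ℝ)..c * L, g t = c * ∫ t in (0 : ℝ)..L, g (c * t) := fun g => by
    simp
  rw [h]
  simp only [h fun s => f (_, s), intervalIntegral.integral_const_mul]
  ring

lemma UnitCurve.integral_corrErr_le {H : Type} [NormedAddCommGroup H] [InnerProductSpace ℝ H]
    {D : ℕ → ℝ → H} {B T : ℝ} (h : UnitCurve D B T) {c L K : ℝ}
    (hK : ∀ i ≤ 1, ∀ j ≤ 1,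
      ∫ t in (0 : ℝ)..L, ∫ s in (0 : ℝ)..L, ⟪D i (c * t), D j (c * s)⟫ ^ 4 ≤ K) :
    ∫ t in (0 : ℝ)..L, ∫ s in (0 : ℝ)..L, corrErr D (c * t, c * s) ≤ 4 * K := by
  have hD := h.continuous
  have hc : ∀ i j, Continuous fun z : ℝ × ℝ => ⟪D i (c * z.1), D j (c * z.2)⟫ ^ 4 :=
    fun i j => by fun_prop
  have hs : ∀ i j t, IntervalIntegrable (fun s => ⟪D i (c * t), D j (c * s)⟫ ^ 4) volume 0 L :=
    fun i j t => Continuous.intervalIntegrable (by fun_prop) _ _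
  have ht : ∀ i j, IntervalIntegrable
      (fun t => ∫ s in (0 : ℝ)..L, ⟪D i (c * t), D j (c * s)⟫ ^ 4) volume 0 L := fun i j =>
    (intervalIntegral.continuous_parametric_intervalIntegral_of_continuous'
      (hc i j) 0 L).intervalIntegrable _ _
  have e : ∫ t in (0 : ℝ)..L, ∫ s in (0 : ℝ)..L, corrErr D (c * t, c * s) =
      (∫ t in (0 : ℝ)..L, ∫ s in (0 : ℝ)..L, ⟪D 0 (c * t), D 0 (c * s)⟫ ^ 4) +
      (∫ t in (0 : ℝ)..L, ∫ s in (0 : ℝ)..L, ⟪D 0 (c * t), D 1 (c * s)⟫ ^ 4) +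
      (∫ t in (0 : ℝ)..L, ∫ s in (0 : ℝ)..L, ⟪D 1 (c * t), D 0 (c * s)⟫ ^ 4) +
      (∫ t in (0 : ℝ)..L, ∫ s in (0 : ℝ)..L, ⟪D 1 (c * t), D 1 (c * s)⟫ ^ 4) := by
    rw [← intervalIntegral.integral_add (ht 0 0) (ht 0 1),
      ← intervalIntegral.integral_add ((ht 0 0).add (ht 0 1)) (ht 1 0),
      ← intervalIntegral.integral_add (((ht 0 0).add (ht 0 1)).add (ht 1 0)) (ht 1 1)]
    congr 1
    funext t
    rw [← intervalIntegral.integral_add (hs 0 0 t) (hs 0 1 t),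
      ← intervalIntegral.integral_add ((hs 0 0 t).add (hs 0 1 t)) (hs 1 0 t),
      ← intervalIntegral.integral_add (((hs 0 0 t).add (hs 0 1 t)).add (hs 1 0 t)) (hs 1 1 t)]
    rfl
  rw [e]
  linarith [hK 0 zero_le_one 0 zero_le_one, hK 0 zero_le_one 1 le_rfl,
    hK 1 le_rfl 0 zero_le_one, hK 1 le_rfl 1 le_rfl]

end

/-- Approximate Kac–Rice formula for the variance of nodal intersections. -/
theorem approximate_kac_rice
    (L : ℝ) (hL : 0 < L) (γ : ℝ → ℝ × ℝ) (hγ : ContDiff ℝ (⊤ : ℕ∞) γ)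
    (hunit : ∀ t ∈ Set.Icc (0:ℝ) L, (deriv γ t).1 ^ 2 + (deriv γ t).2 ^ 2 = 1)
    (hcurv : ∀ t ∈ Set.Icc (0:ℝ) L, deriv (deriv γ) t ≠ 0) :
    ∀ ε₀ ∈ Set.Ioo (0:ℝ) 1, ∃ C > 0, ∀ m : ℕ, 0 < m →
      (∃ a b : ℤ, a ^ 2 + b ^ 2 = (m : ℤ)) →
      |tauHat4 m| < 1 - ε₀ →
      |variance (fun ω => (nodalCount m γ L ω : ℝ)) (waveMeasure m)
          - m * ∫ t₁ in (0:ℝ)..L, ∫ t₂ in (0:ℝ)..L,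
              (covFn m γ t₁ t₂ ^ 2
                - covFn1 m γ t₁ t₂ ^ 2 / (2 * π ^ 2 * m)
                - covFn2 m γ t₁ t₂ ^ 2 / (2 * π ^ 2 * m)
                + covFn12 m γ t₁ t₂ ^ 2 / (2 * π ^ 2 * m) ^ 2)|
        ≤ C * m / (latN m : ℝ) ^ ((3:ℝ)/2) := by
  intro ε₀ _
  obtain ⟨M, hM1, hM⟩ := exists_derivBound L hγ
  obtain ⟨K, hK, h4⟩ := exists_integral_inner_waveVec_pow_four_le hL hγ hunit hcurv
  have hT₀ : 0 < √2 * π * L := by positivity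
  set Q := cellConst (waveBound M)
    (√2 * π * L / (16 * waveBound M * (√2 * π * L) + 1)) with hQ
  have hQ0 : 0 < Q := lt_of_lt_of_le (by norm_num) (cellConst_ge _ _)
  refine ⟨Q * (2 * π ^ 2) * (4 * K), by positivity, fun m hm hab _ => ?_⟩
  have hN := latN_pos hab
  have hU := unitCurve_waveVec hL hγ hunit hM1 hM hm hN
  have hmain := hU.abs_variance_sub_le hT₀
    (mul_le_mul_of_nonneg_right (sqrt_two_mul_pi_le_freq hm) hL.le)
  rw [← hQ, integral_integral_comp_mul_left, integral_integral_comp_mul_left, freq_sq,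
    ← variance_nodalCount hm] at hmain
  simp only [corrMain_waveVec hγ hm]
  have e1 : ∀ I : ℝ, 1 / (2 * π ^ 2) * (2 * π ^ 2 * m * I) = m * I := fun I => by
    field_simp
  rw [e1] at hmain
  refine hmain.trans ?_
  have e2 : (latN m : ℝ) ^ ((3 : ℝ) / 2) = latN m * √(latN m) := by
    have hN' : (0 : ℝ) < latN m := by exact_mod_cast hN
    rw [show (3 : ℝ) / 2 = 1 + 1 / 2 by norm_num, Real.rpow_add hN', Real.rpow_one, sqrt_eq_rpow]
  have h5 := hU.integral_corrErr_le (h4 m hm hN)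
  rw [e2]
  calc _ ≤ Q * (2 * π ^ 2 * m * (4 * (K / (latN m * √(latN m))))) := by gcongr
    _ = _ := by ring

end
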